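/- For every plane graph G, the treewidth of the weak dual G⁺ of G satisfies tw(G⁺) ≤ tw(G) + 1. -/

import Mathlib

open Set Bornology

/-- A plane embedding of a simple graph: each vertex is mapped to a point of the
plane, each edge to an injective arc joining its endpoints; arcs avoid vertices
other than their endpoints and distinct arcs meet only at common endpoints. -/
structure PlaneEmbedding {V : Type} (G : SimpleGraph V) where
  pos : V → ℝ × ℝ
  pos_inj : Function.Injective pos
  arc : G.edgeSet → Set (ℝ × ℝ)
  arc_path : ∀ e : G.edgeSet, ∃ u v : V, (e : Sym2 V) = s(u, v) ∧
    ∃ γ : Path (pos u) (pos v), Function.Injective ⇑γ ∧ Set.range ⇑γ = arc e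
  arc_avoid : ∀ (e : G.edgeSet) (w : V), pos w ∈ arc e → w ∈ (e : Sym2 V)
  arc_inter : ∀ e f : G.edgeSet, e ≠ f → ∀ x ∈ arc e ∩ arc f,
    ∃ w : V, w ∈ (e : Sym2 V) ∧ w ∈ (f : Sym2 V) ∧ x = pos w

namespace PlaneEmbedding

variable {V : Type} {G : SimpleGraph V}

/-- The image (drawing) of the plane graph in the plane. -/
def image (P : PlaneEmbedding G) : Set (ℝ × ℝ) :=
  Set.range P.pos ∪ ⋃ e : G.edgeSet, P.arc e

/-- A face: a connected component of the complement of the image. -/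
def IsFace (P : PlaneEmbedding G) (f : Set (ℝ × ℝ)) : Prop :=
  ∃ x, x ∉ P.image ∧ f = connectedComponentIn (P.image)ᶜ x

def IsBoundedFace (P : PlaneEmbedding G) (f : Set (ℝ × ℝ)) : Prop :=
  P.IsFace f ∧ IsBounded f

def IsOuterFace (P : PlaneEmbedding G) (f : Set (ℝ × ℝ)) : Prop :=
  P.IsFace f ∧ ¬ IsBounded f

/-- The vertices on the boundary of a face `f`. -/
def boundaryVerts (P : PlaneEmbedding G) (f : Set (ℝ × ℝ)) : Set V :=
  {v | P.pos v ∈ closure f}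

/-- The weak dual: vertices are the bounded faces, two distinct faces being
adjacent when some edge lies on the boundary of both. -/
def weakDual (P : PlaneEmbedding G) :
    SimpleGraph {f : Set (ℝ × ℝ) // P.IsBoundedFace f} :=
  SimpleGraph.fromRel fun f g =>
    ∃ e : G.edgeSet, P.arc e ⊆ closure f.1 ∧ P.arc e ⊆ closure g.1

/-- `u⁺`: the bounded faces having `u` on their boundary. -/
def uPlus (P : PlaneEmbedding G) (u : V) :
    Set {f : Set (ℝ × ℝ) // P.IsBoundedFace f} :=
  {f | u ∈ P.boundaryVerts f.1}

/-- The drawing of the subgraph induced by a set `S` of vertices. -/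
def subImage (P : PlaneEmbedding G) (S : Set V) : Set (ℝ × ℝ) :=
  P.pos '' S ∪ ⋃ e ∈ {e : G.edgeSet | ∀ w, w ∈ (e : Sym2 V) → w ∈ S}, P.arc e

/-- The vertices of `S` lying on the boundary of the unbounded face of the
drawing of the subgraph induced by `S`. -/
def outerVerts (P : PlaneEmbedding G) (S : Set V) : Set V :=
  {v | v ∈ S ∧ ∃ x, x ∉ P.subImage S ∧
    ¬ IsBounded (connectedComponentIn (P.subImage S)ᶜ x) ∧
    P.pos v ∈ closure (connectedComponentIn (P.subImage S)ᶜ x)}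

/-- Remove the outer layer of vertices. -/
def peel (P : PlaneEmbedding G) (S : Set V) : Set V := S \ P.outerVerts S

/-- The embedding is (at most) `k`-outerplanar: `k` rounds of removing the
vertices on the outer boundary remove every vertex. -/
def OuterplanarAtMost (P : PlaneEmbedding G) (k : ℕ) : Prop :=
  (P.peel)^[k] Set.univ = ∅

/-- The drawing of the subgraph of all edges incident to vertices of `R`. -/
def familyImage (P : PlaneEmbedding G) (R : Set V) : Set (ℝ × ℝ) :=
  ⋃ e ∈ {e : G.edgeSet | ∃ v ∈ R, v ∈ (e : Sym2 V)}, P.arc e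

/-- `R` is nicely embedded: no bounded face of the subgraph of edges incident
to `R` strictly encloses a vertex of `G`. -/
def NicelyEmbedded (P : PlaneEmbedding G) (R : Set V) : Prop :=
  ∀ x, x ∉ P.familyImage R →
    IsBounded (connectedComponentIn (P.familyImage R)ᶜ x) →
    ∀ v : V, P.pos v ∉ connectedComponentIn (P.familyImage R)ᶜ x

/-- The facial completion: add a clique on the boundary of each bounded face. -/
def facialCompletion (P : PlaneEmbedding G) : SimpleGraph V :=
  G ⊔ SimpleGraph.fromRel fun u v =>
    ∃ f, P.IsBoundedFace f ∧ u ∈ P.boundaryVerts f ∧ v ∈ P.boundaryVerts f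

end PlaneEmbedding

/-- A tree together with a bag of vertices at each node. -/
structure Decomp (V : Type) : Type 1 where
  ι : Type
  tree : SimpleGraph ι
  isTree : tree.IsTree
  bag : ι → Set V

/-- `D` is a tree decomposition of `G`. -/
def IsTreeDecomp {V : Type} (G : SimpleGraph V) (D : Decomp V) : Prop :=
  (∀ v, ∃ i, v ∈ D.bag i) ∧
  (∀ u v, G.Adj u v → ∃ i, u ∈ D.bag i ∧ v ∈ D.bag i) ∧
  (∀ v, (D.tree.induce {i | v ∈ D.bag i}).Connected)

/-- The treewidth of a graph. -/
noncomputable def treewidth {V : Type} (G : SimpleGraph V) : ℕ :=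
  sInf {k | ∃ D : Decomp V, IsTreeDecomp G D ∧ ∀ i, (D.bag i).ncard ≤ k + 1}

/-- `D` is an embedded tree decomposition of the plane graph given by `P`. -/
def IsEmDecomp {V : Type} {G : SimpleGraph V} (P : PlaneEmbedding G)
    (D : Decomp V) : Prop :=
  IsTreeDecomp G D ∧ ∀ f, P.IsBoundedFace f → ∃ i, P.boundaryVerts f ⊆ D.bag i

/-- The em-width of a plane graph. -/
noncomputable def emwidth {V : Type} {G : SimpleGraph V}
    (P : PlaneEmbedding G) : ℕ :=
  sInf {k | ∃ D : Decomp V, IsEmDecomp P D ∧ ∀ i, (D.bag i).ncard ≤ k + 1}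

/-- A cut vertex: its removal disconnects two vertices that were connected. -/
def SimpleGraph.IsCutVertex {V : Type} (G : SimpleGraph V) (u : V) : Prop :=
  ∃ x y, ∃ (hx : x ≠ u) (hy : y ≠ u), G.Reachable x y ∧
    ¬ (G.induce {v | v ≠ u}).Reachable ⟨x, hx⟩ ⟨y, hy⟩

/-- An `r`-family: `r` vertices of degree 2 sharing the same two neighbors. -/
def IsRFamily {V : Type} (G : SimpleGraph V) (R : Set V) (r : ℕ) : Prop :=
  R.ncard = r ∧ ∃ a b : V, a ≠ b ∧ ∀ v ∈ R, G.neighborSet v = {a, b}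

section

open Topology unitInterval

/-- A continuous logarithm of `f` exists on `s`. -/
def HasLog {X : Type*} [TopologicalSpace X] (f : X → ℂ) (s : Set X) : Prop :=
  ∃ g : X → ℂ, ContinuousOn g s ∧ ∀ x ∈ s, Complex.exp (g x) = f x

theorem exists_log_of_homotopy {X : Type*} [TopologicalSpace X] (H : I × X → ℂ)
    (hH : Continuous H) (hne : ∀ p, H p ≠ 0) (g0 : X → ℂ) (hg0 : Continuous g0)
    (h0 : ∀ x, Complex.exp (g0 x) = H (0, x)) :
    ∃ g : X → ℂ, Continuous g ∧ ∀ x, Complex.exp (g x) = H (1, x) := by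
  let H' : C(I × X, {z : ℂ // z ≠ 0}) := ⟨fun p => ⟨H p, hne p⟩, by fun_prop⟩
  let f : C(X, ℂ) := ⟨g0, hg0⟩
  have H0 : ∀ a, H' (0, a) = (fun z : ℂ ↦ (⟨_, z.exp_ne_zero⟩ : {z : ℂ // z ≠ 0})) (f a) := by
    intro a; apply Subtype.ext; exact (h0 a).symm
  let L := Complex.isCoveringMap_exp.liftHomotopy H' f H0
  refine ⟨fun x => L (1, x), by fun_prop, fun x => ?_⟩
  have := congrFun (Complex.isCoveringMap_exp.liftHomotopy_lifts H' f H0) (1, x)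
  exact congrArg Subtype.val this

theorem HasLog.mono {X : Type*} [TopologicalSpace X] {f : X → ℂ} {s t : Set X}
    (h : HasLog f t) (hst : s ⊆ t) : HasLog f s := by
  obtain ⟨g, hg, hx⟩ := h
  exact ⟨g, hg.mono hst, fun x hxs => hx x (hst hxs)⟩

theorem HasLog.congr {X : Type*} [TopologicalSpace X] {f f' : X → ℂ} {s : Set X}
    (h : HasLog f s) (hst : ∀ x ∈ s, f x = f' x) : HasLog f' s := by
  obtain ⟨g, hg, hx⟩ := h
  exact ⟨g, hg, fun x hxs => (hx x hxs).trans (hst x hxs)⟩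

theorem HasLog.mul {X : Type*} [TopologicalSpace X] {f f' : X → ℂ} {s : Set X}
    (h : HasLog f s) (h' : HasLog f' s) : HasLog (fun x => f x * f' x) s := by
  obtain ⟨g, hg, hx⟩ := h
  obtain ⟨g', hg', hx'⟩ := h'
  exact ⟨fun x => g x + g' x, hg.add hg', fun x hxs => by
    rw [Complex.exp_add, hx x hxs, hx' x hxs]⟩

theorem HasLog.zpow {X : Type*} [TopologicalSpace X] {f : X → ℂ} {s : Set X}
    (h : HasLog f s) (m : ℤ) : HasLog (fun x => f x ^ m) s := by
  obtain ⟨g, hg, hx⟩ := h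
  exact ⟨fun x => m * g x, continuousOn_const.mul hg, fun x hxs => by
    rw [Complex.exp_int_mul, hx x hxs]⟩

theorem HasLog.comp {X Y : Type*} [TopologicalSpace X] [TopologicalSpace Y] {f : X → ℂ}
    {s : Set X} (h : HasLog f s) {φ : Y → X} {t : Set Y} (hφ : ContinuousOn φ t)
    (hm : MapsTo φ t s) : HasLog (fun y => f (φ y)) t := by
  obtain ⟨g, hg, hx⟩ := h
  exact ⟨fun y => g (φ y), hg.comp hφ hm, fun y hy => hx _ (hm hy)⟩

theorem hasLog_const {X : Type*} [TopologicalSpace X] {c : ℂ} (hc : c ≠ 0) (s : Set X) :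
    HasLog (fun _ => c) s :=
  ⟨fun _ => Complex.log c, continuousOn_const, fun _ _ => Complex.exp_log hc⟩

/-- A continuous nonvanishing function on the plane has a logarithm. -/
theorem hasLog_univ (f : ℂ → ℂ) (hf : Continuous f) (hne : ∀ z, f z ≠ 0) : HasLog f univ := by
  obtain ⟨g, hg, h⟩ := exists_log_of_homotopy (fun p : I × ℂ => f (p.1 * p.2))
    (by fun_prop) (fun p => hne _) (fun _ => Complex.log (f 0)) (by fun_prop)
    (fun x => by simp [Complex.exp_log (hne 0)])
  exact ⟨g, hg.continuousOn, fun x _ => by simpa using h x⟩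

theorem hasLog_unitInterval (f : I → ℂ) (hf : Continuous f) (hne : ∀ z, f z ≠ 0) :
    HasLog f univ := by
  obtain ⟨g, hg, h⟩ := exists_log_of_homotopy (fun p : I × I => f (p.1 * p.2))
    (by fun_prop) (fun p => hne _) (fun _ => Complex.log (f 0)) (by fun_prop)
    (fun x => by simp [Complex.exp_log (hne 0)])
  exact ⟨g, hg.continuousOn, fun x _ => by simpa using h x⟩

/-- Moving `p` to `q` along a path avoiding `A` gives a logarithm on `A`. -/
theorem hasLog_of_joinedIn {A : Set ℂ} {p q : ℂ} (h : JoinedIn Aᶜ p q) :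
    HasLog (fun z => (z - p) / (z - q)) A := by
  obtain ⟨γ, hγ⟩ := h
  have key : ∀ (t : I) (a : A), (a : ℂ) - γ t ≠ 0 := fun t a h0 =>
    hγ t (by rw [← sub_eq_zero.1 h0]; exact a.2)
  obtain ⟨g, hg, hx⟩ := exists_log_of_homotopy
    (fun x : I × A => (((x.2 : ℂ) - p) / (x.2 - γ x.1)))
    (by
      refine Continuous.div (by fun_prop) (by fun_prop) (fun x => key _ _))
    (fun x => div_ne_zero (by simpa using key 0 x.2) (key _ _)) (fun _ => 0) (by fun_prop)
    (fun x => by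
      have := key 0 x
      simp only [γ.source] at this
      simp [this])
  refine ⟨fun z => by classical exact if h : z ∈ A then g ⟨z, h⟩ else 0, ?_, fun z hz => ?_⟩
  · rw [continuousOn_iff_continuous_domRestrict]
    convert! hg using 1
    ext x; simp
  · simpa [hz] using hx ⟨z, hz⟩

/-- Logarithms of the same function on a preconnected set differ by a constant. -/
theorem log_diff_const {X : Type*} [TopologicalSpace X] {s : Set X} (hs : IsPreconnected s)
    {f g : X → ℂ} (hf : ContinuousOn f s) (hg : ContinuousOn g s)
    (h : ∀ x ∈ s, Complex.exp (f x) = Complex.exp (g x)) :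
    ∃ n : ℤ, ∀ x ∈ s, f x = g x + n * (2 * Real.pi * Complex.I) := by
  rcases s.eq_empty_or_nonempty with rfl | ⟨x0, hx0⟩
  · exact ⟨0, by simp⟩
  obtain ⟨n, hn⟩ := Complex.exp_eq_exp_iff_exists_int.1 (h x0 hx0)
  refine ⟨n, fun x hx => ?_⟩
  have := (Complex.isCoveringMap_exp.isSeparatedMap).constOn_of_comp
    Complex.isCoveringMap_exp.isLocalHomeomorph.isLocallyInjective hs (hf.sub hg)
    (fun a ha a' ha' => by
      apply Subtype.ext
      simp only [Pi.sub_apply, Complex.exp_sub, h a ha, h a' ha']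
      simp) hx hx0
  simp only [Pi.sub_apply] at this
  linear_combination this + hn

theorem hasLog_union_of_eq_add_const {X : Type*} [TopologicalSpace X] {f : X → ℂ} {s t : Set X}
    (hu : ∀ F : X → ℂ, ContinuousOn F s → ContinuousOn F t → ContinuousOn F (s ∪ t))
    {g g' : X → ℂ} (hg : ContinuousOn g s) (hx : ∀ x ∈ s, Complex.exp (g x) = f x)
    (hg' : ContinuousOn g' t) (hx' : ∀ x ∈ t, Complex.exp (g' x) = f x) {n : ℤ}
    (hn : ∀ x ∈ s ∩ t, g x = g' x + n * (2 * Real.pi * Complex.I)) : HasLog f (s ∪ t) := by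
  classical
  let F : X → ℂ := fun x => if x ∈ s then g x else g' x + n * (2 * Real.pi * Complex.I)
  have e1 : EqOn F g s := fun x hx0 => by simp [F, hx0]
  have e2 : EqOn F (fun x => g' x + n * (2 * Real.pi * Complex.I)) t := fun x hx0 => by
    by_cases hxs : x ∈ s
    · simp [F, hxs, hn x ⟨hxs, hx0⟩]
    · simp [F, hxs]
  refine ⟨F, hu F (hg.congr e1) ((hg'.add continuousOn_const).congr e2), ?_⟩
  rintro x (hxs | hxt)
  · rw [e1 hxs, hx x hxs]
  · rw [e2 hxt]
    simp only
    rw [Complex.exp_periodic.int_mul n, hx' x hxt]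

theorem HasLog.union {X : Type*} [TopologicalSpace X] {f : X → ℂ} {s t : Set X}
    (hu : ∀ F : X → ℂ, ContinuousOn F s → ContinuousOn F t → ContinuousOn F (s ∪ t))
    (hst : IsPreconnected (s ∩ t)) (h : HasLog f s) (h' : HasLog f t) : HasLog f (s ∪ t) := by
  obtain ⟨g, hg, hx⟩ := h
  obtain ⟨g', hg', hx'⟩ := h'
  obtain ⟨n, hn⟩ := log_diff_const hst (hg.mono inter_subset_left) (hg'.mono inter_subset_right)
    (fun x hx0 => by rw [hx x hx0.1, hx' x hx0.2])
  exact hasLog_union_of_eq_add_const hu hg hx hg' hx' hn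

theorem not_hasLog_sphere (p : ℂ) {R : ℝ} (hR : 0 < R) {m : ℤ} (hm : m ≠ 0) :
    ¬ HasLog (fun z => (z - p) ^ m) (Metric.sphere p R) := by
  intro h
  have hR' : (R : ℂ) ≠ 0 := by exact_mod_cast hR.ne'
  obtain ⟨g0, hg0, hx0⟩ := h
  have h3 := hg0.comp (f := fun θ : ℝ => p + R * Complex.exp (θ * Complex.I)) (s := univ)
    (by fun_prop) (fun θ _ => by
      simp [Complex.norm_exp_ofReal_mul_I, hR.le])
  obtain ⟨n', hn'⟩ := log_diff_const isPreconnected_univ h3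
    (g := fun θ : ℝ => (m : ℂ) * (Complex.log R + θ * Complex.I)) (by fun_prop) (fun θ hθ => by
      simp only [Function.comp]
      rw [hx0 _ (by simp [Complex.norm_exp_ofReal_mul_I, hR.le]), Complex.exp_int_mul,
        Complex.exp_add, Complex.exp_log hR']
      simp)
  have a := hn' 0 (mem_univ _)
  have b := hn' (2 * Real.pi) (mem_univ _)
  simp only [Function.comp] at a b
  have e : Complex.exp (((2 * Real.pi : ℝ) : ℂ) * Complex.I)
      = Complex.exp (((0 : ℝ) : ℂ) * Complex.I) := by
    push_cast
    rw [Complex.exp_two_pi_mul_I]; simp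
  rw [e, a] at b
  have : (m : ℂ) * (2 * Real.pi * Complex.I) = 0 := by
    push_cast at b
    linear_combination - b
  have hp : (Real.pi : ℂ) ≠ 0 := by exact_mod_cast Real.pi_ne_zero
  simp [hm, hp, Complex.I_ne_zero] at this

theorem joinedIn_exterior {R : ℝ} (hR : 0 ≤ R) {z w : ℂ} (hz : R < ‖z‖) (hw : R < ‖w‖) :
    JoinedIn {z : ℂ | R < ‖z‖} z w := by
  have h := (isPathConnected_compl_singleton_of_one_lt_rank (E := ℂ)
    (by rw [Complex.rank_real_complex]; norm_num) 0).image'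
    (f := fun z => z + (R / ‖z‖ : ℝ) • z) (by
      refine continuousOn_id.add (ContinuousOn.smul (ContinuousOn.div continuousOn_const
        continuous_norm.continuousOn ?_) continuousOn_id)
      intro x hx; simpa using hx)
  have e : (fun z : ℂ => z + (R / ‖z‖ : ℝ) • z) '' {0}ᶜ = {z : ℂ | R < ‖z‖} := by
    ext y
    constructor
    · rintro ⟨x, hx, rfl⟩
      have hx' : 0 < ‖x‖ := by simpa using hx
      have : x + (R / ‖x‖ : ℝ) • x = ((1 + R / ‖x‖ : ℝ)) • x := by rw [add_smul, one_smul]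
      simp only [mem_ofPred_eq]
      rw [this, norm_smul, Real.norm_eq_abs, abs_of_nonneg (by positivity)]
      field_simp
      linarith
    · intro hy
      have hy' : R < ‖y‖ := hy
      have hy0 : 0 < ‖y‖ := hR.trans_lt hy'
      refine ⟨((‖y‖ - R) / ‖y‖ : ℝ) • y, ?_, ?_⟩
      · simp only [mem_compl_iff, mem_singleton_iff, smul_eq_zero, not_or]
        exact ⟨(div_pos (by linarith) hy0).ne', norm_pos_iff.1 hy0⟩
      · have : ‖((‖y‖ - R) / ‖y‖ : ℝ) • y‖ = ‖y‖ - R := by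
          rw [norm_smul, Real.norm_eq_abs, abs_of_pos (div_pos (by linarith) hy0)]
          field_simp
        simp only [this]
        rw [smul_smul, ← add_smul]
        have h1 : ‖y‖ - R ≠ 0 := by linarith
        have : (‖y‖ - R) / ‖y‖ + R / (‖y‖ - R) * ((‖y‖ - R) / ‖y‖) = 1 := by
          field_simp; ring
        rw [this, one_smul]
  rw [e] at h
  exact h.joinedIn _ hz _ hw

/-- No logarithm of `(z - p) ^ m` exists around a hole of `K` containing `p`. -/
theorem not_hasLog_of_isBounded {K : Set ℂ} (hK : IsClosed K) {p : ℂ} (hp : p ∉ K)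
    (hb : IsBounded {y | JoinedIn Kᶜ p y}) {ρ : ℂ → ℂ}
    (hρ : ContinuousOn ρ (K ∪ {y | JoinedIn Kᶜ p y}))
    (hne : ∀ z ∈ K ∪ {y | JoinedIn Kᶜ p y}, ρ z ≠ 0) {m : ℤ} (hm : m ≠ 0) :
    ¬ HasLog (fun z => (z - p) ^ m * ρ z) K := by
  classical
  rintro ⟨g, hg, hx⟩
  set U : Set ℂ := {y | JoinedIn Kᶜ p y} with hU
  have hUo : IsOpen U := hK.isOpen_compl.pathComponentIn p
  have hpU : p ∈ U := JoinedIn.refl hp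
  have hUK : IsClosed (U ∪ K) := by
    rw [← isOpen_compl_iff, isOpen_iff_mem_nhds]
    intro x hx
    have hxK : x ∈ Kᶜ := fun h => hx (Or.inr h)
    have ho : IsOpen {y | JoinedIn Kᶜ x y} := hK.isOpen_compl.pathComponentIn x
    filter_upwards [ho.mem_nhds (JoinedIn.refl hxK)] with y hy
    rintro (h | h)
    · exact hx (Or.inl (JoinedIn.trans h (JoinedIn.symm hy)))
    · exact hy.target_mem h
  obtain ⟨G, hG⟩ := ContinuousMap.exists_restrict_eq hK
    ⟨K.domRestrict g, continuousOn_iff_continuous_domRestrict.1 hg⟩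
  have hGK : ∀ z ∈ K, G z = g z := fun z hz => by
    have := congrArg (fun f => f ⟨z, hz⟩) hG
    simpa using this
  let h : ℂ → ℂ := fun z => if z ∈ U then Complex.exp (G z) / ρ z else (z - p) ^ m
  have e1 : EqOn h (fun z => Complex.exp (G z) / ρ z) (U ∪ K) := by
    intro z hz
    by_cases hzU : z ∈ U
    · simp [h, hzU]
    · have hzK : z ∈ K := hz.resolve_left hzU
      simp only [h, hzU, if_false]
      rw [hGK z hzK, hx z hzK]
      have := hne z (Or.inl hzK)
      field_simp
  have e2 : EqOn h (fun z => (z - p) ^ m) Uᶜ := fun z hz => by simp [h, show z ∉ U from hz]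
  have hnp : ∀ z ∈ Uᶜ, z - p ≠ 0 := fun z hz h0 => hz (by rw [sub_eq_zero.1 h0]; exact hpU)
  have c1 : ContinuousOn h (U ∪ K) := by
    refine ContinuousOn.congr ?_ e1
    refine ContinuousOn.div (by fun_prop) (hρ.mono (by rw [union_comm])) ?_
    intro z hz; exact hne z (by rwa [union_comm] at hz)
  have c2 : ContinuousOn h Uᶜ := by
    refine ContinuousOn.congr ?_ e2
    refine ContinuousOn.zpow₀ (by fun_prop) m ?_
    intro z hz; exact Or.inl (hnp z hz)
  have hc : Continuous h := by
    have := c1.union_of_isClosed c2 hUK hUo.isClosed_compl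
    rw [← continuousOn_univ]
    refine this.mono fun z _ => ?_
    by_cases hz : z ∈ U
    · exact Or.inl (Or.inl hz)
    · exact Or.inr hz
  have hh : ∀ z, h z ≠ 0 := by
    intro z
    by_cases hz : z ∈ U
    · rw [e1 (Or.inl hz)]
      exact div_ne_zero (Complex.exp_ne_zero _) (hne z (Or.inr hz))
    · rw [e2 hz]; exact zpow_ne_zero _ (hnp z hz)
  obtain ⟨R, hR⟩ := hb.subset_ball p
  have hR0 : 0 < R := by simpa using hR hpU
  refine not_hasLog_sphere p hR0 hm (((hasLog_univ h hc hh).mono (subset_univ _)).congr ?_)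
  intro z hz
  refine e2 fun hzU => ?_
  have := hR hzU
  rw [Metric.mem_sphere] at hz
  rw [Metric.mem_ball] at this
  linarith

theorem isBounded_or_isBounded {K : Set ℂ} (hK : IsCompact K) {p q : ℂ}
    (h : ¬ JoinedIn Kᶜ p q) :
    IsBounded {y | JoinedIn Kᶜ p y} ∨ IsBounded {y | JoinedIn Kᶜ q y} := by
  by_contra! hcon
  obtain ⟨R, hR0, hR⟩ := hK.isBounded.exists_pos_norm_le
  have key : ∀ S : Set ℂ, ¬ IsBounded S → ∃ z ∈ S, R < ‖z‖ := by
    intro S hS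
    by_contra! hc
    exact hS (isBounded_iff_forall_norm_le.2 ⟨R, hc⟩)
  obtain ⟨z, hz, hz'⟩ := key _ hcon.1
  obtain ⟨w, hw, hw'⟩ := key _ hcon.2
  have hs : {z : ℂ | R < ‖z‖} ⊆ Kᶜ := fun y hy hyK => absurd (hR y hyK) (not_le.2 hy)
  exact h (JoinedIn.trans hz (((joinedIn_exterior hR0.le hz' hw').mono hs).trans
    (JoinedIn.symm hw)))

theorem joinedIn_of_hasLog {K : Set ℂ} (hK : IsCompact K) {p q : ℂ} (hp : p ∉ K) (hq : q ∉ K)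
    (h : HasLog (fun z => (z - p) / (z - q)) K) : JoinedIn Kᶜ p q := by
  by_contra hj
  rcases isBounded_or_isBounded hK hj with hb | hb
  · have hne : ∀ z ∈ K ∪ {y | JoinedIn Kᶜ p y}, z - q ≠ 0 := by
      rintro z (hz | hz) h0
      · exact hq (by rwa [← sub_eq_zero.1 h0])
      · exact hj (by rwa [← sub_eq_zero.1 h0])
    refine not_hasLog_of_isBounded hK.isClosed hp hb (ρ := fun z => (z - q)⁻¹)
      (ContinuousOn.inv₀ (by fun_prop) hne) (fun z hz => inv_ne_zero (hne z hz))
      one_ne_zero (h.congr fun z _ => ?_)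
    rw [zpow_one, div_eq_mul_inv]
  · have hne : ∀ z ∈ K ∪ {y | JoinedIn Kᶜ q y}, z - p ≠ 0 := by
      rintro z (hz | hz) h0
      · exact hp (by rwa [← sub_eq_zero.1 h0])
      · exact hj (by rw [← sub_eq_zero.1 h0]; exact JoinedIn.symm hz)
    refine not_hasLog_of_isBounded hK.isClosed hq hb (ρ := fun z => z - p)
      (by fun_prop) hne (m := -1) (by norm_num) (h.congr fun z _ => ?_)
    rw [zpow_neg_one, div_eq_mul_inv, mul_comm]

/-- Janiszewski's theorem. -/
theorem joinedIn_compl_union {A B : Set ℂ} (hA : IsCompact A) (hB : IsCompact B)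
    (hAB : IsPreconnected (A ∩ B)) {p q : ℂ} (h : JoinedIn Aᶜ p q) (h' : JoinedIn Bᶜ p q) :
    JoinedIn (A ∪ B)ᶜ p q := by
  refine joinedIn_of_hasLog (hA.union hB) ?_ ?_ ((hasLog_of_joinedIn h).union (fun F h1 h2 =>
    h1.union_of_isClosed h2 hA.isClosed hB.isClosed) hAB (hasLog_of_joinedIn h'))
  · rintro (hp | hp)
    exacts [h.source_mem hp, h'.source_mem hp]
  · rintro (hp | hp)
    exacts [h.target_mem hp, h'.target_mem hp]

theorem hasLog_image_Icc {γ : I → ℂ} (hγ : Continuous γ) (hi : Function.Injective γ) {a b : I}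
    (hab : a ≤ b) {f : ℂ → ℂ} (hf : ContinuousOn f (γ '' Icc a b))
    (hne : ∀ t ∈ Icc a b, f (γ t) ≠ 0) : HasLog f (γ '' Icc a b) := by
  let c : I → I := fun t => max a (min b t)
  have hc : ∀ t, c t ∈ Icc a b := fun t => ⟨le_max_left _ _, max_le hab (min_le_left _ _)⟩
  have hc' : ∀ t ∈ Icc a b, c t = t := fun t ht => by simp [c, ht.1, ht.2]
  have hcc : Continuous c := by fun_prop
  obtain ⟨g, hg, hx⟩ := hasLog_unitInterval (fun t => f (γ (c t)))
    (hf.comp_continuous (hγ.comp hcc) fun t => mem_image_of_mem _ (hc t)) (fun t => hne _ (hc t))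
  have hg' : Continuous g := by rwa [← continuousOn_univ]
  have hemb : IsClosedEmbedding γ := hγ.isClosedEmbedding hi
  obtain ⟨G, hG⟩ := ContinuousMap.exists_extension hemb ⟨g, hg'⟩
  refine ⟨G, by fun_prop, ?_⟩
  rintro _ ⟨t, ht, rfl⟩
  have : G (γ t) = g t := congrArg (fun f => f t) hG
  rw [this, hx t (mem_univ _)]
  simp only [hc' t ht]

/-- An arc does not separate the plane. -/
theorem joinedIn_compl_image_Icc {γ : I → ℂ} (hγ : Continuous γ) (hi : Function.Injective γ)
    {a b : I} (hab : a ≤ b) {p q : ℂ} (hp : p ∉ γ '' Icc a b) (hq : q ∉ γ '' Icc a b) :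
    JoinedIn (γ '' Icc a b)ᶜ p q := by
  have h0 : ∀ p ∉ γ '' Icc a b, ∀ z ∈ γ '' Icc a b, z - p ≠ 0 := fun p hp z hz h0 =>
    hp (by rwa [← sub_eq_zero.1 h0])
  refine joinedIn_of_hasLog (isCompact_Icc.image hγ) hp hq (hasLog_image_Icc hγ hi hab ?_ ?_)
  · exact ContinuousOn.div (by fun_prop) (by fun_prop) (h0 q hq)
  · intro t ht
    exact div_ne_zero (h0 p hp _ (mem_image_of_mem _ ht)) (h0 q hq _ (mem_image_of_mem _ ht))

theorem image_Icc_zero_one {X : Type*} (γ : I → X) : γ '' Icc 0 1 = range γ := by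
  have : (Icc 0 1 : Set I) = univ :=
    eq_univ_of_forall fun _ => ⟨unitInterval.nonneg', unitInterval.le_one'⟩
  rw [this, image_univ]

theorem joinedIn_compl_range {γ : I → ℂ} (hγ : Continuous γ) (hi : Function.Injective γ)
    {p q : ℂ} (hp : p ∉ range γ) (hq : q ∉ range γ) : JoinedIn (range γ)ᶜ p q := by
  rw [← image_Icc_zero_one] at *
  exact joinedIn_compl_image_Icc hγ hi zero_le_one hp hq

/-- A crosscut whose ends are connected outside of `Ω` separates `Ω`. -/
theorem not_isPreconnected_diff_range {Ω : Set ℂ} (hΩ : IsOpen Ω) {γ : I → ℂ}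
    (hγ : Continuous γ) (hi : Function.Injective γ) (hin : ∀ t, t ≠ 0 → t ≠ 1 → γ t ∈ Ω)
    (hout : JoinedIn Ωᶜ (γ 0) (γ 1)) : ¬ IsPreconnected (Ω \ range γ) := by
  intro hpre
  have h1 := hasLog_of_joinedIn hout
  have hc : IsClosed (range γ) := (isCompact_range hγ).isClosed
  have h2 : HasLog (fun z => (z - γ 0) / (z - γ 1)) (range γ)ᶜ := by
    refine hasLog_of_joinedIn ?_
    rw [compl_compl]
    exact ⟨⟨⟨γ, hγ⟩, rfl, rfl⟩, fun t => mem_range_self t⟩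
  have h3 := h1.union (fun F h1 h2 => h1.union_of_isOpen h2 hΩ hc.isOpen_compl)
    (by rwa [sdiff_eq] at hpre) h2
  have hne : γ 0 ≠ γ 1 := hi.ne (by simp)
  have hd : 0 < dist (γ 0) (γ 1) := dist_pos.2 hne
  set r := dist (γ 0) (γ 1) / 2 with hr
  have hr0 : 0 < r := by positivity
  have h4 : HasLog (fun z => (z - γ 1) / (γ 0 - γ 1)) (Metric.sphere (γ 0) r) := by
    have hsl : ∀ z ∈ Metric.sphere (γ 0) r, (z - γ 1) / (γ 0 - γ 1) ∈ Complex.slitPlane := by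
      intro z hz
      have h0 : γ 0 - γ 1 ≠ 0 := sub_ne_zero.2 hne
      have : (z - γ 1) / (γ 0 - γ 1) = 1 + (z - γ 0) / (γ 0 - γ 1) := by
        field_simp; ring
      rw [this]
      apply Complex.mem_slitPlane_of_norm_lt_one
      rw [norm_div, ← dist_eq_norm, ← dist_eq_norm, Metric.mem_sphere.1 hz, div_lt_one hd]
      linarith
    refine ⟨fun z => Complex.log ((z - γ 1) / (γ 0 - γ 1)),
      ContinuousOn.clog (by fun_prop) hsl, fun z hz => ?_⟩
    exact Complex.exp_log (Complex.slitPlane_ne_zero (hsl z hz))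
  have h5 : HasLog (fun z => (z - γ 0) / (z - γ 1)) (Metric.sphere (γ 0) r) := by
    refine h3.mono fun z hz => ?_
    by_contra hcon
    simp only [mem_union, mem_compl_iff, not_or, not_not] at hcon
    obtain ⟨hzΩ, t, rfl⟩ := hcon
    have : t = 0 ∨ t = 1 := by
      by_contra! h; exact hzΩ (hin t h.1 h.2)
    rcases this with rfl | rfl
    · simp at hz; linarith
    · rw [Metric.mem_sphere, dist_comm] at hz; linarith
  refine not_hasLog_sphere (γ 0) hr0 one_ne_zero (((h5.mul h4).mul
    (hasLog_const (sub_ne_zero.2 hne) _)).congr fun z hz => ?_)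
  have h0 : γ 0 - γ 1 ≠ 0 := sub_ne_zero.2 hne
  have h1 : z - γ 1 ≠ 0 := by
    intro h; rw [sub_eq_zero.1 h, Metric.mem_sphere, dist_comm] at hz; linarith
  field_simp

/-- An arc attached to `K` at its ends splits a component of `Kᶜ` into at most two pieces. -/
theorem joinedIn_of_three {K : Set ℂ} (hK : IsCompact K) {γ : I → ℂ} (hγ : Continuous γ)
    (hi : Function.Injective γ) (hend : ∀ t, γ t ∈ K → t = 0 ∨ t = 1) {p₁ p₂ p₃ : ℂ}
    (hp₁ : p₁ ∉ range γ) (hp₂ : p₂ ∉ range γ) (hp₃ : p₃ ∉ range γ)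
    (h12 : JoinedIn Kᶜ p₁ p₂) (h23 : JoinedIn Kᶜ p₂ p₃) :
    JoinedIn (K ∪ range γ)ᶜ p₁ p₂ ∨ JoinedIn (K ∪ range γ)ᶜ p₂ p₃ ∨
      JoinedIn (K ∪ range γ)ᶜ p₁ p₃ := by
  have hC : IsCompact (range γ) := isCompact_range hγ
  by_cases hK0 : γ 0 ∈ K ∧ γ 1 ∈ K
  swap
  · refine Or.inl (joinedIn_compl_union hK hC (Subsingleton.isPreconnected ?_) h12
      (joinedIn_compl_range hγ hi hp₁ hp₂))
    rintro _ ⟨hx, t, rfl⟩ _ ⟨hy, s, rfl⟩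
    rcases hend t hx with rfl | rfl <;> rcases hend s hy with rfl | rfl <;> tauto
  have hp₁K := h12.source_mem
  have hp₂K := h12.target_mem
  have hp₃K := h23.target_mem
  obtain ⟨g, hg, hgx⟩ := hasLog_of_joinedIn h12
  obtain ⟨g', hg', hgx'⟩ := hasLog_of_joinedIn h23
  obtain ⟨k, hk, hkx⟩ := hasLog_of_joinedIn (joinedIn_compl_range hγ hi hp₁ hp₂)
  obtain ⟨k', hk', hkx'⟩ := hasLog_of_joinedIn (joinedIn_compl_range hγ hi hp₂ hp₃)
  have hm : ∀ t, γ t ∈ range γ := fun t => mem_range_self t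
  obtain ⟨n0, hn0⟩ := Complex.exp_eq_exp_iff_exists_int.1 ((hgx _ hK0.1).trans (hkx _ (hm 0)).symm)
  obtain ⟨n1, hn1⟩ := Complex.exp_eq_exp_iff_exists_int.1 ((hgx _ hK0.2).trans (hkx _ (hm 1)).symm)
  obtain ⟨m0, hm0⟩ :=
    Complex.exp_eq_exp_iff_exists_int.1 ((hgx' _ hK0.1).trans (hkx' _ (hm 0)).symm)
  obtain ⟨m1, hm1⟩ :=
    Complex.exp_eq_exp_iff_exists_int.1 ((hgx' _ hK0.2).trans (hkx' _ (hm 1)).symm)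
  have hKC : IsCompact (K ∪ range γ) := hK.union hC
  have hu : ∀ F : ℂ → ℂ, ContinuousOn F K → ContinuousOn F (range γ) →
      ContinuousOn F (K ∪ range γ) := fun F h1 h2 =>
    h1.union_of_isClosed h2 hK.isClosed hC.isClosed
  have hq₁ : p₁ ∉ K ∪ range γ := fun h => h.elim hp₁K hp₁
  have hq₂ : p₂ ∉ K ∪ range γ := fun h => h.elim hp₂K hp₂
  have hq₃ : p₃ ∉ K ∪ range γ := fun h => h.elim hp₃K hp₃
  have glue : ∀ a b : ℤ, a * n0 + b * m0 = a * n1 + b * m1 →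
      HasLog (fun z => ((z - p₁) / (z - p₂)) ^ a * ((z - p₂) / (z - p₃)) ^ b) (K ∪ range γ) := by
    intro a b hab
    refine hasLog_union_of_eq_add_const (g := fun z => a * g z + b * g' z)
      (g' := fun z => a * k z + b * k' z) (n := a * n0 + b * m0) hu (by fun_prop) ?_ (by fun_prop)
      ?_ ?_
    · intro x hx
      rw [Complex.exp_add, Complex.exp_int_mul, Complex.exp_int_mul, hgx x hx, hgx' x hx]
    · intro x hx
      rw [Complex.exp_add, Complex.exp_int_mul, Complex.exp_int_mul, hkx x hx, hkx' x hx]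
    · rintro _ ⟨hx, t, rfl⟩
      rcases hend t hx with rfl | rfl
      · rw [hn0, hm0]; push_cast; ring
      · rw [hn1, hm1, hab]; push_cast; ring
  by_cases ha : n0 = n1
  · exact Or.inl (joinedIn_of_hasLog hKC hq₁ hq₂ ((glue 1 0 (by simp [ha])).congr (by simp)))
  by_cases hb : m0 = m1
  · exact Or.inr (Or.inl (joinedIn_of_hasLog hKC hq₂ hq₃
      ((glue 0 1 (by simp [hb])).congr (by simp))))
  by_contra! hcon
  obtain ⟨c12, c23, c13⟩ := hcon
  set b : ℤ := m1 - m0 with hbdef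
  set a : ℤ := n1 - n0 with hadef
  clear_value a b
  have ha0 : a ≠ 0 := fun h => ha (by omega)
  have hb0 : b ≠ 0 := fun h => hb (by omega)
  have hl := glue b (-a) (by rw [hbdef, hadef]; ring)
  have ne1 : ∀ z ∈ K ∪ range γ, z - p₁ ≠ 0 := fun z hz h0 => hq₁ (by rwa [← sub_eq_zero.1 h0])
  have ne2 : ∀ z ∈ K ∪ range γ, z - p₂ ≠ 0 := fun z hz h0 => hq₂ (by rwa [← sub_eq_zero.1 h0])
  have ne3 : ∀ z ∈ K ∪ range γ, z - p₃ ≠ 0 := fun z hz h0 => hq₃ (by rwa [← sub_eq_zero.1 h0])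
  have hl' : HasLog (fun z => (z - p₁) ^ b * (z - p₂) ^ (-b - a) * (z - p₃) ^ a)
      (K ∪ range γ) := by
    refine hl.congr fun z hz => ?_
    have := ne2 z hz
    have e : (z - p₂) ^ (-b - a) = ((z - p₂) ^ b)⁻¹ * ((z - p₂) ^ a)⁻¹ := by
      rw [zpow_sub₀ this, zpow_neg, div_eq_mul_inv]
    rw [div_zpow, div_zpow, zpow_neg, zpow_neg, e]
    have := zpow_ne_zero b (ne2 z hz)
    have := zpow_ne_zero a (ne2 z hz)
    have := zpow_ne_zero a (ne3 z hz)
    field_simp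
  have sep : ∀ {p q : ℂ}, ¬ JoinedIn (K ∪ range γ)ᶜ p q → (∀ z ∈ K ∪ range γ, z - q ≠ 0) →
      ∀ z ∈ K ∪ range γ ∪ {y | JoinedIn (K ∪ range γ)ᶜ p y}, z - q ≠ 0 := by
    rintro p q hpq hq z (hz | hz)
    · exact hq z hz
    · intro h0; rw [sub_eq_zero.1 h0] at hz; exact hpq hz
  rcases isBounded_or_isBounded hKC c13 with hbd | hbd
  · refine not_hasLog_of_isBounded hKC.isClosed hq₁ hbd
      (ρ := fun z => (z - p₂) ^ (-b - a) * (z - p₃) ^ a) ?_ ?_ hb0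
      (hl'.congr fun z _ => mul_assoc _ _ _)
    · exact (ContinuousOn.zpow₀ (by fun_prop) _ fun z hz => Or.inl (sep c12 ne2 z hz)).mul
        (ContinuousOn.zpow₀ (by fun_prop) _ fun z hz => Or.inl (sep c13 ne3 z hz))
    · exact fun z hz => mul_ne_zero (zpow_ne_zero _ (sep c12 ne2 z hz))
        (zpow_ne_zero _ (sep c13 ne3 z hz))
  · have c31 : ¬ JoinedIn (K ∪ range γ)ᶜ p₃ p₁ := fun h => c13 h.symm
    have c32 : ¬ JoinedIn (K ∪ range γ)ᶜ p₃ p₂ := fun h => c23 h.symm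
    refine not_hasLog_of_isBounded hKC.isClosed hq₃ hbd
      (ρ := fun z => (z - p₁) ^ b * (z - p₂) ^ (-b - a)) ?_ ?_ ha0
      (hl'.congr fun z _ => mul_comm _ _)
    · exact (ContinuousOn.zpow₀ (by fun_prop) _ fun z hz => Or.inl (sep c31 ne1 z hz)).mul
        (ContinuousOn.zpow₀ (by fun_prop) _ fun z hz => Or.inl (sep c32 ne2 z hz))
    · exact fun z hz => mul_ne_zero (zpow_ne_zero _ (sep c31 ne1 z hz))
        (zpow_ne_zero _ (sep c32 ne2 z hz))

/-- If `p` sees an interior point of an arc attached to `K` at its ends, then it still does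
after the arc is removed. -/
theorem mem_closure_of_joinedIn {K : Set ℂ} (hK : IsCompact K) {γ : I → ℂ} (hγ : Continuous γ)
    (hi : Function.Injective γ) (hend : ∀ t, γ t ∈ K → t = 0 ∨ t = 1) {p : ℂ}
    (hp : p ∉ range γ) {s : I} (hs0 : 0 < s) (hs1 : s < 1) (h : JoinedIn Kᶜ p (γ s)) :
    γ s ∈ closure {y | JoinedIn (K ∪ range γ)ᶜ p y} := by
  set O : Set ℂ := {y | JoinedIn (K ∪ range γ)ᶜ p y} with hO
  have hKC : IsCompact (K ∪ range γ) := hK.union (isCompact_range hγ)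
  have hOo : ∀ p, IsOpen {y | JoinedIn (K ∪ range γ)ᶜ p y} :=
    fun p => hKC.isClosed.isOpen_compl.pathComponentIn p
  by_contra hcl
  rw [mem_closure_iff_nhds] at hcl
  push Not at hcl
  obtain ⟨N, hN, hNO⟩ := hcl
  obtain ⟨B, hBN, hBo, hsB⟩ := mem_nhds_iff.1 hN
  have hBO : ∀ y ∈ B, y ∉ O := fun y hy hyO => by
    have : y ∈ N ∩ O := ⟨hBN hy, hyO⟩
    rw [hNO] at this; exact this
  have hpre : γ ⁻¹' B ∈ 𝓝 s := hγ.continuousAt.preimage_mem_nhds (hBo.mem_nhds hsB)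
  obtain ⟨l, u, ⟨hl, hu⟩, hIoo⟩ := (mem_nhds_iff_exists_Ioo_subset' ⟨0, hs0⟩ ⟨1, hs1⟩).1 hpre
  have hsl : γ s ∉ γ '' Icc 0 l := by
    rintro ⟨t, ht, hts⟩
    rw [hi hts] at ht
    exact absurd ht.2 (not_le.2 hl)
  have hsu : γ s ∉ γ '' Icc u 1 := by
    rintro ⟨t, ht, hts⟩
    rw [hi hts] at ht
    exact absurd ht.1 (not_le.2 hu)
  have hpl : p ∉ γ '' Icc 0 l := fun h => hp (image_subset_range _ _ h)
  have hpu : p ∉ γ '' Icc u 1 := fun h => hp (image_subset_range _ _ h)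
  have j1 := joinedIn_compl_image_Icc hγ hi unitInterval.nonneg' hpl hsl
  have j2 := joinedIn_compl_image_Icc hγ hi unitInterval.le_one' hpu hsu
  have c1 : IsCompact (γ '' Icc 0 l) := isCompact_Icc.image hγ
  have c2 : IsCompact (γ '' Icc u 1) := isCompact_Icc.image hγ
  have j3 := joinedIn_compl_union hK c1 (Subsingleton.isPreconnected (by
    have : ∀ x ∈ K ∩ γ '' Icc 0 l, x = γ 0 := by
      rintro _ ⟨hx, t, ht, rfl⟩
      rcases hend t hx with rfl | rfl
      · rfl
      · exact absurd ht.2 (not_le.2 (hl.trans hs1))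
    intro x hx y hy
    rw [this x hx, this y hy])) h j1
  have j4 := joinedIn_compl_union (hK.union c1) c2 (Subsingleton.isPreconnected (by
    have : ∀ x ∈ (K ∪ γ '' Icc 0 l) ∩ γ '' Icc u 1, x = γ 1 := by
      rintro _ ⟨hx, t, ht, rfl⟩
      rcases hx with hx | ⟨t', ht', hx⟩
      · rcases hend t hx with rfl | rfl
        · exact absurd ht.1 (not_le.2 (hs0.trans hu))
        · rfl
      · rw [hi hx] at ht'
        exact absurd (ht.1.trans ht'.2) (not_le.2 (hl.trans hu))
    intro x hx y hy
    rw [this x hx, this y hy])) j3 j2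
  obtain ⟨δ, hδ⟩ := j4
  have hclopen : IsClopen (δ ⁻¹' O) := by
    refine ⟨⟨?_⟩, (hOo p).preimage δ.continuous⟩
    rw [isOpen_iff_mem_nhds]
    intro t ht
    by_cases htB : δ t ∈ B
    · filter_upwards [δ.continuous.continuousAt.preimage_mem_nhds (hBo.mem_nhds htB)] with r hr
      exact hBO _ hr
    · have hδt : δ t ∈ (K ∪ range γ)ᶜ := by
        rintro (hx | ⟨r, hr⟩)
        · exact hδ t (Or.inl (Or.inl hx))
        · have hrl : l < r := by
            by_contra hcon
            exact hδ t (Or.inl (Or.inr ⟨r, ⟨unitInterval.nonneg', not_lt.1 hcon⟩, hr⟩))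
          have hru : r < u := by
            by_contra hcon
            exact hδ t (Or.inr ⟨r, ⟨not_lt.1 hcon, unitInterval.le_one'⟩, hr⟩)
          exact htB (hr ▸ hIoo ⟨hrl, hru⟩)
      filter_upwards [δ.continuous.continuousAt.preimage_mem_nhds
        ((hOo (δ t)).mem_nhds (JoinedIn.refl hδt))] with r hr hrO
      exact ht (JoinedIn.trans hrO (JoinedIn.symm hr))
  have huniv := hclopen.eq_univ ⟨0, by
    change δ 0 ∈ O
    rw [δ.source]
    exact JoinedIn.refl fun hx => hx.elim h.source_mem hp⟩
  have h1 : δ 1 ∈ O := by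
    change (1 : I) ∈ δ ⁻¹' O
    rw [huniv]; trivial
  rw [δ.target] at h1
  exact JoinedIn.target_mem h1 (Or.inr (mem_range_self s))

/-- The standard homeomorphism of the plane with the complex numbers. -/
noncomputable def planeHomeo : ℝ × ℝ ≃ₜ ℂ := Complex.equivRealProdCLM.symm.toHomeomorph

theorem joinedIn_planeHomeo {K : Set (ℝ × ℝ)} {p q : ℝ × ℝ} :
    JoinedIn (planeHomeo '' K)ᶜ (planeHomeo p) (planeHomeo q) ↔ JoinedIn Kᶜ p q := by
  rw [← image_compl_eq planeHomeo.bijective]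
  constructor
  · intro h
    have := h.map_continuousOn (f := planeHomeo.symm) planeHomeo.symm.continuous.continuousOn
    simpa [image_image] using this
  · intro h
    exact h.map_continuousOn planeHomeo.continuous.continuousOn

theorem plane_joinedIn_compl_union {A B : Set (ℝ × ℝ)} (hA : IsCompact A) (hB : IsCompact B)
    (hAB : IsPreconnected (A ∩ B)) {p q : ℝ × ℝ} (h : JoinedIn Aᶜ p q) (h' : JoinedIn Bᶜ p q) :
    JoinedIn (A ∪ B)ᶜ p q := by
  rw [← joinedIn_planeHomeo] at *
  rw [image_union]
  refine joinedIn_compl_union (hA.image planeHomeo.continuous) (hB.image planeHomeo.continuous)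
    ?_ h h'
  rw [← image_inter planeHomeo.injective]
  exact hAB.image _ planeHomeo.continuous.continuousOn

section

variable {γ : I → ℝ × ℝ}

theorem plane_joinedIn_compl_range (hγ : Continuous γ) (hi : Function.Injective γ)
    {p q : ℝ × ℝ} (hp : p ∉ range γ) (hq : q ∉ range γ) : JoinedIn (range γ)ᶜ p q := by
  rw [← joinedIn_planeHomeo, ← range_comp]
  refine joinedIn_compl_range (planeHomeo.continuous.comp hγ) (planeHomeo.injective.comp hi) ?_ ?_
  · rwa [range_comp, planeHomeo.injective.mem_set_image]
  · rwa [range_comp, planeHomeo.injective.mem_set_image]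

theorem plane_not_isPreconnected_diff_range {Ω : Set (ℝ × ℝ)} (hΩ : IsOpen Ω)
    (hγ : Continuous γ) (hi : Function.Injective γ) (hin : ∀ t, t ≠ 0 → t ≠ 1 → γ t ∈ Ω)
    (hout : JoinedIn Ωᶜ (γ 0) (γ 1)) : ¬ IsPreconnected (Ω \ range γ) := by
  intro h
  rw [← joinedIn_planeHomeo] at hout
  refine not_isPreconnected_diff_range (planeHomeo.isOpenMap _ hΩ) (planeHomeo.continuous.comp hγ)
    (planeHomeo.injective.comp hi) (fun t h0 h1 => mem_image_of_mem _ (hin t h0 h1)) hout ?_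
  rw [range_comp, ← image_sdiff planeHomeo.injective]
  exact h.image _ planeHomeo.continuous.continuousOn

theorem plane_joinedIn_of_three {K : Set (ℝ × ℝ)} (hK : IsCompact K) (hγ : Continuous γ)
    (hi : Function.Injective γ) (hend : ∀ t, γ t ∈ K → t = 0 ∨ t = 1) {p₁ p₂ p₃ : ℝ × ℝ}
    (hp₁ : p₁ ∉ range γ) (hp₂ : p₂ ∉ range γ) (hp₃ : p₃ ∉ range γ)
    (h12 : JoinedIn Kᶜ p₁ p₂) (h23 : JoinedIn Kᶜ p₂ p₃) :
    JoinedIn (K ∪ range γ)ᶜ p₁ p₂ ∨ JoinedIn (K ∪ range γ)ᶜ p₂ p₃ ∨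
      JoinedIn (K ∪ range γ)ᶜ p₁ p₃ := by
  rw [← joinedIn_planeHomeo] at h12 h23
  have hm : ∀ p, p ∉ range γ → planeHomeo p ∉ range (planeHomeo ∘ γ) := fun p hp => by
    rwa [range_comp, planeHomeo.injective.mem_set_image]
  simp only [← joinedIn_planeHomeo (K := K ∪ range γ), image_union, ← range_comp]
  exact joinedIn_of_three (hK.image planeHomeo.continuous) (planeHomeo.continuous.comp hγ)
    (planeHomeo.injective.comp hi)
    (fun t ht => hend t (by simpa [planeHomeo.injective.mem_set_image] using ht))
    (hm _ hp₁) (hm _ hp₂) (hm _ hp₃) h12 h23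

theorem plane_mem_closure_of_joinedIn {K : Set (ℝ × ℝ)} (hK : IsCompact K) (hγ : Continuous γ)
    (hi : Function.Injective γ) (hend : ∀ t, γ t ∈ K → t = 0 ∨ t = 1) {p : ℝ × ℝ}
    (hp : p ∉ range γ) {s : I} (hs0 : 0 < s) (hs1 : s < 1) (h : JoinedIn Kᶜ p (γ s)) :
    γ s ∈ closure {y | JoinedIn (K ∪ range γ)ᶜ p y} := by
  rw [← joinedIn_planeHomeo] at h
  have := mem_closure_of_joinedIn (hK.image planeHomeo.continuous) (planeHomeo.continuous.comp hγ)
    (planeHomeo.injective.comp hi)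
    (fun t ht => hend t (by simpa [planeHomeo.injective.mem_set_image] using ht))
    (p := planeHomeo p) (by rwa [range_comp, planeHomeo.injective.mem_set_image]) hs0 hs1 h
  rw [range_comp, ← image_union] at this
  have e : {y | JoinedIn (planeHomeo '' (K ∪ range γ))ᶜ (planeHomeo p) y} =
      planeHomeo '' {y | JoinedIn (K ∪ range γ)ᶜ p y} := by
    ext y
    obtain ⟨y, rfl⟩ := planeHomeo.surjective y
    rw [planeHomeo.injective.mem_set_image]
    exact joinedIn_planeHomeo
  rwa [e, ← planeHomeo.image_closure, Function.comp,
    planeHomeo.injective.mem_set_image] at this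

end

namespace PlaneEmbedding

variable {V : Type} {G : SimpleGraph V} (P : PlaneEmbedding G)

/-- The points drawn by the vertices in `W` and the edges in `A`. -/
def partialDrawing (W : Set V) (A : Set G.edgeSet) : Set (ℝ × ℝ) :=
  P.pos '' W ∪ ⋃ e ∈ A, P.arc e

/-- The drawing of the spanning subgraph with edge set `A`. -/
def drawing (A : Set G.edgeSet) : Set (ℝ × ℝ) := P.partialDrawing univ A

theorem drawing_univ : P.drawing univ = P.image := by
  simp [drawing, partialDrawing, image]

theorem drawing_insert (e : G.edgeSet) (A : Set G.edgeSet) :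
    P.drawing (insert e A) = P.drawing A ∪ P.arc e := by
  simp only [drawing, partialDrawing, biUnion_insert, union_assoc]
  rw [union_comm (P.arc e)]

theorem partialDrawing_mono {W W' : Set V} {A A' : Set G.edgeSet} (hW : W ⊆ W') (hA : A ⊆ A') :
    P.partialDrawing W A ⊆ P.partialDrawing W' A' :=
  union_subset_union (image_mono hW) (biUnion_subset_biUnion_left hA)

theorem drawing_mono {A A' : Set G.edgeSet} (hA : A ⊆ A') : P.drawing A ⊆ P.drawing A' :=
  P.partialDrawing_mono subset_rfl hA

theorem arc_subset_drawing {e : G.edgeSet} {A : Set G.edgeSet} (h : e ∈ A) :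
    P.arc e ⊆ P.drawing A := fun _ hx => Or.inr (mem_biUnion h hx)

theorem isCompact_arc (e : G.edgeSet) : IsCompact (P.arc e) := by
  obtain ⟨u, v, -, γ, -, h⟩ := P.arc_path e
  rw [← h]
  exact isCompact_range γ.continuous

theorem isCompact_partialDrawing [Finite V] (W : Set V) (A : Set G.edgeSet) :
    IsCompact (P.partialDrawing W A) :=
  ((toFinite _).isCompact).union ((toFinite A).isCompact_biUnion fun e _ => P.isCompact_arc e)

theorem isCompact_drawing [Finite V] (A : Set G.edgeSet) : IsCompact (P.drawing A) :=
  P.isCompact_partialDrawing _ _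

theorem mem_of_mem_arc_of_mem_partialDrawing {e : G.edgeSet} {W : Set V} {A : Set G.edgeSet}
    (he : e ∉ A) (hA : ∀ f ∈ A, ∀ w ∈ (f : Sym2 V), w ∈ W) {x : ℝ × ℝ} (hx : x ∈ P.arc e)
    (h : x ∈ P.partialDrawing W A) : ∃ w ∈ (e : Sym2 V), w ∈ W ∧ x = P.pos w := by
  rcases h with ⟨w, hw, rfl⟩ | h
  · exact ⟨w, P.arc_avoid e w hx, hw, rfl⟩
  · simp only [mem_iUnion] at h
    obtain ⟨f, hf, hxf⟩ := h
    obtain ⟨w, hw, hw', rfl⟩ := P.arc_inter e f (by rintro rfl; exact he hf) x ⟨hx, hxf⟩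
    exact ⟨w, hw, hA f hf w hw', rfl⟩

theorem disjoint_partialDrawing {W W' : Set V} {A A' : Set G.edgeSet} (hW : Disjoint W W')
    (hA : ∀ f ∈ A, ∀ w ∈ (f : Sym2 V), w ∈ W) (hA' : ∀ f ∈ A', ∀ w ∈ (f : Sym2 V), w ∈ W') :
    Disjoint (P.partialDrawing W A) (P.partialDrawing W' A') := by
  rw [Set.disjoint_left]
  rintro x (⟨w, hw, rfl⟩ | h) h'
  · rcases h' with ⟨w', hw', he⟩ | h'
    · exact hW.le_bot ⟨hw, P.pos_inj he ▸ hw'⟩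
    · simp only [mem_iUnion] at h'
      obtain ⟨f, hf, hxf⟩ := h'
      exact hW.le_bot ⟨hw, hA' f hf w (P.arc_avoid f w hxf)⟩
  · simp only [mem_iUnion] at h
    obtain ⟨f, hf, hxf⟩ := h
    have : f ∉ A' := fun hf' => by
      obtain ⟨w, hw⟩ : ∃ w, w ∈ (f : Sym2 V) := ⟨_, Sym2.out_fst_mem _⟩
      exact hW.le_bot ⟨hA f hf w hw, hA' f hf' w hw⟩
    obtain ⟨w, hw, hw', -⟩ := P.mem_of_mem_arc_of_mem_partialDrawing this hA' hxf h'
    exact hW.le_bot ⟨hA f hf w hw, hw'⟩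

theorem eq_zero_or_one_of_mem_drawing {e : G.edgeSet} {A : Set G.edgeSet} (he : e ∉ A) {u v : V}
    (huv : (e : Sym2 V) = s(u, v)) {γ : Path (P.pos u) (P.pos v)} (hi : Function.Injective γ)
    (hγ : range γ = P.arc e) {t : I} (h : γ t ∈ P.drawing A) : t = 0 ∨ t = 1 := by
  obtain ⟨w, hw, -, hx⟩ := P.mem_of_mem_arc_of_mem_partialDrawing he (by simp)
    (hγ ▸ mem_range_self t) h
  rw [huv, Sym2.mem_iff] at hw
  rcases hw with rfl | rfl
  · exact .inl (hi (hx.trans γ.source.symm))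
  · exact .inr (hi (hx.trans γ.target.symm))

theorem joinedIn_interior_arc {K : Set (ℝ × ℝ)} {x y : ℝ × ℝ} {γ : Path x y}
    (hend : ∀ t, γ t ∈ K → t = 0 ∨ t = 1) {s t : I} (hs0 : s ≠ 0) (hs1 : s ≠ 1)
    (ht0 : t ≠ 0) (ht1 : t ≠ 1) : JoinedIn Kᶜ (γ s) (γ t) := by
  have hc : IsPathConnected (γ.extend '' Ioo (0 : ℝ) 1) :=
    ((convex_Ioo (0 : ℝ) 1).isPathConnected ⟨1 / 2, by norm_num⟩).image γ.continuous_extend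
  have key : ∀ r : I, r ≠ 0 → r ≠ 1 → γ r ∈ γ.extend '' Ioo (0 : ℝ) 1 := fun r h0 h1 =>
    ⟨r, ⟨lt_of_le_of_ne r.2.1 fun h => h0 (Subtype.ext h.symm),
      lt_of_le_of_ne r.2.2 fun h => h1 (Subtype.ext h)⟩, by simp⟩
  refine (hc.joinedIn _ (key s hs0 hs1) _ (key t ht0 ht1)).mono ?_
  rintro _ ⟨r, hr, rfl⟩ hK
  rw [γ.extend_apply ⟨hr.1.le, hr.2.le⟩] at hK
  rcases hend _ hK with h | h
  · exact hr.1.ne' (congrArg Subtype.val h)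
  · exact hr.2.ne (congrArg Subtype.val h)

/-- The spanning subgraph with edge set `A`. -/
def spanningGraph (A : Set G.edgeSet) : SimpleGraph V := SimpleGraph.fromEdgeSet ((↑) '' A)

theorem spanningGraph_adj {A : Set G.edgeSet} {u v : V} :
    (spanningGraph A).Adj u v ↔ ∃ e ∈ A, (e : Sym2 V) = s(u, v) := by
  simp only [spanningGraph, SimpleGraph.fromEdgeSet_adj, mem_image, and_iff_left_iff_imp]
  rintro ⟨e, -, he⟩ rfl
  exact G.irrefl (SimpleGraph.mem_edgeSet _ |>.1 (he ▸ e.2))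

theorem spanningGraph_mono {A A' : Set G.edgeSet} (h : A ⊆ A') :
    spanningGraph A ≤ spanningGraph A' :=
  SimpleGraph.fromEdgeSet_mono (image_mono h)

theorem not_reachable_of_isAcyclic_insert {A : Set G.edgeSet} {e : G.edgeSet} (he : e ∉ A)
    (h : (spanningGraph (insert e A)).IsAcyclic) {u v : V} (huv : (e : Sym2 V) = s(u, v)) :
    ¬ (spanningGraph A).Reachable u v := by
  have hb := SimpleGraph.isAcyclic_iff_forall_isBridge.1 h (e := s(u, v))
    ((SimpleGraph.mem_edgeSet _).2 (spanningGraph_adj.2 ⟨e, mem_insert _ _, huv⟩))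
  rw [SimpleGraph.isBridge_iff] at hb
  refine fun hr => hb (hr.mono ?_)
  intro a b hab
  obtain ⟨f, hf, hab'⟩ := spanningGraph_adj.1 hab
  rw [SimpleGraph.deleteEdges_adj]
  refine ⟨spanningGraph_adj.2 ⟨f, mem_insert_of_mem _ hf, hab'⟩, ?_⟩
  intro hh
  rw [mem_singleton_iff, ← hab', ← huv] at hh
  exact he (Subtype.ext hh ▸ hf)

/-- The drawing of a forest does not separate the plane. -/
theorem joinedIn_compl_drawing_of_isAcyclic [Finite V] {A : Set G.edgeSet}
    (hA : (spanningGraph A).IsAcyclic) {p q : ℝ × ℝ} (hp : p ∉ P.drawing A)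
    (hq : q ∉ P.drawing A) : JoinedIn (P.drawing A)ᶜ p q := by
  induction A, toFinite A using Set.Finite.induction_on with
  | empty =>
    have hc : (P.drawing ∅).Countable := by
      simpa [drawing, partialDrawing] using (finite_range P.pos).countable
    have := hc.isPathConnected_compl_of_one_lt_rank (by simp [← Module.finrank_eq_rank])
    exact this.joinedIn _ hp _ hq
  | @insert e A he _ ih =>
    rw [drawing_insert] at hp hq ⊢
    simp only [mem_union, not_or] at hp hq
    have hJ := ih (hA.anti (spanningGraph_mono (subset_insert _ _))) hp.1 hq.1
    obtain ⟨u, v, huv, γ, hi, hγ⟩ := P.arc_path e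
    have hnr := not_reachable_of_isAcyclic_insert he hA huv
    set W := {w | (spanningGraph A).Reachable u w}
    set B := {f ∈ A | ∀ w ∈ (f : Sym2 V), w ∈ W}
    have hB' : ∀ f ∈ A \ B, ∀ w ∈ (f : Sym2 V), w ∈ Wᶜ := by
      rintro f ⟨hf, hfB⟩ w hw hwW
      refine hfB ⟨hf, fun w' hw' => ?_⟩
      by_cases h : w = w'
      · exact h ▸ hwW
      · exact SimpleGraph.Reachable.trans hwW (spanningGraph_adj.2
          ⟨f, hf, (Sym2.mem_and_mem_iff h).1 ⟨hw, hw'⟩⟩).reachable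
    have hB : ∀ f ∈ B, ∀ w ∈ (f : Sym2 V), w ∈ W := fun f hf => hf.2
    have hun : P.drawing A = P.partialDrawing W B ∪ P.partialDrawing Wᶜ (A \ B) := by
      simp only [drawing, partialDrawing]
      rw [union_union_union_comm, ← image_union, union_compl_self, ← biUnion_union,
        union_sdiff_cancel (sep_subset _ _)]
    rw [hun] at hJ ⊢
    have h1 : JoinedIn (P.partialDrawing W B ∪ P.arc e)ᶜ p q := by
      refine plane_joinedIn_compl_union (P.isCompact_partialDrawing _ _) (P.isCompact_arc e)
        (Set.Subsingleton.isPreconnected ?_) (hJ.mono (compl_subset_compl.2 subset_union_left)) ?_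
      · have : ∀ x ∈ P.partialDrawing W B ∩ P.arc e, x = P.pos u := by
          rintro x ⟨hx, hx'⟩
          obtain ⟨w, hw, hwW, rfl⟩ := P.mem_of_mem_arc_of_mem_partialDrawing
            (fun h => he h.1) hB hx' hx
          rw [huv, Sym2.mem_iff] at hw
          rcases hw with rfl | rfl
          · rfl
          · exact absurd hwW hnr
        exact fun x hx y hy => (this x hx).trans (this y hy).symm
      · rw [← hγ] at hp hq ⊢
        exact plane_joinedIn_compl_range γ.continuous hi hp.2 hq.2
    rw [union_right_comm]
    refine plane_joinedIn_compl_union ((P.isCompact_partialDrawing _ _).union (P.isCompact_arc e))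
      (P.isCompact_partialDrawing _ _) (Set.Subsingleton.isPreconnected ?_) h1
        (hJ.mono (compl_subset_compl.2 subset_union_right))
    have : ∀ x ∈ (P.partialDrawing W B ∪ P.arc e) ∩ P.partialDrawing Wᶜ (A \ B),
        x = P.pos v := by
      rintro x ⟨hx | hx, hx'⟩
      · exact ((P.disjoint_partialDrawing disjoint_compl_right hB hB').le_bot ⟨hx, hx'⟩).elim
      · obtain ⟨w, hw, hwW, rfl⟩ := P.mem_of_mem_arc_of_mem_partialDrawing
            (fun h => he h.1) hB' hx hx'
        rw [huv, Sym2.mem_iff] at hw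
        rcases hw with rfl | rfl
        · exact absurd (SimpleGraph.Reachable.refl _) hwW
        · rfl
    exact fun x hx y hy => (this x hx).trans (this y hy).symm

theorem joinedIn_drawing_of_reachable {A : Set G.edgeSet} {u v : V}
    (h : (spanningGraph A).Reachable u v) : JoinedIn (P.drawing A) (P.pos u) (P.pos v) := by
  obtain ⟨w⟩ := h
  induction w with
  | nil => exact JoinedIn.refl (.inl (mem_image_of_mem _ (mem_univ _)))
  | cons hadj _ ih =>
    refine JoinedIn.trans ?_ ih
    obtain ⟨e, he, huv⟩ := spanningGraph_adj.1 hadj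
    obtain ⟨a, b, hab, γ, -, hγ⟩ := P.arc_path e
    have hj : JoinedIn (P.drawing A) (P.pos a) (P.pos b) :=
      ⟨γ, fun t => P.arc_subset_drawing he (hγ ▸ mem_range_self t)⟩
    rw [hab, Sym2.eq_iff] at huv
    rcases huv with ⟨rfl, rfl⟩ | ⟨rfl, rfl⟩
    exacts [hj, hj.symm]

theorem half_ne : (⟨1 / 2, by norm_num, by norm_num⟩ : I) ≠ 0 ∧
    (⟨1 / 2, by norm_num, by norm_num⟩ : I) ≠ 1 := by
  constructor <;> intro h <;> have := congrArg Subtype.val h <;> norm_num at this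

/-- Adding an edge that closes a cycle separates the plane. -/
theorem exists_not_joinedIn_insert [Finite V] {A : Set G.edgeSet} {e : G.edgeSet}
    (he : e ∉ A) {u v : V} (huv : (e : Sym2 V) = s(u, v))
    (hr : (spanningGraph A).Reachable u v) :
    ∃ p q, p ∉ P.drawing (insert e A) ∧ q ∉ P.drawing (insert e A) ∧
      ¬ JoinedIn (P.drawing (insert e A))ᶜ p q := by
  obtain ⟨a, b, hab, γ, hi, hγ⟩ := P.arc_path e
  have hr' : (spanningGraph A).Reachable a b := by
    rw [huv, Sym2.eq_iff] at hab
    rcases hab with ⟨rfl, rfl⟩ | ⟨rfl, rfl⟩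
    exacts [hr, hr.symm]
  have hend := fun t => P.eq_zero_or_one_of_mem_drawing he hab hi hγ (t := t)
  obtain ⟨m, hm0, hm1⟩ : ∃ m : I, m ≠ 0 ∧ m ≠ 1 := ⟨_, half_ne⟩
  by_contra! hcon
  have hopen : IsOpen (P.drawing A)ᶜ := (P.isCompact_drawing A).isClosed.isOpen_compl
  refine plane_not_isPreconnected_diff_range (hopen.pathComponentIn (γ m)) γ.continuous hi
    (fun t h0 h1 => joinedIn_interior_arc hend hm0 hm1 h0 h1) ?_ ?_
  · rw [γ.source, γ.target]
    exact (P.joinedIn_drawing_of_reachable hr').mono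
      fun x hx hx' => (JoinedIn.mem hx').2 hx
  · rw [hγ]
    rcases (pathComponentIn (P.drawing A)ᶜ (γ m) \ P.arc e).eq_empty_or_nonempty with h | ⟨p, hp⟩
    · rw [h]
      exact isPreconnected_empty
    refine (IsPathConnected.isConnected ⟨p, hp, fun {q} hq => ?_⟩).isPreconnected
    have hd : ∀ x ∈ pathComponentIn (P.drawing A)ᶜ (γ m) \ P.arc e,
        x ∉ P.drawing (insert e A) := fun x hx => by
      rw [drawing_insert]
      exact fun h => h.elim (JoinedIn.mem hx.1).2 hx.2
    obtain ⟨δ, hδ⟩ := hcon p q (hd p hp) (hd q hq)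
    refine ⟨δ, fun t => ?_⟩
    have ht : ∀ t, δ t ∉ P.drawing A ∧ δ t ∉ P.arc e := fun t => by
      have := hδ t
      rw [drawing_insert, compl_union] at this
      exact this
    refine ⟨JoinedIn.trans hp.1 ?_, (ht t).2⟩
    exact ⟨(δ.subpath 0 t).cast (by simp) rfl, fun r => (ht _).1⟩

end PlaneEmbedding

theorem IsOpen.connectedComponentIn_eq_pathComponentIn {X : Type*} [TopologicalSpace X]
    [LocallyPathConnectedSpace X] {U : Set X} (hU : IsOpen U) {x : X} (hx : x ∈ U) :
    connectedComponentIn U x = pathComponentIn U x := by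
  refine subset_antisymm (fun y hy => ?_)
    ((isPathConnected_pathComponentIn hx).isConnected.isPreconnected.subset_connectedComponentIn
      (mem_pathComponentIn_self hx) pathComponentIn_subset)
  have hc : IsPathConnected (connectedComponentIn U x) :=
    (hU.connectedComponentIn).isConnected_iff_isPathConnected.1
      (isConnected_connectedComponentIn_iff.2 hx)
  exact (hc.joinedIn x (mem_connectedComponentIn hx) y hy).mono (connectedComponentIn_subset _ _)

namespace PlaneEmbedding

variable {V : Type} {G : SimpleGraph V} (P : PlaneEmbedding G)

/-- The faces of a plane graph. -/
abbrev Face : Type := {f : Set (ℝ × ℝ) // P.IsFace f}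

/-- The face containing a point off the drawing. -/
def faceAt (x : ℝ × ℝ) (hx : x ∉ P.image) : P.Face := ⟨connectedComponentIn P.imageᶜ x, x, hx, rfl⟩

theorem exists_eq_faceAt (f : P.Face) : ∃ x hx, f = P.faceAt x hx := by
  obtain ⟨f, x, hx, rfl⟩ := f
  exact ⟨x, hx, rfl⟩

/-- The edge `e` lies on the boundary of the face `f`. -/
def Borders (e : G.edgeSet) (f : P.Face) : Prop := P.arc e ⊆ closure f.1

/-- The midpoint of the arc of an edge. -/
noncomputable def mid (e : G.edgeSet) : ℝ × ℝ :=
  (P.arc_path e).choose_spec.choose_spec.2.choose ⟨1 / 2, by norm_num, by norm_num⟩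

theorem exists_arc (e : G.edgeSet) : ∃ u v, (e : Sym2 V) = s(u, v) ∧
    ∃ γ : Path (P.pos u) (P.pos v), Function.Injective γ ∧ range γ = P.arc e ∧
      ∃ m : I, 0 < m ∧ m < 1 ∧ γ m = P.mid e :=
  ⟨_, _, (P.arc_path e).choose_spec.choose_spec.1, _,
    (P.arc_path e).choose_spec.choose_spec.2.choose_spec.1,
    (P.arc_path e).choose_spec.choose_spec.2.choose_spec.2, _,
    unitInterval.pos_iff_ne_zero.2 half_ne.1, unitInterval.lt_one_iff_ne_one.2 half_ne.2, rfl⟩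

theorem isOpen_compl_image [Finite V] : IsOpen P.imageᶜ := by
  rw [← drawing_univ]
  exact (P.isCompact_drawing _).isClosed.isOpen_compl

theorem isOpen_compl_drawing [Finite V] (A : Set G.edgeSet) : IsOpen (P.drawing A)ᶜ :=
  (P.isCompact_drawing _).isClosed.isOpen_compl

theorem coe_faceAt [Finite V] (x : ℝ × ℝ) (hx : x ∉ P.image) :
    (P.faceAt x hx).1 = {y | JoinedIn P.imageᶜ x y} :=
  P.isOpen_compl_image.connectedComponentIn_eq_pathComponentIn hx

theorem faceAt_eq_iff [Finite V] {x y : ℝ × ℝ} {hx : x ∉ P.image} {hy : y ∉ P.image} :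
    P.faceAt x hx = P.faceAt y hy ↔ JoinedIn P.imageᶜ x y := by
  rw [Subtype.ext_iff, coe_faceAt, coe_faceAt]
  refine ⟨fun h => ?_, fun h => ?_⟩
  · have : y ∈ {z | JoinedIn P.imageᶜ x z} := h ▸ JoinedIn.refl hy
    exact this
  · ext z
    exact ⟨h.symm.trans, h.trans⟩

theorem image_eq_union_arc (e : G.edgeSet) : P.image = P.drawing {e}ᶜ ∪ P.arc e := by
  rw [← drawing_univ, ← drawing_insert]
  congr 1
  ext f
  simp [em]

theorem arc_subset_closure {γ : I → ℝ × ℝ} (hγ : Continuous γ) {S : Set (ℝ × ℝ)}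
    (h : ∀ t, 0 < t → t < 1 → γ t ∈ closure S) : range γ ⊆ closure S := by
  have h1 : closure (Ioo (0 : I) 1) = univ := by
    rw [closure_Ioo zero_ne_one]
    exact eq_univ_of_forall fun t => ⟨t.2.1, t.2.2⟩
  rw [← image_univ, ← h1]
  refine (image_closure_subset_closure_image hγ).trans (closure_minimal ?_ isClosed_closure)
  rintro _ ⟨t, ht, rfl⟩
  exact h t ht.1 ht.2

theorem borders_faceAt [Finite V] {e : G.edgeSet} {x : ℝ × ℝ} {hx : x ∉ P.image} :
    P.Borders e (P.faceAt x hx) ↔ JoinedIn (P.drawing {e}ᶜ)ᶜ x (P.mid e) := by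
  obtain ⟨u, v, huv, γ, hi, hγ, m, hm0, hm1, hm⟩ := P.exists_arc e
  have hend := fun t => P.eq_zero_or_one_of_mem_drawing (A := {e}ᶜ) (by simp) huv hi hγ (t := t)
  have hmΩ : P.mid e ∈ (P.drawing {e}ᶜ)ᶜ := fun h => by
    rw [← hm] at h
    exact (hend m h).elim hm0.ne' hm1.ne
  rw [Borders, coe_faceAt]
  constructor
  · intro h
    have hmem : P.mid e ∈ closure {y | JoinedIn P.imageᶜ x y} := h (hγ ▸ hm ▸ mem_range_self m)
    obtain ⟨y, hy, hxy⟩ := mem_closure_iff.1 hmem _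
      ((P.isOpen_compl_drawing {e}ᶜ).pathComponentIn (P.mid e)) (mem_pathComponentIn_self hmΩ)
    refine (JoinedIn.mono hxy ?_).trans (JoinedIn.symm hy)
    rw [P.image_eq_union_arc e]
    exact compl_subset_compl.2 subset_union_left
  · intro h
    rw [← hγ]
    refine arc_subset_closure γ.continuous fun t ht0 ht1 => ?_
    rw [P.image_eq_union_arc e, ← hγ]
    refine plane_mem_closure_of_joinedIn (P.isCompact_drawing _) γ.continuous hi hend ?_ ht0 ht1 ?_
    · rw [hγ]
      exact fun h => hx (P.image_eq_union_arc e ▸ .inr h)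
    · exact h.trans (hm ▸ joinedIn_interior_arc hend hm0.ne' hm1.ne ht0.ne' ht1.ne)

theorem dense_compl_arc (e : G.edgeSet) : Dense (P.arc e)ᶜ := by
  obtain ⟨u, v, huv, γ, hi, hγ⟩ := P.arc_path e
  rw [← hγ]
  obtain ⟨p, hp⟩ : ∃ p, p ∉ range γ := by
    by_contra! h
    exact noncompact_univ (ℝ × ℝ) (eq_univ_of_forall h ▸ isCompact_range γ.continuous)
  intro x
  by_cases hx : x ∈ range γ
  · refine arc_subset_closure γ.continuous (fun t ht0 ht1 => ?_) hx
    have hj : JoinedIn (∅ : Set (ℝ × ℝ))ᶜ p (γ t) := by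
      rw [compl_empty, joinedIn_univ]
      exact PathConnectedSpace.joined _ _
    have := plane_mem_closure_of_joinedIn isCompact_empty γ.continuous hi (by simp) hp ht0 ht1 hj
    refine closure_mono ?_ this
    rw [empty_union]
    exact fun y hy => (JoinedIn.mem hy).2
  · exact subset_closure hx

theorem dense_compl_image [Finite V] : Dense P.imageᶜ := by
  have : P.imageᶜ = (range P.pos)ᶜ ∩ ⋂ e, (P.arc e)ᶜ := by
    simp [image, compl_union, compl_iUnion]
  rw [this]
  refine Dense.inter_of_isOpen_left ?_ ?_ (finite_range _).isClosed.isOpen_compl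
  · exact (finite_range P.pos).countable.dense_compl ℝ
  · exact dense_iInter_of_isOpen (fun e => (P.isCompact_arc e).isClosed.isOpen_compl)
      P.dense_compl_arc

theorem mid_notMem (e : G.edgeSet) : P.mid e ∉ P.drawing {e}ᶜ := fun h => by
  obtain ⟨u, v, huv, γ, hi, hγ, m, hm0, hm1, hm⟩ := P.exists_arc e
  rw [← hm] at h
  exact (P.eq_zero_or_one_of_mem_drawing (A := {e}ᶜ) (by simp) huv hi hγ h).elim hm0.ne' hm1.ne

theorem exists_borders [Finite V] (e : G.edgeSet) : ∃ f, P.Borders e f := by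
  obtain ⟨x, hx, hx'⟩ := P.dense_compl_image.inter_open_nonempty _
    ((P.isOpen_compl_drawing {e}ᶜ).pathComponentIn (P.mid e))
    ⟨_, mem_pathComponentIn_self (P.mid_notMem e)⟩
  exact ⟨P.faceAt x hx', P.borders_faceAt.2 hx.symm⟩

theorem eq_or_eq_or_eq_of_borders [Finite V] {e : G.edgeSet} {f g h : P.Face} (hf : P.Borders e f)
    (hg : P.Borders e g) (hh : P.Borders e h) : f = g ∨ g = h ∨ f = h := by
  obtain ⟨x, hx, rfl⟩ := P.exists_eq_faceAt f
  obtain ⟨y, hy, rfl⟩ := P.exists_eq_faceAt g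
  obtain ⟨z, hz, rfl⟩ := P.exists_eq_faceAt h
  rw [borders_faceAt] at hf hg hh
  obtain ⟨u, v, huv, γ, hi, hγ⟩ := P.arc_path e
  have hend := fun t => P.eq_zero_or_one_of_mem_drawing (A := {e}ᶜ) (by simp) huv hi hγ (t := t)
  have hn : ∀ x, x ∉ P.image → x ∉ range γ := fun x hx h =>
    hx (P.image_eq_union_arc e ▸ .inr (hγ ▸ h))
  simp only [faceAt_eq_iff]
  rw [P.image_eq_union_arc e, ← hγ]
  exact plane_joinedIn_of_three (P.isCompact_drawing _) γ.continuous hi hend (hn x hx) (hn y hy)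
    (hn z hz) (hf.trans hg.symm) (hg.trans hh.symm)

/-- A property of faces that does not change across edges outside `B` does not change along
paths avoiding `B`. -/
theorem iff_of_joinedIn [Finite V] {B : Set G.edgeSet} {p q : ℝ × ℝ} (hp : p ∉ P.image)
    (hq : q ∉ P.image) (h : JoinedIn (P.drawing B)ᶜ p q) (τ : P.Face → Prop)
    (hτ : ∀ e ∉ B, ∀ f g, P.Borders e f → P.Borders e g → τ f → τ g) :
    τ (P.faceAt p hp) → τ (P.faceAt q hq) := by
  have hface : ∀ x (hx : x ∉ P.image), ∀ᶠ y in 𝓝 x, ∀ hy, P.faceAt y hy = P.faceAt x hx :=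
    fun x hx => by
      filter_upwards [(P.isOpen_compl_image.pathComponentIn x).mem_nhds
        (mem_pathComponentIn_self hx)] with y hy hy'
      exact P.faceAt_eq_iff.2 (JoinedIn.symm hy)
  have hloc : ∀ x ∉ P.drawing B, (∀ᶠ y in 𝓝 x, ∀ hy, τ (P.faceAt y hy)) ∨
      ∀ᶠ y in 𝓝 x, ∀ hy, ¬ τ (P.faceAt y hy) := by
    intro x hxB
    by_cases hx : x ∈ P.image
    · obtain ⟨e, hxe⟩ : ∃ e, x ∈ P.arc e := by
        rcases hx with hx | hx
        · exact (hxB (.inl (by simpa using hx))).elim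
        · simpa using hx
      have heB : e ∉ B := fun h => hxB (P.arc_subset_drawing h hxe)
      have hΩ : JoinedIn (P.drawing {e}ᶜ)ᶜ (P.mid e) x := by
        obtain ⟨u, v, huv, γ, hi, hγ, m, hm0, hm1, hm⟩ := P.exists_arc e
        have hend := fun t =>
          P.eq_zero_or_one_of_mem_drawing (A := {e}ᶜ) (by simp) huv hi hγ (t := t)
        rw [← hγ] at hxe
        obtain ⟨t, rfl⟩ := hxe
        rw [← hm]
        refine joinedIn_interior_arc hend hm0.ne' hm1.ne ?_ ?_
        · rintro rfl
          exact hxB (.inl (by simp))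
        · rintro rfl
          exact hxB (.inl (by simp))
      have hev : ∀ᶠ y in 𝓝 x, ∀ hy, P.Borders e (P.faceAt y hy) := by
        filter_upwards [((P.isOpen_compl_drawing {e}ᶜ).pathComponentIn (P.mid e)).mem_nhds hΩ]
          with y hy hy'
        exact P.borders_faceAt.2 (JoinedIn.symm hy)
      obtain ⟨f, hf⟩ := P.exists_borders e
      by_cases hτf : τ f
      · exact .inl (hev.mono fun y hy hy' => hτ e heB _ _ hf (hy hy') hτf)
      · exact .inr (hev.mono fun y hy hy' h => hτf (hτ e heB _ _ (hy hy') hf h))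
    · by_cases hτx : τ (P.faceAt x hx)
      · exact .inl ((hface x hx).mono fun y hy hy' => hy hy' ▸ hτx)
      · exact .inr ((hface x hx).mono fun y hy hy' => hy hy' ▸ hτx)
  have hnot : ∀ x, (∀ᶠ y in 𝓝 x, ∀ hy, τ (P.faceAt y hy)) →
      ¬ ∀ᶠ y in 𝓝 x, ∀ hy, ¬ τ (P.faceAt y hy) := fun x h1 h2 => by
    obtain ⟨y, hy, hy1, hy2⟩ :=
      (mem_closure_iff_frequently.1 (P.dense_compl_image x)).and_eventually
      (h1.and h2) |>.exists
    exact hy2 hy (hy1 hy)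
  obtain ⟨δ, hδ⟩ := h
  let ρ : I → Prop := fun t => ∀ᶠ y in 𝓝 (δ t), ∀ hy, τ (P.faceAt y hy)
  have hρ : IsLocallyConstant ρ := by
    rw [IsLocallyConstant.iff_eventually_eq]
    intro t
    have hc := δ.continuous.tendsto t
    rcases hloc (δ t) (hδ t) with h | h
    · filter_upwards [hc.eventually (eventually_eventually_nhds.2 h)] with s hs
      exact propext ⟨fun _ => h, fun _ => hs⟩
    · filter_upwards [hc.eventually (eventually_eventually_nhds.2 h)] with s hs
      exact propext ⟨fun h' => (hnot _ h' hs).elim, fun h' => (hnot _ h' h).elim⟩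
  have h01 : ρ 0 = ρ 1 := hρ.apply_eq_of_preconnectedSpace 0 1
  intro hτp
  have h0 : ρ 0 := by
    simp only [ρ, δ.source]
    exact (hface p hp).mono fun y hy hy' => hy hy' ▸ hτp
  rw [h01] at h0
  simp only [ρ, δ.target] at h0
  exact h0.self_of_nhds hq

theorem eq_of_isAcyclic [Finite V] {B : Set G.edgeSet} (hB : (spanningGraph B).IsAcyclic)
    (τ : P.Face → Prop)
    (hτ : ∀ e ∉ B, ∀ f g, P.Borders e f → P.Borders e g → τ f → τ g) (f g : P.Face) :
    τ f → τ g := by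
  obtain ⟨x, hx, rfl⟩ := P.exists_eq_faceAt f
  obtain ⟨y, hy, rfl⟩ := P.exists_eq_faceAt g
  have hsub : P.drawing B ⊆ P.image := P.drawing_univ ▸ P.drawing_mono (subset_univ _)
  exact P.iff_of_joinedIn hx hy (P.joinedIn_compl_drawing_of_isAcyclic hB
    (fun h => hx (hsub h)) (fun h => hy (hsub h))) τ hτ

instance finite_face [Finite V] : Finite P.Face := by
  by_cases h : Subsingleton P.Face
  · infer_instance
  have key : ∀ f : P.Face, ∃ e, P.Borders e f := by
    intro f
    by_contra! hcon
    refine h ⟨fun a b => ?_⟩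
    have := P.eq_of_isAcyclic (B := ∅) (by simp [spanningGraph])
      (fun g => g = f) (fun e _ g g' hg _ hgf => (hcon e (hgf ▸ hg)).elim) f
    exact (this a rfl).trans (this b rfl).symm
  choose e he using key
  have hfib : ∀ a, (e ⁻¹' {a}).Finite := by
    intro a
    by_contra hinf
    obtain ⟨t, ht, htc⟩ := Set.Infinite.exists_subset_card_eq hinf 3
    obtain ⟨x, y, z, hxy, hxz, hyz, rfl⟩ := Finset.card_eq_three.1 htc
    have hb : ∀ w ∈ ({x, y, z} : Finset P.Face), P.Borders a w := fun w hw => by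
      have : e w = a := ht hw
      exact this ▸ he w
    rcases P.eq_or_eq_or_eq_of_borders (hb x (by simp)) (hb y (by simp)) (hb z (by simp))
      with h | h | h
    exacts [hxy h, hyz h, hxz h]
  exact Set.finite_univ_iff.1 (Set.Finite.of_finite_fibers e (toFinite _) fun a _ => by
    simpa using hfib a)

end PlaneEmbedding

open scoped Classical in
/-- A family of edges, each with two ends and two sides, such that the even edge sets are exactly
the edge boundaries of sets of faces, and each nonempty even edge set contains one of maximum
degree two. -/
structure DualSystem (V E F : Type) [Fintype E] where
  vs : E → Finset V
  fs : E → Finset F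
  card_vs : ∀ e, (vs e).card = 2
  card_fs : ∀ e, (fs e).card = 2
  even_iff : ∀ z : E → ZMod 2, (∀ v, ∑ e with v ∈ vs e, z e = 0) ↔
    ∃ t : F → ZMod 2, ∀ e, z e = ∑ f ∈ fs e, t f
  exists_circuit : ∀ z : E → ZMod 2, z ≠ 0 → (∀ v, ∑ e with v ∈ vs e, z e = 0) →
    ∃ c : E → ZMod 2, c ≠ 0 ∧ (∀ v, ∑ e with v ∈ vs e, c e = 0) ∧ (∀ e, c e ≠ 0 → z e ≠ 0) ∧
      ∀ v, (Finset.univ.filter fun e => v ∈ vs e ∧ c e ≠ 0).card ≤ 2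

theorem ZMod.two_ne_zero_iff {a : ZMod 2} : a ≠ 0 ↔ a = 1 := by
  revert a; decide

theorem ZMod.two_add_self (a : ZMod 2) : a + a = 0 := by
  revert a; decide

namespace PlaneEmbedding

variable {V : Type} {G : SimpleGraph V}

theorem exists_circuit_of_not_isAcyclic [Finite V] {Z : Set G.edgeSet}
    (hZ : ¬ (spanningGraph Z).IsAcyclic) :
    ∃ C ⊆ Z, C.Nonempty ∧ (∀ v, {e ∈ C | v ∈ (e : Sym2 V)}.ncard = 0 ∨
      {e ∈ C | v ∈ (e : Sym2 V)}.ncard = 2) ∧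
      ¬ (spanningGraph C).IsAcyclic ∧ ∀ e ∈ C, (spanningGraph (C \ {e})).IsAcyclic := by
  obtain ⟨C, hCZ, hC⟩ := exists_minimal_le_of_wellFoundedLT
    (fun C : Set G.edgeSet => ¬ (spanningGraph C).IsAcyclic) Z hZ
  have hmin : ∀ e ∈ C, (spanningGraph (C \ {e})).IsAcyclic := fun e he => by
    by_contra h
    exact (hC.le_of_le h sdiff_subset he).2 rfl
  have hna := hC.prop
  obtain ⟨v, w, hw⟩ : ∃ v, ∃ w : (spanningGraph C).Walk v v, w.IsCycle := by
    have := hC.prop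
    simp only [SimpleGraph.IsAcyclic] at this
    push Not at this
    exact this
  have hwC : ∀ e ∈ C, (e : Sym2 V) ∈ w.edges := by
    have h' : ¬ (spanningGraph {e ∈ C | (e : Sym2 V) ∈ w.edges}).IsAcyclic := fun hac => by
      refine hac _ (hw.transfer (H := spanningGraph {e ∈ C | (e : Sym2 V) ∈ w.edges}) ?_)
      intro e
      induction e with | _ a b => ?_
      intro hab
      obtain ⟨f, hf, hfab⟩ := spanningGraph_adj.1 (w.adj_of_mem_edges hab)
      exact spanningGraph_adj.2 ⟨f, ⟨hf, hfab ▸ hab⟩, hfab⟩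
    exact fun e he => (hC.le_of_le h' (sep_subset _ _) he).2
  refine ⟨C, hCZ, ?_, fun v => ?_, hna, hmin⟩
  · rw [nonempty_iff_ne_empty]
    rintro rfl
    exact hna (by simp [spanningGraph])
  have himg : ((↑) : G.edgeSet → Sym2 V) '' {e ∈ C | v ∈ (e : Sym2 V)} =
      (fun u => s(v, u)) '' w.toSubgraph.neighborSet v := by
    ext x
    constructor
    · rintro ⟨e, ⟨he, hv⟩, rfl⟩
      obtain ⟨u, hu⟩ := Sym2.mem_iff_exists.1 hv
      refine ⟨u, ?_, hu.symm⟩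
      rw [SimpleGraph.Subgraph.mem_neighborSet, SimpleGraph.Walk.adj_toSubgraph_iff_mem_edges, ← hu]
      exact hwC e he
    · rintro ⟨u, hu, rfl⟩
      rw [SimpleGraph.Subgraph.mem_neighborSet, SimpleGraph.Walk.adj_toSubgraph_iff_mem_edges] at hu
      obtain ⟨f, hf, hfab⟩ := spanningGraph_adj.1 (w.adj_of_mem_edges hu)
      exact ⟨f, ⟨hf, hfab ▸ Sym2.mem_mk_left _ _⟩, hfab⟩
  have hcard : {e ∈ C | v ∈ (e : Sym2 V)}.ncard = (w.toSubgraph.neighborSet v).ncard := by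
    rw [← ncard_image_of_injective _ Subtype.val_injective, himg,
      ncard_image_of_injective _ fun a b h => Sym2.congr_right.1 h]
  rw [hcard]
  by_cases hv : v ∈ w.support
  · exact .inr (hw.ncard_neighborSet_toSubgraph_eq_two hv)
  · left
    rw [ncard_eq_zero]
    ext u
    simp only [SimpleGraph.Subgraph.mem_neighborSet, mem_empty_iff_false, iff_false]
    exact fun h => hv (w.mem_verts_toSubgraph.1 h.fst_mem)

theorem reachable_of_isAcyclic_of_not_isAcyclic {C : Set G.edgeSet} {e : G.edgeSet} (he : e ∈ C)
    (hC : ¬ (spanningGraph C).IsAcyclic) (hCe : (spanningGraph (C \ {e})).IsAcyclic) {u v : V}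
    (huv : (e : Sym2 V) = s(u, v)) : (spanningGraph (C \ {e})).Reachable u v := by
  by_contra hn
  refine hC (((SimpleGraph.isAcyclic_add_edge_iff_of_not_reachable u v hn).2 hCe).anti ?_)
  intro a b hab
  obtain ⟨f, hf, hfab⟩ := spanningGraph_adj.1 hab
  by_cases hfe : f = e
  · right
    rw [SimpleGraph.edge_adj]
    subst hfe
    rw [huv, Sym2.eq_iff] at hfab
    exact ⟨by tauto, hab.ne⟩
  · exact .inl (spanningGraph_adj.2 ⟨f, ⟨hf, hfe⟩, hfab⟩)

variable (P : PlaneEmbedding G)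

theorem exists_separating_of_circuit [Finite V] {C : Set G.edgeSet} (hne : C.Nonempty)
    (hC : ¬ (spanningGraph C).IsAcyclic) (hCe : ∀ e ∈ C, (spanningGraph (C \ {e})).IsAcyclic) :
    ∃ T : Set P.Face, ∀ e, e ∈ C ↔ ∃ f g, P.Borders e f ∧ P.Borders e g ∧ f ∈ T ∧ g ∉ T := by
  obtain ⟨e₀, he₀⟩ := hne
  have hmove : ∀ p ∉ P.drawing C, ∃ p', p' ∉ P.image ∧ JoinedIn (P.drawing C)ᶜ p p' := by
    intro p hp
    obtain ⟨x, hx, hx'⟩ := P.dense_compl_image.inter_open_nonempty _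
      ((P.isOpen_compl_drawing C).pathComponentIn p) ⟨_, mem_pathComponentIn_self hp⟩
    exact ⟨x, hx', hx⟩
  obtain ⟨p, q, hp, hq, hpq⟩ : ∃ p q, p ∉ P.image ∧ q ∉ P.image ∧
      ¬ JoinedIn (P.drawing C)ᶜ p q := by
    obtain ⟨u, v, huv, -⟩ := P.arc_path e₀
    obtain ⟨p, q, hp, hq, hpq⟩ := P.exists_not_joinedIn_insert (A := C \ {e₀}) (by simp) huv
      (reachable_of_isAcyclic_of_not_isAcyclic he₀ hC (hCe e₀ he₀) huv)
    rw [insert_sdiff_self_of_mem he₀] at hp hq hpq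
    obtain ⟨p', hp', hpp'⟩ := hmove p hp
    obtain ⟨q', hq', hqq'⟩ := hmove q hq
    exact ⟨p', q', hp', hq', fun h => hpq (hpp'.trans (h.trans hqq'.symm))⟩
  have hsub : P.drawing C ⊆ P.image := P.drawing_univ ▸ P.drawing_mono (subset_univ _)
  let T : Set P.Face := {f | ∃ x hx, f = P.faceAt x hx ∧ JoinedIn (P.drawing C)ᶜ p x}
  have hT : ∀ x hx, P.faceAt x hx ∈ T ↔ JoinedIn (P.drawing C)ᶜ p x := by
    refine fun x hx => ⟨?_, fun h => ⟨x, hx, rfl, h⟩⟩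
    rintro ⟨y, hy, hxy, h⟩
    exact h.trans ((P.faceAt_eq_iff.1 hxy).symm.mono (compl_subset_compl.2 hsub))
  have hout : ∀ e ∉ C, ∀ f g, P.Borders e f → P.Borders e g → f ∈ T → g ∈ T := by
    intro e he f g hf hg
    obtain ⟨x, hx, rfl⟩ := P.exists_eq_faceAt f
    obtain ⟨y, hy, rfl⟩ := P.exists_eq_faceAt g
    rw [borders_faceAt] at hf hg
    rw [hT, hT]
    exact fun h => h.trans ((hf.trans hg.symm).mono
      (compl_subset_compl.2 (P.drawing_mono (subset_compl_singleton_iff.2 he))))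
  refine ⟨T, fun e => ⟨fun he => ?_, ?_⟩⟩
  · by_contra! hcon
    refine hpq ((hT q hq).1 (P.eq_of_isAcyclic (hCe e he) (· ∈ T) ?_ (P.faceAt p hp) _
      ((hT p hp).2 (JoinedIn.refl fun h => hp (hsub h)))))
    intro e' he' f g hf hg hfT
    by_cases hee : e' = e
    · subst hee
      exact hcon f g hf hg hfT
    · exact hout e' (fun h => he' ⟨h, hee⟩) f g hf hg hfT
  · rintro ⟨f, g, hf, hg, hfT, hgT⟩
    by_contra he
    exact hgT (hout e he f g hf hg hfT)

end PlaneEmbedding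

namespace PlaneEmbedding

variable {V : Type} {G : SimpleGraph V}

open scoped Classical in
/-- The edges of `G` incident with `v`. -/
noncomputable def incident [Fintype V] (v : V) : Finset G.edgeSet :=
  Finset.univ.filter fun e => v ∈ (e : Sym2 V)

theorem mem_incident [Fintype V] {v : V} {e : G.edgeSet} : e ∈ incident v ↔ v ∈ (e : Sym2 V) := by
  simp [incident]

open scoped Classical in
theorem eq_zero_of_isAcyclic_support [Fintype V] {z : G.edgeSet → ZMod 2}
    (hz : ∀ v, ∑ e ∈ incident v, z e = 0)
    (hac : (spanningGraph {e | z e ≠ 0}).IsAcyclic) : z = 0 := by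
  by_contra hne
  obtain ⟨e₀, he₀⟩ := Function.ne_iff.1 hne
  obtain ⟨u, v, huv⟩ : ∃ u v, (e₀ : Sym2 V) = s(u, v) :=
    ⟨_, _, (Quot.out_eq (e₀ : Sym2 V)).symm⟩
  set A := {e | z e ≠ 0} \ {e₀} with hA
  have hnr := not_reachable_of_isAcyclic_insert (A := A) (e := e₀) (by simp [hA])
    (by rwa [hA, insert_sdiff_self_of_mem he₀]) huv
  set W := Finset.univ.filter fun w => (spanningGraph A).Reachable u w
  have h1 : ∑ w ∈ W, ∑ e ∈ incident w, z e = 0 := Finset.sum_eq_zero fun w _ => hz w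
  rw [Finset.sum_comm' (s := W) (t := incident) (f := fun _ e => z e)
    (t' := Finset.univ) (s' := fun e => W.filter fun w => w ∈ (e : Sym2 V))
    (by simp [mem_incident])] at h1
  simp only [Finset.sum_const, nsmul_eq_mul] at h1
  rw [Finset.sum_eq_single e₀] at h1
  · have : W.filter (fun w => w ∈ (e₀ : Sym2 V)) = {u} := by
      ext w
      simp only [Finset.mem_filter, Finset.mem_singleton, huv, Sym2.mem_iff, W, Finset.mem_univ,
        true_and]
      constructor
      · rintro ⟨h, rfl | rfl⟩
        exacts [rfl, (hnr h).elim]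
      · rintro rfl
        exact ⟨SimpleGraph.Reachable.refl _, .inl rfl⟩
    rw [this] at h1
    exact he₀ (by simpa using h1)
  · intro e _ hee
    by_cases hze : z e = 0
    · simp [hze]
    obtain ⟨a, b, hab⟩ : ∃ u v, (e : Sym2 V) = s(u, v) := ⟨_, _, (Quot.out_eq (e : Sym2 V)).symm⟩
    have hadj : (spanningGraph A).Adj a b := spanningGraph_adj.2 ⟨e, ⟨hze, hee⟩, hab⟩
    by_cases ha : (spanningGraph A).Reachable u a
    · have : W.filter (fun w => w ∈ (e : Sym2 V)) = {a, b} := by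
        ext w
        simp only [Finset.mem_filter, Finset.mem_insert, Finset.mem_singleton, hab, Sym2.mem_iff,
          W, Finset.mem_univ, true_and, and_iff_right_iff_imp]
        rintro (rfl | rfl)
        exacts [ha, ha.trans hadj.reachable]
      rw [this, Finset.card_pair hadj.ne]
      simp [show (2 : ZMod 2) = 0 from rfl]
    · have : W.filter (fun w => w ∈ (e : Sym2 V)) = ∅ := by
        ext w
        simp only [Finset.mem_filter, hab, Sym2.mem_iff, W, Finset.mem_univ, true_and,
          Finset.notMem_empty, iff_false, not_and]
        rintro hw (rfl | rfl)
        exacts [ha hw, ha (hw.trans hadj.reachable.symm)]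
      rw [this]
      simp
  · simp

variable (P : PlaneEmbedding G)

/-- The faces bordered by `e` are exactly `f` and `g`. -/
def Sides (e : G.edgeSet) (f g : P.Face) : Prop := ∀ h, P.Borders e h ↔ h = f ∨ h = g

theorem exists_sides [Finite V] (e : G.edgeSet) : ∃ f g, P.Sides e f g := by
  obtain ⟨f, hf⟩ := P.exists_borders e
  by_cases h : ∃ g, P.Borders e g ∧ g ≠ f
  · obtain ⟨g, hg, hgf⟩ := h
    refine ⟨f, g, fun k => ⟨fun hk => ?_, ?_⟩⟩
    · rcases P.eq_or_eq_or_eq_of_borders hf hg hk with h | h | h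
      exacts [(hgf h.symm).elim, .inr h.symm, .inl h.symm]
    · rintro (rfl | rfl)
      exacts [hf, hg]
  · push Not at h
    exact ⟨f, f, fun k => ⟨fun hk => .inl (h k hk), by rintro (rfl | rfl) <;> exact hf⟩⟩

/-- The function `z` on edges is the coboundary of the function `t` on faces. -/
def IsCoboundary (z : G.edgeSet → ZMod 2) (t : P.Face → ZMod 2) : Prop :=
  ∀ e f g, P.Sides e f g → z e = t f + t g

theorem eq_zero_of_isCoboundary [Finite V] {z : G.edgeSet → ZMod 2} {t : P.Face → ZMod 2}
    (h : P.IsCoboundary z t) (hac : (spanningGraph {e | z e ≠ 0}).IsAcyclic) : z = 0 := by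
  funext e
  obtain ⟨f, g, hfg⟩ := P.exists_sides e
  rw [h e f g hfg, P.eq_of_isAcyclic hac (fun k => t k = t g) ?_ g f rfl]
  · exact ZMod.two_add_self _
  · intro e' he' a b ha hb hta
    obtain ⟨f', g', hfg'⟩ := P.exists_sides e'
    have h0 : t f' + t g' = 0 := by
      rw [← h e' f' g' hfg']
      simpa using he'
    have h1 : t f' = t g' := by
      revert h0
      generalize t f' = x
      generalize t g' = y
      revert x y
      decide
    have h2 : ∀ k, P.Borders e' k → t k = t g' := fun k hk => by
      rcases (hfg' k).1 hk with rfl | rfl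
      exacts [h1, rfl]
    rw [h2 b hb, ← h2 a ha, hta]

open scoped Classical in
theorem exists_circuit_function [Fintype V] {z : G.edgeSet → ZMod 2}
    (hz : ¬ (spanningGraph {e | z e ≠ 0}).IsAcyclic) : ∃ c : G.edgeSet → ZMod 2, c ≠ 0 ∧
      (∀ v, ∑ e ∈ incident v, c e = 0) ∧ (∃ t, P.IsCoboundary c t) ∧
      (∀ e, c e ≠ 0 → z e ≠ 0) ∧
      ∀ v, (Finset.univ.filter fun e : G.edgeSet => v ∈ (e : Sym2 V) ∧ c e ≠ 0).card ≤ 2 := by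
  obtain ⟨C, hCz, hne, hdeg, hC, hCe⟩ := exists_circuit_of_not_isAcyclic hz
  have hcard : ∀ v, {e ∈ C | v ∈ (e : Sym2 V)}.ncard =
      (Finset.univ.filter fun e : G.edgeSet => v ∈ (e : Sym2 V) ∧ e ∈ C).card := fun v => by
    rw [← ncard_coe_finset]
    congr 1
    ext e
    simp [and_comm]
  refine ⟨fun e => if e ∈ C then 1 else 0, ?_, fun v => ?_, ?_, fun e he => ?_, fun v => ?_⟩
  · obtain ⟨e, he⟩ := hne
    exact fun h => by simpa [he] using congrFun h e
  · rw [Finset.sum_ite, incident, Finset.filter_filter, Finset.sum_const_zero, add_zero,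
      Finset.sum_const,
      ← hcard]
    rcases hdeg v with h | h <;> rw [h] <;> rfl
  · obtain ⟨T, hT⟩ := P.exists_separating_of_circuit hne hC hCe
    refine ⟨fun f => if f ∈ T then 1 else 0, fun e f g hfg => ?_⟩
    have : e ∈ C ↔ ¬ (f ∈ T ↔ g ∈ T) := by
      rw [hT]
      constructor
      · rintro ⟨f', g', hf', hg', hf'T, hg'T⟩ hiff
        rw [hfg] at hf' hg'
        rcases hf' with rfl | rfl <;> rcases hg' with rfl | rfl <;> tauto
      · intro h
        have hf := (hfg f).2 (.inl rfl)
        have hg := (hfg g).2 (.inr rfl)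
        by_cases hfT : f ∈ T
        · exact ⟨f, g, hf, hg, hfT, by tauto⟩
        · exact ⟨g, f, hg, hf, by tauto, hfT⟩
    by_cases hf : f ∈ T <;> by_cases hg : g ∈ T <;> simp [this, hf, hg, ZMod.two_add_self]
  · exact hCz (by_contra fun h => he (by simp [h]))
  · have := hdeg v
    rw [hcard] at this
    simp only [ite_eq_right_iff, one_ne_zero, imp_false, not_not, ne_eq]
    omega

theorem circuit_induction [Fintype V] {Q R : (G.edgeSet → ZMod 2) → Prop}
    (hQ : ∀ z : G.edgeSet → ZMod 2, Q z → (spanningGraph {e | z e ≠ 0}).IsAcyclic → z = 0)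
    (hQR : ∀ z : G.edgeSet → ZMod 2, ¬ (spanningGraph {e | z e ≠ 0}).IsAcyclic →
      ∃ c : G.edgeSet → ZMod 2, c ≠ 0 ∧
      (∀ e, c e ≠ 0 → z e ≠ 0) ∧ Q c ∧ R c)
    (hadd : ∀ z c, Q z → Q c → Q (z + c)) (hR0 : R 0) (hRadd : ∀ z c, R z → R c → R (z + c))
    {z : G.edgeSet → ZMod 2} (hz : Q z) : R z := by
  classical
  induction hn : (Finset.univ.filter fun e => z e ≠ 0).card using Nat.strong_induction_on
    generalizing z with | _ n ih => ?_
  by_cases hac : (spanningGraph {e | z e ≠ 0}).IsAcyclic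
  · rw [hQ z hz hac]
    exact hR0
  obtain ⟨c, hc0, hcz, hcQ, hcR⟩ := hQR z hac
  have hzc : z = (z + c) + c := by
    funext e
    simp [add_assoc, ZMod.two_add_self]
  rw [hzc]
  refine hRadd _ _ (ih _ ?_ (hadd _ _ hz hcQ) rfl) hcR
  rw [← hn]
  refine Finset.card_lt_card ?_
  rw [Finset.ssubset_iff_of_subset]
  · obtain ⟨e, he⟩ := Function.ne_iff.1 hc0
    refine ⟨e, by simpa using hcz e he, ?_⟩
    have h1 := ZMod.two_ne_zero_iff.1 he
    have h2 := ZMod.two_ne_zero_iff.1 (hcz e he)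
    simp [h1, h2, ZMod.two_add_self]
  · intro e
    simp only [Pi.add_apply, Finset.mem_filter, Finset.mem_univ, true_and]
    intro h hze
    rw [hze, zero_add] at h
    exact hcz e h hze

open scoped Classical in
/-- Planar duality: the even edge functions are the coboundaries of functions on faces. -/
theorem even_iff_exists_isCoboundary [Fintype V] {z : G.edgeSet → ZMod 2} :
    (∀ v, ∑ e ∈ incident v, z e = 0) ↔ ∃ t, P.IsCoboundary z t := by
  have hev : ∀ z c : G.edgeSet → ZMod 2, (∀ v, ∑ e ∈ incident v, z e = 0) →
      (∀ v, ∑ e ∈ incident v, c e = 0) →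
      ∀ v, ∑ e ∈ incident v, (z + c) e = 0 := fun z c h h' v => by
    simp [Finset.sum_add_distrib, h v, h' v]
  have hco : ∀ z c : G.edgeSet → ZMod 2, (∃ t, P.IsCoboundary z t) →
      (∃ t, P.IsCoboundary c t) → ∃ t, P.IsCoboundary (z + c) t := by
    rintro z c ⟨t, ht⟩ ⟨s, hs⟩
    refine ⟨t + s, fun e f g h => ?_⟩
    simp only [Pi.add_apply, ht e f g h, hs e f g h]
    ring
  constructor
  · exact circuit_induction (Q := fun z => ∀ v, ∑ e ∈ incident v, z e = 0)
      (R := fun z => ∃ t, P.IsCoboundary z t) (fun _ => eq_zero_of_isAcyclic_support)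
      (fun z hz => let ⟨c, h1, h2, h3, h4, _⟩ := P.exists_circuit_function hz; ⟨c, h1, h4, h2, h3⟩)
      hev ⟨0, fun e f g _ => by simp⟩ hco
  · exact circuit_induction (R := fun z => ∀ v, ∑ e ∈ incident v, z e = 0)
      (Q := fun z => ∃ t, P.IsCoboundary z t) (fun _ ⟨_, ht⟩ => P.eq_zero_of_isCoboundary ht)
      (fun z hz => let ⟨c, h1, h2, h3, h4, _⟩ := P.exists_circuit_function hz; ⟨c, h1, h4, h3, h2⟩)
      hco (fun v => by simp) hev

end PlaneEmbedding

namespace PlaneEmbedding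

variable {V : Type} {G : SimpleGraph V} (P : PlaneEmbedding G)

/-- The edges bordering two distinct faces. -/
abbrev DualEdge : Type := {e : G.edgeSet // ∃ f g, f ≠ g ∧ P.Sides e f g}

variable [Fintype V]

noncomputable instance fintypeDualEdge : Fintype P.DualEdge := Fintype.ofFinite _

noncomputable instance fintypeFace : Fintype P.Face := Fintype.ofFinite _

open scoped Classical in
/-- Extension by zero of a function on the edges bordering two faces. -/
noncomputable def extendZero (z : P.DualEdge → ZMod 2) (e : G.edgeSet) : ZMod 2 :=
  if h : ∃ f g, f ≠ g ∧ P.Sides e f g then z ⟨e, h⟩ else 0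

theorem extendZero_coe (z : P.DualEdge → ZMod 2) (e : P.DualEdge) : P.extendZero z e.1 = z e :=
  dif_pos e.2

open scoped Classical in
theorem sum_dualEdge (z : G.edgeSet → ZMod 2) (v : V)
    (hz : ∀ e, (¬ ∃ f g, f ≠ g ∧ P.Sides e f g) → z e = 0) :
    ∑ e : P.DualEdge with v ∈ (e.1 : Sym2 V).toFinset, z e.1 = ∑ e ∈ incident v, z e := by
  refine Finset.sum_of_injOn Subtype.val Subtype.val_injective.injOn ?_ ?_ fun _ _ => rfl
  · intro e he
    simpa [mem_incident] using he
  · intro e he hne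
    refine hz e fun h => hne ⟨⟨e, h⟩, ?_, rfl⟩
    simpa [mem_incident] using he

open scoped Classical in
theorem sum_borders (e : G.edgeSet) {f g : P.Face} (hne : f ≠ g) (h : P.Sides e f g)
    (t : P.Face → ZMod 2) : ∑ k with P.Borders e k, t k = t f + t g := by
  have : Finset.univ.filter (P.Borders e) = {f, g} := by
    ext k
    simp [h k]
  rw [this, Finset.sum_pair hne]

open scoped Classical in
theorem isCoboundary_extendZero {z : P.DualEdge → ZMod 2} {t : P.Face → ZMod 2} :
    P.IsCoboundary (P.extendZero z) t ↔ ∀ e : P.DualEdge, z e = ∑ f with P.Borders e.1 f, t f := by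
  constructor
  · rintro h ⟨e, f, g, hne, hfg⟩
    rw [P.sum_borders e hne hfg, ← h e f g hfg]
    exact (P.extendZero_coe z _).symm
  · intro h e f g hfg
    by_cases hne : f = g
    · subst hne
      rw [ZMod.two_add_self, extendZero, dif_neg]
      rintro ⟨f', g', hne, hfg'⟩
      have h1 := (hfg f').1 ((hfg' f').2 (.inl rfl))
      have h2 := (hfg g').1 ((hfg' g').2 (.inr rfl))
      simp only [or_self] at h1 h2
      exact hne (h1.trans h2.symm)
    · rw [← P.sum_borders e hne hfg]
      exact (P.extendZero_coe z ⟨e, f, g, hne, hfg⟩).trans (h _)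

open scoped Classical in
/-- The dual system of a plane graph. -/
noncomputable def dualSystem : DualSystem V P.DualEdge P.Face where
  vs e := (e.1 : Sym2 V).toFinset
  fs e := Finset.univ.filter (P.Borders e.1)
  card_vs e := Sym2.card_toFinset_of_not_isDiag _ (G.not_isDiag_of_mem_edgeSet e.1.2)
  card_fs := by
    rintro ⟨e, f, g, hne, h⟩
    have : Finset.univ.filter (P.Borders e) = {f, g} := by
      ext k
      simp [h k]
    rw [this, Finset.card_pair hne]
  even_iff z := by
    simp_rw [← isCoboundary_extendZero, ← even_iff_exists_isCoboundary,
      ← P.sum_dualEdge (P.extendZero z) _ fun e he => dif_neg he, extendZero_coe]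
  exists_circuit z hz hev := by
    have hev' : ∀ v, ∑ e ∈ incident v, P.extendZero z e = 0 := fun v => by
      rw [← P.sum_dualEdge (P.extendZero z) _ fun e he => dif_neg he]
      simpa only [extendZero_coe] using hev v
    have hne : P.extendZero z ≠ 0 := fun h => hz (funext fun e => by
      rw [← P.extendZero_coe z, h]; rfl)
    obtain ⟨c, hc0, hc, -, hcz, hdeg⟩ := P.exists_circuit_function
      fun hac => hne (eq_zero_of_isAcyclic_support hev' hac)
    have hc' : ∀ e, (¬ ∃ f g, f ≠ g ∧ P.Sides e f g) → c e = 0 := fun e he =>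
      by_contra fun h => hcz e h (dif_neg he)
    refine ⟨fun e => c e.1, fun h => hc0 (funext fun e => ?_), fun v => ?_, fun e he => ?_,
      fun v => ?_⟩
    · by_cases he : ∃ f g, f ≠ g ∧ P.Sides e f g
      exacts [congrFun h ⟨e, he⟩, hc' e he]
    · rw [P.sum_dualEdge c v hc', hc v]
    · rw [← P.extendZero_coe z]
      exact hcz _ he
    · refine le_trans (Finset.card_le_card_of_injOn Subtype.val (fun e he => ?_)
        Subtype.val_injective.injOn) (hdeg v)
      simpa using he

theorem mem_dualSystem_vs {e : P.DualEdge} {v : V} :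
    v ∈ P.dualSystem.vs e ↔ v ∈ (e.1 : Sym2 V) := by
  simp [dualSystem]

theorem mem_dualSystem_fs {e : P.DualEdge} {f : P.Face} :
    f ∈ P.dualSystem.fs e ↔ P.Borders e.1 f := by
  simp [dualSystem]

end PlaneEmbedding

end

theorem exists_coboundary_of_orthogonal {E V : Type} [Fintype E] [DecidableEq V]
    (r : E → Finset V) (d : E → ZMod 2)
    (h : ∀ z : E → ZMod 2, (∀ v, ∑ e with v ∈ r e, z e = 0) → ∑ e, d e * z e = 0) :
    ∃ x : V → ZMod 2, ∀ e, d e = ∑ v ∈ r e, x v := by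
  classical
  let M : (E → ZMod 2) →ₗ[ZMod 2] (V → ZMod 2) :=
    LinearMap.pi fun v => ∑ e with v ∈ r e, LinearMap.proj e
  let φ : (E → ZMod 2) →ₗ[ZMod 2] ZMod 2 := ∑ e, d e • LinearMap.proj e
  have hφ : φ ∈ LinearMap.range M.dualMap := by
    rw [LinearMap.range_dualMap_eq_dualAnnihilator_ker, Submodule.mem_dualAnnihilator]
    intro z hz
    have : ∀ v, ∑ e with v ∈ r e, z e = 0 := fun v => by
      simpa [M] using congrFun (LinearMap.mem_ker.1 hz) v
    simpa [φ] using h z this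
  obtain ⟨ψ, hψ⟩ := hφ
  refine ⟨fun v => ψ (Pi.single v 1), fun e => ?_⟩
  have h1 : φ (Pi.single e 1) = d e := by
    simp [φ, Pi.single_apply]
  have h2 : M (Pi.single e 1) = ∑ v ∈ r e, Pi.single v 1 := by
    funext v
    simp [M, Pi.single_apply, Finset.sum_apply]
  rw [← h1, ← hψ, LinearMap.dualMap_apply, h2, map_sum]

namespace DualSystem

variable {V E F : Type} [Fintype E] (S : DualSystem V E F)

open scoped Classical in
/-- The edges at the vertex `v`. -/
noncomputable def star (v : V) : Finset E := Finset.univ.filter fun e => v ∈ S.vs e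

open scoped Classical in
/-- The edges on the boundary of the face `f`. -/
noncomputable def boundary (f : F) : Finset E := Finset.univ.filter fun e => f ∈ S.fs e

open scoped Classical in
/-- The edges on both sides of the angle of `f` at `v`. -/
noncomputable def angle (v : V) (f : F) : Finset E :=
  Finset.univ.filter fun e => v ∈ S.vs e ∧ f ∈ S.fs e

variable {S} in
@[simp] theorem mem_star {v : V} {e : E} : e ∈ S.star v ↔ v ∈ S.vs e := by simp [star]

variable {S} in
@[simp] theorem mem_boundary {f : F} {e : E} : e ∈ S.boundary f ↔ f ∈ S.fs e := by simp [boundary]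

variable {S} in
@[simp] theorem mem_angle {v : V} {f : F} {e : E} :
    e ∈ S.angle v f ↔ v ∈ S.vs e ∧ f ∈ S.fs e := by simp [angle]

/-- A function on edges with even sum at each vertex. -/
def IsEven (z : E → ZMod 2) : Prop := ∀ v, ∑ e ∈ S.star v, z e = 0

theorem isEven_iff {z : E → ZMod 2} :
    S.IsEven z ↔ ∃ t : F → ZMod 2, ∀ e, z e = ∑ f ∈ S.fs e, t f :=
  S.even_iff z

open scoped Classical in
/-- The indicator function of the boundary of `f`. -/
noncomputable def face (f : F) (e : E) : ZMod 2 := if f ∈ S.fs e then 1 else 0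

theorem isEven_face (f : F) : S.IsEven (S.face f) := by
  classical
  rw [isEven_iff]
  exact ⟨Pi.single f 1, fun e => by simp [face, Pi.single_apply]⟩

theorem sum_mul_eq_zero [Fintype F] {d z : E → ZMod 2}
    (hd : ∀ f, ∑ e ∈ S.boundary f, d e = 0) (hz : S.IsEven z) : ∑ e, d e * z e = 0 := by
  obtain ⟨t, ht⟩ := S.isEven_iff.1 hz
  simp_rw [ht, Finset.mul_sum]
  rw [Finset.sum_comm' (t' := Finset.univ) (s' := S.boundary) (by simp)]
  refine Finset.sum_eq_zero fun f _ => ?_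
  rw [← Finset.sum_mul, hd, zero_mul]

theorem exists_vertex_coboundary [Fintype F] {d : E → ZMod 2}
    (hd : ∀ f, ∑ e ∈ S.boundary f, d e = 0) : ∃ x : V → ZMod 2, ∀ e, d e = ∑ v ∈ S.vs e, x v := by
  classical
  refine exists_coboundary_of_orthogonal S.vs d fun z hz => S.sum_mul_eq_zero hd fun v => ?_
  rw [← hz v]
  congr 1

/-- The dual graph of the system has no separation of order at most one. -/
def Indecomposable : Prop := ∀ S₁ S₂ : Set F, S₁ ∪ S₂ = Set.univ → (S₁ ∩ S₂).Subsingleton →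
  (∀ e, (S.fs e : Set F) ⊆ S₁ ∨ (S.fs e : Set F) ⊆ S₂) → S₁ = Set.univ ∨ S₂ = Set.univ

theorem exists_vs (e : E) : ∃ u v, u ≠ v ∧ ∀ w, w ∈ S.vs e ↔ w = u ∨ w = v := by
  classical
  obtain ⟨u, v, h, he⟩ := Finset.card_eq_two.1 (S.card_vs e)
  exact ⟨u, v, h, by simp [he]⟩

theorem exists_fs (e : E) : ∃ f g, f ≠ g ∧ ∀ h, h ∈ S.fs e ↔ h = f ∨ h = g := by
  classical
  obtain ⟨u, v, h, he⟩ := Finset.card_eq_two.1 (S.card_fs e)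
  exact ⟨u, v, h, by simp [he]⟩

theorem sum_vs {e : E} {u v : V} (hne : u ≠ v) (h : ∀ w, w ∈ S.vs e ↔ w = u ∨ w = v)
    (x : V → ZMod 2) : ∑ w ∈ S.vs e, x w = x u + x v := by
  classical
  rw [show S.vs e = {u, v} by ext w; simp [h], Finset.sum_pair hne]

theorem sum_fs {e : E} {u v : F} (hne : u ≠ v) (h : ∀ w, w ∈ S.fs e ↔ w = u ∨ w = v)
    (x : F → ZMod 2) : ∑ w ∈ S.fs e, x w = x u + x v := by
  classical
  rw [show S.fs e = {u, v} by ext w; simp [h], Finset.sum_pair hne]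

variable {S}

/-- In an indecomposable system, face boundaries are minimal even sets. -/
theorem Indecomposable.eq_zero_or_eq_face (hS : S.Indecomposable) {z : E → ZMod 2}
    (hz : S.IsEven z) {f : F} (hzf : ∀ e, z e ≠ 0 → f ∈ S.fs e) : z = 0 ∨ z = S.face f := by
  obtain ⟨t, ht, htf⟩ : ∃ t : F → ZMod 2, (∀ e, z e = ∑ f ∈ S.fs e, t f) ∧ t f = 0 := by
    obtain ⟨t, ht⟩ := S.isEven_iff.1 hz
    refine ⟨fun g => t g + t f, fun e => ?_, ZMod.two_add_self _⟩
    rw [ht e, Finset.sum_add_distrib, Finset.sum_const, S.card_fs]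
    simp [show (2 : ZMod 2) = 0 from rfl]
  have hsep := hS {g | t g ≠ 0 ∨ g = f} {g | t g = 0} (by
      ext g
      simp only [Set.mem_union, Set.mem_ofPred_eq, Set.mem_univ, iff_true]
      tauto) (by
      rintro a ⟨ha, ha'⟩ b ⟨hb, hb'⟩
      exact (ha.resolve_left fun h => h ha').trans (hb.resolve_left fun h => h hb').symm) (by
      intro e
      obtain ⟨a, b, hab, he⟩ := S.exists_fs e
      have hta := ht e
      rw [S.sum_fs hab he] at hta
      by_cases hze : z e = 0
      · by_cases hz0 : t a = 0
        · right
          intro g hg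
          rw [hze, hz0, zero_add] at hta
          rcases (he g).1 hg with rfl | rfl
          exacts [hz0, hta.symm]
        · left
          intro g hg
          have hz1 : t b ≠ 0 := fun h => hz0 (by rw [hze, h, add_zero] at hta; exact hta.symm)
          rcases (he g).1 hg with rfl | rfl
          exacts [.inl hz0, .inl hz1]
      · left
        have hfe := (he f).1 (hzf e hze)
        rw [hta] at hze
        intro g hg
        rcases hfe with rfl | rfl <;> rcases (he g).1 hg with rfl | rfl
        · exact .inr rfl
        · exact .inl (by simpa [htf] using hze)
        · exact .inl (by simpa [htf] using hze)
        · exact .inr rfl)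
  rcases hsep with h | h
  · right
    have htg : ∀ g, g ≠ f → t g = 1 := fun g hg => by
      have : g ∈ {g | t g ≠ 0 ∨ g = f} := h ▸ Set.mem_univ g
      exact ZMod.two_ne_zero_iff.1 (this.resolve_right hg)
    funext e
    obtain ⟨a, b, hab, he⟩ := S.exists_fs e
    rw [ht e, S.sum_fs hab he, face]
    by_cases ha : a = f
    · subst ha
      rw [if_pos ((he a).2 (.inl rfl)), htf, htg b hab.symm, zero_add]
    · by_cases hb : b = f
      · subst hb
        rw [if_pos ((he b).2 (.inr rfl)), htf, htg a hab, add_zero]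
      · rw [if_neg, htg a ha, htg b hb]
        · rfl
        · rw [he]
          rintro (rfl | rfl)
          exacts [ha rfl, hb rfl]
  · left
    funext e
    rw [ht e]
    refine Finset.sum_eq_zero fun g _ => ?_
    have : g ∈ {g | t g = 0} := h ▸ Set.mem_univ g
    exact this

theorem Indecomposable.exists_mem_fs [Nontrivial F] (hS : S.Indecomposable) (f : F) :
    ∃ e, f ∈ S.fs e := by
  by_contra! hcon
  obtain ⟨g, hg⟩ := exists_ne f
  rcases hS {f} {f}ᶜ (Set.union_compl_self _) (by simp) fun e => .inr fun g hg hgf =>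
    hcon e (Set.mem_singleton_iff.1 hgf ▸ hg) with h | h
  · exact hg (by simpa using (h ▸ Set.mem_univ g : g ∈ ({f} : Set F)))
  · exact (h ▸ Set.mem_univ f : f ∈ ({f}ᶜ : Set F)) rfl

theorem Indecomposable.face_ne_zero [Nontrivial F] (hS : S.Indecomposable) (f : F) :
    S.face f ≠ 0 := by
  obtain ⟨e, he⟩ := hS.exists_mem_fs f
  exact fun h => by simpa [face, he] using congrFun h e

theorem sum_angle (v : V) (f : F) (z : E → ZMod 2) :
    ∑ e ∈ S.angle v f, z e = ∑ e ∈ S.star v, S.face f e * z e := by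
  simp [angle, star, Finset.sum_filter, face, ite_and]

theorem Indecomposable.card_angle (hS : S.Indecomposable) {v : V} {f : F} {e : E}
    (hv : v ∈ S.vs e) (hf : f ∈ S.fs e) : (S.angle v f).card = 2 := by
  classical
  have hev : Even (S.angle v f).card := by
    rw [← ZMod.natCast_eq_zero_iff_even]
    have := S.sum_angle v f 1
    simp only [Pi.one_apply, Finset.sum_const, nsmul_eq_mul, mul_one] at this
    rw [this]
    exact S.isEven_face f v
  have hpos : 0 < (S.angle v f).card := Finset.card_pos.2 ⟨e, by simp [hv, hf]⟩
  have hne : S.face f ≠ 0 := fun h => by simpa [face, hf] using congrFun h e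
  obtain ⟨c, hc0, hc, hcf, hdeg⟩ := S.exists_circuit (S.face f) hne (S.isEven_face f)
  have hle : (S.angle v f).card ≤ 2 := by
    rcases hS.eq_zero_or_eq_face (z := c) hc (f := f) fun e he => by
      have := hcf e he
      simpa [face] using this with h | h
    · exact (hc0 h).elim
    · refine le_trans (Finset.card_le_card fun e he => ?_) (hdeg v)
      rw [mem_angle] at he
      simp [h, face, he]
  obtain ⟨k, hk⟩ := hev
  omega

open scoped Classical in
theorem Indecomposable.exists_angle (hS : S.Indecomposable) {v : V} {f : F} {e : E}
    (hv : v ∈ S.vs e) (hf : f ∈ S.fs e) : ∃ e', e' ≠ e ∧ S.angle v f = {e, e'} := by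
  obtain ⟨a, b, hab, h⟩ := Finset.card_eq_two.1 (hS.card_angle hv hf)
  have he : e ∈ S.angle v f := by simp [hv, hf]
  rw [h] at he ⊢
  simp only [Finset.mem_insert, Finset.mem_singleton] at he
  rcases he with rfl | rfl
  · exact ⟨b, hab.symm, rfl⟩
  · exact ⟨a, hab, Finset.pair_comm _ _⟩

/-- In an indecomposable system, no proper set of edges splits every even set evenly. -/
theorem Indecomposable.eq_zero_or_eq_one [Nontrivial F] (hS : S.Indecomposable) {a : E → ZMod 2}
    (ha : ∀ z, S.IsEven z → S.IsEven (a * z)) : a = 0 ∨ a = 1 := by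
  have hf : ∀ f, a * S.face f = 0 ∨ a * S.face f = S.face f := fun f =>
    hS.eq_zero_or_eq_face (ha _ (S.isEven_face f)) fun e he => by
      by_contra h
      exact he (by simp [face, h])
  have h0 : ∀ f e, a * S.face f = 0 → f ∈ S.fs e → a e = 0 := fun f e h he => by
    simpa [face, he] using congrFun h e
  have h1 : ∀ f e, a * S.face f = S.face f → f ∈ S.fs e → a e = 1 := fun f e h he => by
    simpa [face, he] using congrFun h e
  rcases hS {f | a * S.face f = 0} {f | a * S.face f = S.face f} (by
      ext f
      simpa using hf f) (by
      rintro f ⟨h, h'⟩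
      exact (hS.face_ne_zero f (h'.symm.trans h)).elim) (by
      intro e
      by_cases hae : a e = 0
      · left
        intro f hfe
        refine (hf f).resolve_right fun h => ?_
        rw [h1 f e h hfe] at hae
        exact one_ne_zero hae
      · right
        intro f hfe
        exact (hf f).resolve_left fun h => hae (h0 f e h hfe)) with h | h
  · left
    funext e
    obtain ⟨f, g, -, he⟩ := S.exists_fs e
    exact h0 f e (h ▸ Set.mem_univ f : f ∈ {f | a * S.face f = 0}) ((he f).2 (.inl rfl))
  · right
    funext e
    obtain ⟨f, g, -, he⟩ := S.exists_fs e
    exact h1 f e (h ▸ Set.mem_univ f : f ∈ {f | a * S.face f = S.face f}) ((he f).2 (.inl rfl))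

end DualSystem

namespace DualSystem

variable {V E F : Type} [Fintype E] {S : DualSystem V E F}

/-- In an indecomposable system, the edges at a vertex are connected through common faces. -/
theorem Indecomposable.star_subset [Fintype F] [Nontrivial F] (hS : S.Indecomposable) {v : V}
    {C : Set E} (hC : ∃ e ∈ C, v ∈ S.vs e)
    (hcl : ∀ e ∈ C, v ∈ S.vs e → ∀ e', v ∈ S.vs e' → ∀ f ∈ S.fs e, f ∈ S.fs e' → e' ∈ C) :
    ∀ e, v ∈ S.vs e → e ∈ C := by
  classical
  by_contra! hcon
  obtain ⟨e₀, he₀, he₀C⟩ := hcon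
  obtain ⟨e₁, he₁C, he₁⟩ := hC
  let d : E → ZMod 2 := fun e => if v ∈ S.vs e ∧ e ∈ C then 1 else 0
  have hd : ∀ f, ∑ e ∈ S.boundary f, d e = 0 := fun f => by
    have h1 : ∑ e ∈ S.boundary f, d e = ∑ e ∈ S.angle v f, if e ∈ C then 1 else 0 := by
      simp only [d, boundary, angle, Finset.sum_filter, ite_and]
      exact Finset.sum_congr rfl fun e _ => by split_ifs <;> rfl
    rw [h1]
    by_cases hex : ∃ e ∈ S.angle v f, e ∈ C
    · obtain ⟨e, he, heC⟩ := hex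
      rw [mem_angle] at he
      rw [Finset.sum_congr rfl fun e' he' => if_pos (hcl e heC he.1 e' (mem_angle.1 he').1 f he.2
        (mem_angle.1 he').2), Finset.sum_const, hS.card_angle he.1 he.2]
      rfl
    · push Not at hex
      exact Finset.sum_eq_zero fun e he => if_neg (hex e he)
  obtain ⟨x, hxv, hx⟩ : ∃ x : V → ZMod 2, x v = 0 ∧ ∀ e, d e = ∑ w ∈ S.vs e, x w := by
    obtain ⟨x, hx⟩ := S.exists_vertex_coboundary hd
    refine ⟨fun w => x w + x v, ZMod.two_add_self _, fun e => ?_⟩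
    rw [hx, Finset.sum_add_distrib, Finset.sum_const, S.card_vs]
    simp [show (2 : ZMod 2) = 0 from rfl]
  let a : E → ZMod 2 := fun e => if ∃ u ∈ S.vs e, x u ≠ 0 then 1 else 0
  have hav : ∀ e, v ∈ S.vs e → a e = d e := fun e he => by
    obtain ⟨p, q, hpq, h⟩ := S.exists_vs e
    have h2 := hx e
    rw [S.sum_vs hpq h] at h2
    rw [h2]
    have key : ∀ s t : ZMod 2, (s = 0 ∨ t = 0) → (if s ≠ 0 ∨ t ≠ 0 then 1 else 0) = s + t := by
      decide
    rw [← key]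
    · simp only [a, h]
      simp
    · rcases (h v).1 he with rfl | rfl
      exacts [.inl hxv, .inr hxv]
  have ha : ∀ z, S.IsEven z → S.IsEven (a * z) := fun z hz w => by
    simp only [Pi.mul_apply]
    by_cases hw : x w = 0
    · by_cases hwv : w = v
      · subst hwv
        rw [Finset.sum_congr rfl fun e he => by rw [hav e (mem_star.1 he)]]
        rw [← S.sum_mul_eq_zero hd hz]
        refine Finset.sum_subset (Finset.subset_univ _) fun e _ he => ?_
        rw [mem_star] at he
        simp [d, he]
      · refine Finset.sum_eq_zero fun e he => ?_
        rw [mem_star] at he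
        rw [show a e = 0 from ?_, zero_mul]
        refine if_neg ?_
        rintro ⟨u, hu, hxu⟩
        have huw : u ≠ w := fun h => hxu (h ▸ hw)
        obtain ⟨p, q, hpq, h⟩ := S.exists_vs e
        have h2 := hx e
        have hset : ∀ t, t ∈ S.vs e ↔ t = u ∨ t = w := fun t => by
          rw [h] at hu he ⊢
          grind
        rw [S.sum_vs huw hset, hw, add_zero] at h2
        have hve : v ∈ S.vs e := by
          by_contra hve
          exact hxu (h2 ▸ if_neg fun h => hve h.1)
        rcases (hset v).1 hve with rfl | rfl
        exacts [hxu hxv, hwv rfl]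
    · rw [← hz w]
      refine Finset.sum_congr rfl fun e he => ?_
      rw [show a e = 1 from if_pos ⟨w, mem_star.1 he, hw⟩, one_mul]
  rcases hS.eq_zero_or_eq_one ha with h | h
  · have := congrFun h e₁
    rw [hav e₁ he₁] at this
    simp [d, he₁, he₁C] at this
  · have := congrFun h e₀
    rw [hav e₀ he₀] at this
    simp [d, he₀C] at this

variable (S) in
/-- Two edges are adjacent in the medial graph when they share a vertex and a face. -/
def Med (e e' : E) : Prop := ∃ v f, v ∈ S.vs e ∧ v ∈ S.vs e' ∧ f ∈ S.fs e ∧ f ∈ S.fs e'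

theorem Med.symm {e e' : E} (h : S.Med e e') : S.Med e' e := by
  obtain ⟨v, f, h⟩ := h
  exact ⟨v, f, h.2.1, h.1, h.2.2.2, h.2.2.1⟩

variable (S) in
/-- A set of edges inducing a connected subgraph of the medial graph. -/
def MedConn (A : Set E) : Prop := ∀ C : Set E, (A ∩ C).Nonempty →
  (∀ e ∈ A, e ∈ C → ∀ e' ∈ A, S.Med e e' → e' ∈ C) → A ⊆ C

theorem MedConn.union {A B : Set E} (hA : S.MedConn A) (hB : S.MedConn B) {a b : E} (ha : a ∈ A)
    (hb : b ∈ B) (hab : S.Med a b) : S.MedConn (A ∪ B) := by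
  intro C hC hcl
  have hA' : (A ∩ C).Nonempty → A ⊆ C := fun h =>
    hA C h fun e he hec e' he' => hcl e (.inl he) hec e' (.inl he')
  have hB' : (B ∩ C).Nonempty → B ⊆ C := fun h =>
    hB C h fun e he hec e' he' => hcl e (.inr he) hec e' (.inr he')
  have h1 : A ⊆ C → B ⊆ C := fun h =>
    hB' ⟨b, hb, hcl a (.inl ha) (h ha) b (.inr hb) hab⟩
  have h2 : B ⊆ C → A ⊆ C := fun h =>
    hA' ⟨a, ha, hcl b (.inr hb) (h hb) a (.inl ha) hab.symm⟩
  obtain ⟨x, hx | hx, hxC⟩ := hC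
  · have := hA' ⟨x, hx, hxC⟩
    exact Set.union_subset this (h1 this)
  · have := hB' ⟨x, hx, hxC⟩
    exact Set.union_subset (h2 this) this

theorem MedConn.singleton (e : E) : S.MedConn {e} := by
  rintro C ⟨x, rfl, hx⟩ -
  simpa using hx

/-- Edges reachable by a symmetric relation contained in medial adjacency are connected. -/
theorem medConn_reflTransGen {r : E → E → Prop} (hr : ∀ a b, r a b → r b a)
    (hm : ∀ a b, r a b → S.Med a b)
    (e : E) : S.MedConn {x | Relation.ReflTransGen r e x} := by
  rintro C ⟨x, hx, hxC⟩ hcl y hy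
  have : Std.Symm r := ⟨hr⟩
  have hxy : Relation.ReflTransGen r x y := (Std.Symm.symm _ _ hx).trans hy
  clear hy
  induction hxy with
  | refl => exact hxC
  | tail h1 h2 ih => exact hcl _ (hx.trans h1) ih _ (hx.trans (h1.tail h2)) (hm _ _ h2)

/-- Removing a component of the complement of a connected part keeps a set connected. -/
theorem MedConn.diff {A B Y : Set E} (hA : S.MedConn A) (hB : S.MedConn B) (hBA : B ⊆ A)
    (hBne : B.Nonempty) (hY : Y ⊆ A \ B) (hYcl : ∀ e ∈ Y, ∀ e' ∈ A \ B, S.Med e e' → e' ∈ Y) :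
    S.MedConn (A \ Y) := by
  have key : ∀ C : Set E, (A \ Y ∩ C).Nonempty →
      (∀ e ∈ A \ Y, e ∈ C → ∀ e' ∈ A \ Y, S.Med e e' → e' ∈ C) → (B ∩ C).Nonempty := by
    rintro C ⟨x, hx, hxC⟩ hcl
    by_contra hcon
    rw [Set.not_nonempty_iff_eq_empty] at hcon
    have hBC : ∀ e ∈ B, e ∉ C := fun e he heC => (hcon ▸ ⟨he, heC⟩ : e ∈ (∅ : Set E))
    have := hA (A \ Y ∩ C) ⟨x, hx.1, hx, hxC⟩ fun e _ hec e' he' hm => by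
      have : e' ∉ Y := fun h => hec.1.2 (hYcl e' h e ⟨hec.1.1, fun h => hBC e h hec.2⟩ hm.symm)
      exact ⟨⟨he', this⟩, hcl e hec.1 hec.2 e' ⟨he', this⟩ hm⟩
    obtain ⟨b, hb⟩ := hBne
    exact hBC b hb (this (hBA hb)).2
  have hBX : B ⊆ A \ Y := fun b hb => ⟨hBA hb, fun h => (hY h).2 hb⟩
  intro C hC hcl
  have hBC : B ⊆ C := hB C (key C hC hcl) fun e he hec e' he' => hcl e (hBX he) hec e' (hBX he')
  by_contra hcon
  obtain ⟨y, hy, hyC⟩ := Set.not_subset.1 hcon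
  obtain ⟨b, hb, hbC⟩ := key Cᶜ ⟨y, hy, hyC⟩ fun e he heC e' he' hm he'C =>
    heC (hcl e' he' he'C e he hm.symm)
  exact hbC (hBC hb)

theorem Indecomposable.eq_univ_of_med_closed [Fintype F] [Nontrivial F] (hS : S.Indecomposable)
    {C : Set E} (hne : C.Nonempty) (hcl : ∀ e ∈ C, ∀ e', S.Med e e' → e' ∈ C) : C = Set.univ := by
  classical
  let a : E → ZMod 2 := fun e => if e ∈ C then 1 else 0
  have ha : ∀ z, S.IsEven z → S.IsEven (a * z) := fun z hz v => by
    by_cases hv : ∃ e ∈ C, v ∈ S.vs e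
    · have := hS.star_subset hv fun e he hev e' hev' f hf hf' =>
        hcl e he e' ⟨v, f, hev, hev', hf, hf'⟩
      rw [← hz v]
      refine Finset.sum_congr rfl fun e he => ?_
      simp [a, this e (mem_star.1 he)]
    · push Not at hv
      refine Finset.sum_eq_zero fun e he => ?_
      have : e ∉ C := fun h => hv e h (mem_star.1 he)
      simp [a, this]
  rcases hS.eq_zero_or_eq_one ha with h | h
  · obtain ⟨e, he⟩ := hne
    simpa [a, he] using congrFun h e
  · ext e
    simpa [a] using congrFun h e

theorem sum_sum_angle_face [Fintype F] (v : V) (c : E → ZMod 2) :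
    ∑ f, ∑ e ∈ S.angle v f, c e = 0 := by
  classical
  rw [Finset.sum_comm' (t' := S.star v) (s' := S.fs) (by simp [and_comm])]
  refine Finset.sum_eq_zero fun e _ => ?_
  rw [Finset.sum_const, S.card_fs]
  simp [show (2 : ZMod 2) = 0 from rfl]

theorem sum_sum_angle_vertex [Fintype V] (f : F) (c : E → ZMod 2) :
    ∑ v, ∑ e ∈ S.angle v f, c e = 0 := by
  classical
  rw [Finset.sum_comm' (t' := S.boundary f) (s' := S.vs) (by simp)]
  refine Finset.sum_eq_zero fun e _ => ?_
  rw [Finset.sum_const, S.card_vs]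
  simp [show (2 : ZMod 2) = 0 from rfl]

theorem Indecomposable.medConn_compl_singleton [Fintype V] [Fintype F] [Nontrivial F]
    (hS : S.Indecomposable) (e₀ : E) : S.MedConn {e₀}ᶜ := by
  classical
  intro C hC hcl
  by_contra hcon
  obtain ⟨y, hy, hyC⟩ := Set.not_subset.1 hcon
  obtain ⟨x, hx, hxC⟩ := hC
  simp only [Set.mem_compl_iff, Set.mem_singleton_iff] at hcl hx hy
  let c : E → ZMod 2 := fun e => if e ∈ C ∧ e ≠ e₀ then 1 else 0
  have hoff : ∀ v f, ¬ (v ∈ S.vs e₀ ∧ f ∈ S.fs e₀) → ∑ e ∈ S.angle v f, c e = 0 := fun v f h => by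
    have hne : ∀ e ∈ S.angle v f, e ≠ e₀ := fun e he => by
      rintro rfl
      exact h (mem_angle.1 he)
    by_cases hex : ∃ e ∈ S.angle v f, e ∈ C
    · obtain ⟨e, he, heC⟩ := hex
      have : ∀ e' ∈ S.angle v f, c e' = 1 := fun e' he' =>
        if_pos ⟨hcl e (hne e he) heC e' (hne e' he') ⟨v, f, (mem_angle.1 he).1, (mem_angle.1 he').1,
          (mem_angle.1 he).2, (mem_angle.1 he').2⟩, hne e' he'⟩
      rw [Finset.sum_congr rfl this, Finset.sum_const,
        hS.card_angle (mem_angle.1 he).1 (mem_angle.1 he).2]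
      rfl
    · push Not at hex
      exact Finset.sum_eq_zero fun e he => if_neg fun h => hex e he h.1
  obtain ⟨v₁, v₂, hv, hvs⟩ := S.exists_vs e₀
  obtain ⟨f₁, f₂, hf, hfs⟩ := S.exists_fs e₀
  have hface : ∀ v, ∑ e ∈ S.angle v f₁, c e = ∑ e ∈ S.angle v f₂, c e := fun v => by
    have h := S.sum_sum_angle_face v c
    rw [Fintype.sum_eq_add f₁ f₂ hf fun f hf' => hoff v f fun h => by
      rcases (hfs f).1 h.2 with h | h
      exacts [hf'.1 h, hf'.2 h]] at h
    generalize ∑ e ∈ S.angle v f₁, c e = a at h ⊢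
    generalize ∑ e ∈ S.angle v f₂, c e = b at h ⊢
    revert a b
    decide
  have hvert : ∀ f, ∑ e ∈ S.angle v₁ f, c e = ∑ e ∈ S.angle v₂ f, c e := fun f => by
    have h := S.sum_sum_angle_vertex f c
    rw [Fintype.sum_eq_add v₁ v₂ hv fun v hv' => hoff v f fun h => by
      rcases (hvs v).1 h.1 with h | h
      exacts [hv'.1 h, hv'.2 h]] at h
    generalize ∑ e ∈ S.angle v₁ f, c e = a at h ⊢
    generalize ∑ e ∈ S.angle v₂ f, c e = b at h ⊢
    revert a b
    decide
  have hall : ∀ v ∈ S.vs e₀, ∀ f ∈ S.fs e₀,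
      ∑ e ∈ S.angle v f, c e = ∑ e ∈ S.angle v₁ f₁, c e := fun v hv f hf => by
    rcases (hvs v).1 hv with rfl | rfl <;> rcases (hfs f).1 hf with rfl | rfl
    · rfl
    · exact (hface _).symm
    · exact (hvert _).symm
    · rw [← hface, ← hvert]
  have hpart : ∀ e ≠ e₀, S.Med e e₀ → c e = ∑ e ∈ S.angle v₁ f₁, c e := by
    rintro e he ⟨v, f, hve, hve₀, hfe, hfe₀⟩
    rw [← hall v hve₀ f hfe₀]
    obtain ⟨e', he', hang⟩ := hS.exists_angle hve₀ hfe₀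
    have : e ∈ S.angle v f := mem_angle.2 ⟨hve, hfe⟩
    rw [hang] at this ⊢
    simp only [Finset.mem_insert, Finset.mem_singleton, he, false_or] at this
    rw [Finset.sum_pair he'.symm, this]
    simp [c]
  by_cases h0 : ∑ e ∈ S.angle v₁ f₁, c e = 0
  · have hne : C \ {e₀} = Set.univ := hS.eq_univ_of_med_closed ⟨x, hxC, hx⟩ fun e he e' hm => by
      by_cases he' : e' = e₀
      · subst he'
        have := hpart e he.2 hm
        simp only [h0, c, if_pos (show e ∈ C ∧ e ≠ e' from he)] at this
        exact (one_ne_zero this).elim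
      · exact ⟨hcl e he.2 he.1 e' he' hm, he'⟩
    exact (hne ▸ Set.mem_univ e₀ : e₀ ∈ C \ {e₀}).2 rfl
  · have hne : Cᶜ \ {e₀} = Set.univ := hS.eq_univ_of_med_closed ⟨y, hyC, hy⟩ fun e he e' hm => by
      by_cases he' : e' = e₀
      · subst he'
        have := hpart e he.2 hm
        rw [← this] at h0
        exact (h0 (if_neg fun h => he.1 h.1)).elim
      · exact ⟨fun h => he.1 (hcl e' he' h e he.2 hm.symm), he'⟩
    exact (hne ▸ Set.mem_univ e₀ : e₀ ∈ Cᶜ \ {e₀}).2 rfl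

end DualSystem

namespace DualSystem

variable {V E F : Type} [Fintype E] {S : DualSystem V E F}

theorem Indecomposable.sum_angle_const (hS : S.Indecomposable) (v : V) (f : F) (a : ZMod 2) :
    ∑ _e ∈ S.angle v f, a = 0 := by
  rcases (S.angle v f).eq_empty_or_nonempty with h | ⟨e, he⟩
  · rw [h, Finset.sum_empty]
  · rw [Finset.sum_const, hS.card_angle (mem_angle.1 he).1 (mem_angle.1 he).2, two_nsmul,
      ZMod.two_add_self]

/-- Exactness at the angles: a set of angles which is even at all vertices and faces is the
boundary of a set of edges. -/
theorem Indecomposable.exists_sum_angle [Fintype V] [Fintype F] (hS : S.Indecomposable)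
    {Z : V → F → ZMod 2} (hoff : ∀ v f, S.angle v f = ∅ → Z v f = 0)
    (hv : ∀ v, ∑ f, Z v f = 0) (hf : ∀ f, ∑ v, Z v f = 0) :
    ∃ x : E → ZMod 2, ∀ v f, Z v f = ∑ e ∈ S.angle v f, x e := by
  classical
  suffices h : ∃ x : E → ZMod 2, ∀ p : V × F, Z p.1 p.2 = ∑ e ∈ S.angle p.1 p.2, x e by
    obtain ⟨x, hx⟩ := h
    exact ⟨x, fun v f => hx (v, f)⟩
  refine exists_coboundary_of_orthogonal (fun p : V × F => S.angle p.1 p.2) _ fun y hy => ?_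
  have hy' : ∀ e, ∑ f ∈ S.fs e, ∑ v ∈ S.vs e, y (v, f) = 0 := fun e => by
    rw [← hy e, Finset.sum_comm, ← Finset.sum_product']
    refine Finset.sum_congr ?_ fun _ _ => rfl
    ext p
    simp
  obtain ⟨d, hd⟩ : ∃ d : E → ZMod 2, ∀ e, ∀ f ∈ S.fs e, d e = ∑ v ∈ S.vs e, y (v, f) := by
    choose f g hfg hfs using S.exists_fs
    refine ⟨fun e => ∑ v ∈ S.vs e, y (v, f e), fun e h he => ?_⟩
    rcases (hfs e h).1 he with rfl | rfl
    · rfl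
    · have := hy' e
      rw [S.sum_fs (hfg e) (hfs e)] at this
      exact (eq_neg_of_add_eq_zero_left this).trans (by
        rw [eq_comm, ← sub_eq_zero, sub_neg_eq_add, ZMod.two_add_self])
  obtain ⟨x, hx⟩ := S.exists_vertex_coboundary (d := d) fun f => by
    rw [Finset.sum_congr rfl fun e he => hd e f (mem_boundary.1 he),
      Finset.sum_comm' (t' := Finset.univ) (s' := fun v => S.angle v f) (by simp [and_comm])]
    exact Finset.sum_eq_zero fun v _ => hS.sum_angle_const v f _
  have hconst : ∀ f, ∃ c : ZMod 2, ∀ v, (S.angle v f).Nonempty → y (v, f) = x v + c := fun f => by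
    let w : V → ZMod 2 := fun v => y (v, f) + x v
    have hw : ∀ e, f ∈ S.fs e → ∀ u ∈ S.vs e, ∀ v ∈ S.vs e, w u = w v := fun e he => by
      obtain ⟨p, q, hpq, h⟩ := S.exists_vs e
      have h0 : ∑ v ∈ S.vs e, w v = 0 := by
        rw [Finset.sum_add_distrib, ← hd e f he, ← hx e, ZMod.two_add_self]
      rw [S.sum_vs hpq h] at h0
      have h1 : w p = w q := (eq_neg_of_add_eq_zero_left h0).trans (by
        rw [eq_comm, ← sub_eq_zero, sub_neg_eq_add, ZMod.two_add_self])
      intro u hu v hv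
      rcases (h u).1 hu with rfl | rfl <;> rcases (h v).1 hv with rfl | rfl <;> simp [h1]
    choose p q hpq hvs using S.exists_vs
    let z : E → ZMod 2 := fun e => if f ∈ S.fs e then w (p e) else 0
    have hz : S.IsEven z := fun v => by
      have : ∑ e ∈ S.star v, z e = ∑ e ∈ S.angle v f, w v := by
        simp only [star, angle, Finset.sum_filter, z]
        refine Finset.sum_congr rfl fun e _ => ?_
        by_cases hv : v ∈ S.vs e <;> by_cases hf : f ∈ S.fs e <;> simp only [hv, hf, if_true,
          if_false, and_self, and_true, and_false]
        exact hw e hf _ ((hvs e _).2 (.inl rfl)) _ hv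
      rw [this, hS.sum_angle_const]
    have hzw : ∀ e v, v ∈ S.vs e → f ∈ S.fs e → w v = z e := fun e v hv hf => by
      rw [show z e = w (p e) from if_pos hf]
      exact hw e hf _ hv _ ((hvs e _).2 (.inl rfl))
    have hcc : ∃ c : ZMod 2, ∀ e, f ∈ S.fs e → z e = c := by
      rcases hS.eq_zero_or_eq_face hz (f := f) fun e he => by
        by_contra h
        exact he (if_neg h) with h | h
      · exact ⟨0, fun e _ => congrFun h e⟩
      · exact ⟨1, fun e he => (congrFun h e).trans (if_pos he)⟩
    obtain ⟨c, hc⟩ := hcc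
    refine ⟨c, fun v hv => ?_⟩
    obtain ⟨e, he⟩ := hv
    rw [mem_angle] at he
    rw [← hc e he.2, ← hzw e v he.1 he.2]
    simp only [w]
    rw [add_comm (y _), ← add_assoc, ZMod.two_add_self, zero_add]
  choose c hc using hconst
  have h1 : ∀ p : V × F, Z p.1 p.2 * y p = Z p.1 p.2 * x p.1 + Z p.1 p.2 * c p.2 := fun p => by
    rcases (S.angle p.1 p.2).eq_empty_or_nonempty with h | h
    · simp [hoff _ _ h]
    · rw [← mul_add, ← hc _ _ h]
  simp_rw [h1, Finset.sum_add_distrib, Fintype.sum_prod_type]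
  rw [Finset.sum_comm (f := fun v f => Z v f * c f)]
  simp [← Finset.sum_mul, hv, hf]

variable (S)

open scoped Classical in
/-- The vertices meeting at least two classes of edges. -/
noncomputable def frontierVertices [Fintype V] {α : Type} (p : E → α) : Finset V :=
  Finset.univ.filter fun v => ∃ e e', v ∈ S.vs e ∧ v ∈ S.vs e' ∧ p e ≠ p e'

open scoped Classical in
/-- The faces meeting at least two classes of edges. -/
noncomputable def frontierFaces [Fintype F] {α : Type} (p : E → α) : Finset F :=
  Finset.univ.filter fun f => ∃ e e', f ∈ S.fs e ∧ f ∈ S.fs e' ∧ p e ≠ p e'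

open scoped Classical in
/-- The angles separating two classes of edges. -/
noncomputable def frontierAngles [Fintype V] [Fintype F] {α : Type} (p : E → α) : Finset (V × F) :=
  Finset.univ.filter fun a => ∃ e ∈ S.angle a.1 a.2, ∃ e' ∈ S.angle a.1 a.2, p e ≠ p e'

variable {S}

@[simp] theorem mem_frontierVertices [Fintype V] {α : Type} {p : E → α} {v : V} :
    v ∈ S.frontierVertices p ↔ ∃ e e', v ∈ S.vs e ∧ v ∈ S.vs e' ∧ p e ≠ p e' := by
  simp [frontierVertices]

@[simp] theorem mem_frontierFaces [Fintype F] {α : Type} {p : E → α} {f : F} :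
    f ∈ S.frontierFaces p ↔ ∃ e e', f ∈ S.fs e ∧ f ∈ S.fs e' ∧ p e ≠ p e' := by
  simp [frontierFaces]

theorem mem_frontierAngles [Fintype V] [Fintype F] {α : Type} {p : E → α} {v : V} {f : F} :
    (v, f) ∈ S.frontierAngles p ↔ ∃ e ∈ S.angle v f, ∃ e' ∈ S.angle v f, p e ≠ p e' := by
  simp [frontierAngles]

theorem Indecomposable.two_mul_card_frontierFaces_le [Fintype V] [Fintype F] {α : Type}
    (hS : S.Indecomposable) (p : E → α) :
    2 * (S.frontierFaces p).card ≤ (S.frontierAngles p).card := by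
  classical
  rw [mul_comm, ← smul_eq_mul]
  refine le_trans (Finset.card_nsmul_le_sum (S.frontierFaces p)
    (fun f => ((S.frontierAngles p).filter fun a => a.2 = f).card) 2 fun f hf => ?_) ?_
  · obtain ⟨e₀, e₁, he₀, he₁, hne⟩ := mem_frontierFaces.1 hf
    let c : α → E → ZMod 2 := fun i e => if p e = i then 1 else 0
    have hoff : ∀ v, (v, f) ∉ S.frontierAngles p → ∀ i, ∑ e ∈ S.angle v f, c i e = 0 :=
        fun v hv i => by
      have hv' : ∀ e ∈ S.angle v f, ∀ e' ∈ S.angle v f, p e = p e' := fun e he e' he' => by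
        by_contra h
        exact hv (mem_frontierAngles.2 ⟨e, he, e', he', h⟩)
      rcases (S.angle v f).eq_empty_or_nonempty with h | ⟨e, he⟩
      · rw [h, Finset.sum_empty]
      · rw [← hS.sum_angle_const v f (c i e)]
        exact Finset.sum_congr rfl fun e' he' => by simp only [c, hv' e he e' he']
    have hpos : ((S.frontierAngles p).filter fun a => a.2 = f).card ≠ 0 := fun h0 => by
      have hnot : ∀ v, (v, f) ∉ S.frontierAngles p := fun v hv => by
        rw [Finset.card_eq_zero] at h0
        exact Finset.notMem_empty (v, f) (h0 ▸ Finset.mem_filter.2 ⟨hv, rfl⟩)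
      rcases hS.eq_zero_or_eq_face (z := S.face f * c (p e₀)) (f := f) (fun v => by
        simp only [Pi.mul_apply]
        rw [← S.sum_angle, hoff v (hnot v)]) (fun e he => by
          by_contra h
          exact he (by simp [face, h])) with h | h
      · simpa [face, he₀, c] using congrFun h e₀
      · have := congrFun h e₁
        simp only [face, he₁, c, Pi.mul_apply, if_neg hne.symm] at this
        simp at this
    have hne1 : ((S.frontierAngles p).filter fun a => a.2 = f).card ≠ 1 := fun h1 => by
      obtain ⟨⟨v, g⟩, ha⟩ := Finset.card_eq_one.1 h1
      have hmem : (v, g) ∈ (S.frontierAngles p).filter fun a => a.2 = f := by simp [ha]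
      obtain ⟨hvf, rfl : g = f⟩ := Finset.mem_filter.1 hmem
      obtain ⟨e, he, e', he', hpe⟩ := mem_frontierAngles.1 hvf
      have h := S.sum_sum_angle_vertex g (c (p e))
      rw [Fintype.sum_eq_single v fun u hu => hoff u (fun hu' => hu (by
        have : (u, g) ∈ (S.frontierAngles p).filter fun a => a.2 = g :=
          Finset.mem_filter.2 ⟨hu', rfl⟩
        rw [ha] at this
        simpa using this)) _] at h
      obtain ⟨e'', hee, hang⟩ := hS.exists_angle (mem_angle.1 he).1 (mem_angle.1 he).2
      have h'' : e' = e'' := by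
        rw [hang] at he'
        simp only [Finset.mem_insert, Finset.mem_singleton] at he'
        exact he'.resolve_left fun h => hpe (h ▸ rfl)
      subst h''
      rw [hang, Finset.sum_pair hee.symm] at h
      simp [c, hpe.symm] at h
    omega
  · rw [← Finset.card_eq_sum_card_fiberwise (s := (S.frontierAngles p)) (f := Prod.snd)]
    intro a ha
    obtain ⟨e, he, e', he', hne⟩ := mem_frontierAngles.1 ha
    exact mem_frontierFaces.2 ⟨e, e', (mem_angle.1 he).2, (mem_angle.1 he').2, hne⟩

theorem Indecomposable.card_frontierAngles_le [Fintype V] [Fintype F] (hS : S.Indecomposable)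
    (p : E → Fin 3) (hp : ∀ i, S.MedConn (p ⁻¹' {i})) (hne : (S.frontierVertices p).Nonempty) :
    (S.frontierAngles p).card ≤ (S.frontierVertices p).card + (S.frontierFaces p).card + 1 := by
  classical
  obtain ⟨v₀, hv₀⟩ := hne
  let ι : Type := {a // a ∈ (S.frontierAngles p)ᶜ} ⊕ {v // v ∈ (S.frontierVertices p).erase v₀} ⊕
    {f // f ∈ S.frontierFaces p}
  let M : (V × F → ZMod 2) →ₗ[ZMod 2] (ι → ZMod 2) := LinearMap.pi <|
    Sum.elim (fun a => LinearMap.proj a.1) <|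
      Sum.elim (fun v => ∑ f, LinearMap.proj (v.1, f)) fun f => ∑ v, LinearMap.proj (v, f.1)
  let D : Fin 3 → V × F → ZMod 2 := fun i a => ∑ e ∈ S.angle a.1 a.2, if p e = i then 1 else 0
  have hker : M.ker ≤ Submodule.span (ZMod 2) {D 1, D 2} := by
    intro Z hZ
    have hM : ∀ i, M Z i = 0 := fun i => congrFun (LinearMap.mem_ker.1 hZ) i
    have hoff : ∀ a, a ∉ S.frontierAngles p → Z a = 0 := fun a ha => by
      simpa [M] using hM (.inl ⟨a, Finset.mem_compl.2 ha⟩)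
    have hf : ∀ f, ∑ v, Z (v, f) = 0 := fun f => by
      by_cases hf : f ∈ S.frontierFaces p
      · simpa [M] using hM (.inr (.inr ⟨f, hf⟩))
      · refine Finset.sum_eq_zero fun v _ => hoff _ fun ha => hf ?_
        obtain ⟨e, he, e', he', hne⟩ := mem_frontierAngles.1 ha
        exact mem_frontierFaces.2 ⟨e, e', (mem_angle.1 he).2, (mem_angle.1 he').2, hne⟩
    have hv' : ∀ v ≠ v₀, ∑ f, Z (v, f) = 0 := fun v hvv => by
      by_cases hv : v ∈ S.frontierVertices p
      · simpa [M] using hM (.inr (.inl ⟨v, Finset.mem_erase.2 ⟨hvv, hv⟩⟩))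
      · refine Finset.sum_eq_zero fun f _ => hoff _ fun ha => hv ?_
        obtain ⟨e, he, e', he', hne⟩ := mem_frontierAngles.1 ha
        exact mem_frontierVertices.2 ⟨e, e', (mem_angle.1 he).1, (mem_angle.1 he').1, hne⟩
    have hv : ∀ v, ∑ f, Z (v, f) = 0 := fun v => by
      by_cases h : v = v₀
      · subst h
        rw [← Fintype.sum_eq_single (f := fun v => ∑ f, Z (v, f)) v hv', Finset.sum_comm]
        exact Finset.sum_eq_zero fun f _ => hf f
      · exact hv' v h
    obtain ⟨x, hx⟩ := hS.exists_sum_angle (Z := fun v f => Z (v, f))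
      (fun v f h => hoff _ fun ha => by
      obtain ⟨e, he, -⟩ := mem_frontierAngles.1 ha
      rw [h] at he
      simp at he) hv hf
    have hconst : ∀ i, ∃ g : ZMod 2, ∀ e, p e = i → x e = g := fun i => by
      by_cases hi : ∃ e, p e = i
      · obtain ⟨e, he⟩ := hi
        refine ⟨x e, hp i {e' | x e' = x e} ⟨e, he, rfl⟩ ?_⟩
        rintro a ha hxa b hb ⟨v, f, hva, hvb, hfa, hfb⟩
        by_cases hab : b = a
        · rw [hab]
          exact hxa
        obtain ⟨c, hc, hang⟩ := hS.exists_angle hva hfa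
        have hbm : b ∈ S.angle v f := mem_angle.2 ⟨hvb, hfb⟩
        rw [hang] at hbm
        simp only [Finset.mem_insert, Finset.mem_singleton, hab, false_or] at hbm
        subst hbm
        have h0 := hx v f
        simp only [hang] at h0
        rw [Finset.sum_pair hc.symm, hoff (v, f) fun h => by
          obtain ⟨s, hs, t, ht, hst⟩ := mem_frontierAngles.1 h
          simp only [hang, Finset.mem_insert, Finset.mem_singleton] at hs ht
          simp only [Set.mem_preimage, Set.mem_singleton_iff] at ha hb
          rcases hs with rfl | rfl <;> rcases ht with rfl | rfl <;> simp [ha, hb] at hst] at h0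
        simp only [Set.mem_ofPred_eq] at hxa ⊢
        rw [← hxa]
        generalize x a = s at h0 ⊢
        generalize x b = t at h0 ⊢
        revert s t
        decide
      · push Not at hi
        exact ⟨0, fun e he => (hi e he).elim⟩
    choose g hg using hconst
    refine Submodule.mem_span_pair.2 ⟨g 1 + g 0, g 2 + g 0, ?_⟩
    funext a
    simp only [Pi.add_apply, Pi.smul_apply, smul_eq_mul, D, Finset.mul_sum]
    have hZa : Z a = ∑ e ∈ S.angle a.1 a.2, (x e + g 0) := by
      rw [Finset.sum_add_distrib, hS.sum_angle_const, add_zero, ← hx]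
    rw [hZa, ← Finset.sum_add_distrib]
    refine Finset.sum_congr rfl fun e _ => ?_
    rw [hg _ e rfl]
    generalize p e = i
    fin_cases i <;> simp [ZMod.two_add_self]
  have h1 := LinearMap.finrank_range_add_finrank_ker M
  have h2 : Module.finrank (ZMod 2) M.range ≤ Module.finrank (ZMod 2) (ι → ZMod 2) :=
    Submodule.finrank_le _
  have h3 : Module.finrank (ZMod 2) M.ker ≤ 2 :=
    (Submodule.finrank_mono hker).trans ((finrank_span_le_card _).trans (by
      rw [Set.toFinset_insert, Set.toFinset_singleton]
      exact Finset.card_le_two))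
  simp only [Module.finrank_fintype_fun_eq_card, ι, Fintype.card_sum, Fintype.card_coe,
    Finset.card_compl, Finset.card_erase_of_mem hv₀] at h1 h2
  have h4 : 0 < (S.frontierVertices p).card := Finset.card_pos.2 ⟨v₀, hv₀⟩
  have h5 : (S.frontierAngles p).card ≤ Fintype.card (V × F) := Finset.card_le_univ _
  omega

/-- A partition into three connected classes meets at most one more face than vertices. -/
theorem Indecomposable.card_frontierFaces_le [Fintype V] [Fintype F] (hS : S.Indecomposable)
    (p : E → Fin 3) (hp : ∀ i, S.MedConn (p ⁻¹' {i})) :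
    (S.frontierFaces p).card ≤ (S.frontierVertices p).card + 1 := by
  have h1 := hS.two_mul_card_frontierFaces_le p
  rcases (S.frontierVertices p).eq_empty_or_nonempty with h | h
  · have : S.frontierAngles p = ∅ := by
      rw [Finset.eq_empty_iff_forall_notMem]
      intro a ha
      obtain ⟨e, he, e', he', hne⟩ := mem_frontierAngles.1 ha
      exact Finset.notMem_empty a.1 (h ▸ mem_frontierVertices.2 ⟨e, e', (mem_angle.1 he).1,
        (mem_angle.1 he').1, hne⟩)
    rw [this, Finset.card_empty] at h1
    omega
  · have := hS.card_frontierAngles_le p hp h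
    omega

end DualSystem

/-- In a tree, the branch at `r` towards another node `t` is entered through a single edge. -/
theorem SimpleGraph.IsTree.exists_branch {ι : Type} {T : SimpleGraph ι} (hT : T.IsTree) {r t : ι}
    (hrt : r ≠ t) : ∃ s, ∃ B : Set ι, T.dist s t < T.dist r t ∧ t ∈ B ∧ r ∉ B ∧
      ∀ i j, T.Adj i j → i ∈ B → j ∉ B → i = s ∧ j = r := by
  classical
  obtain ⟨w, hw, hlen⟩ := hT.connected.exists_path_of_dist r t
  cases w with
  | nil => exact (hrt rfl).elim
  | @cons _ s _ h p =>
    rw [SimpleGraph.Walk.cons_isPath_iff] at hw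
    have hbr := SimpleGraph.isBridge_iff.1 (SimpleGraph.isAcyclic_iff_forall_adj_isBridge.1
      hT.isAcyclic h)
    refine ⟨s, {i | (T.deleteEdges {s(r, s)}).Reachable s i}, ?_, ?_,
      fun hr => hbr hr.symm, ?_⟩
    · have := SimpleGraph.dist_le p
      rw [SimpleGraph.Walk.length_cons] at hlen
      omega
    · refine ⟨p.transfer _ fun e he => ?_⟩
      rw [SimpleGraph.edgeSet_deleteEdges]
      refine ⟨p.edges_subset_edgeSet he, fun h' => hw.2 ?_⟩
      have : e = s(r, s) := h'
      exact p.fst_mem_support_of_mem_edges (this ▸ he)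
    · intro i j hij hi hj
      have : s(i, j) = s(r, s) := by
        by_contra hne
        refine hj (SimpleGraph.Reachable.trans hi (SimpleGraph.Adj.reachable ?_))
        rw [SimpleGraph.deleteEdges_adj]
        exact ⟨hij, hne⟩
      rcases Sym2.eq_iff.1 this with ⟨rfl, rfl⟩ | ⟨rfl, rfl⟩
      · exact (hbr (SimpleGraph.Reachable.symm hi)).elim
      · exact ⟨rfl, rfl⟩

/-- A connected set of nodes meeting a branch and its complement contains the edge between. -/
theorem SimpleGraph.Connected.mem_of_branch {ι : Type} {T : SimpleGraph ι} {B C : Set ι} {r s : ι}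
    (hB : ∀ i j, T.Adj i j → i ∈ B → j ∉ B → i = s ∧ j = r) (hC : (T.induce C).Connected)
    {i j : ι} (hi : i ∈ C) (hiB : i ∈ B) (hj : j ∈ C) (hjB : j ∉ B) : s ∈ C ∧ r ∈ C := by
  obtain ⟨w⟩ := hC.preconnected ⟨i, hi⟩ ⟨j, hj⟩
  obtain ⟨d, -, hd, hd'⟩ := w.exists_boundary_dart {x | x.1 ∈ B} hiB hjB
  obtain ⟨h1, h2⟩ := hB d.fst.1 d.snd.1 d.adj hd hd'
  exact ⟨h1 ▸ d.fst.2, h2 ▸ d.snd.2⟩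

namespace DualSystem

variable {V E F : Type} [Fintype E] (S : DualSystem V E F)

/-- The vertices shared by an edge in `A` and an edge outside `A`. -/
def cutVertices (A : Set E) : Set V := {v | ∃ e ∈ A, ∃ e' ∉ A, v ∈ S.vs e ∧ v ∈ S.vs e'}

variable {S}

theorem Indecomposable.exists_med_compl [Fintype F] [Nontrivial F] (hS : S.Indecomposable)
    {A : Set E} (hA : A.Nonempty) (hA' : Aᶜ.Nonempty) : ∃ e ∈ A, ∃ e' ∉ A, S.Med e e' := by
  by_contra! hcon
  have := hS.eq_univ_of_med_closed hA fun e he e' hm => by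
    by_contra h
    exact hcon e he e' h hm
  rw [this] at hA'
  simp at hA'

/-- A set of at least two edges, connected and with connected complement, whose cut vertices
lie in a bag, splits into two such sets, with all cut vertices in a common bag. -/
theorem Indecomposable.exists_split [Fintype V] [Fintype F] [Nontrivial F] (hS : S.Indecomposable)
    {ι : Type} {T : SimpleGraph ι} (hT : T.IsTree) {bag : ι → Set V}
    (hbag : ∀ v, (T.induce {i | v ∈ bag i}).Connected)
    (hedge : ∀ e, ∃ i, (S.vs e : Set V) ⊆ bag i)
    {A : Set E} (hA : S.MedConn A) (hA' : S.MedConn Aᶜ) (hne : A.Nontrivial) (hne' : Aᶜ.Nonempty)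
    (hcut : ∃ i, S.cutVertices A ⊆ bag i) :
    ∃ X Y : Set E, X ∪ Y = A ∧ Disjoint X Y ∧ X.Nonempty ∧ Y.Nonempty ∧
      S.MedConn X ∧ S.MedConn Y ∧ S.MedConn Xᶜ ∧ S.MedConn Yᶜ ∧
      ∃ i, S.cutVertices X ⊆ bag i ∧ S.cutVertices Y ⊆ bag i := by
  obtain ⟨e₁, he₁, e₁', he₁', hm₁⟩ := hS.exists_med_compl hne.nonempty hne'
  obtain ⟨t, ht⟩ := hedge e₁
  obtain ⟨r, hr, hmin⟩ := (measure (T.dist · t)).wf.has_min {r | S.cutVertices A ⊆ bag r} hcut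
  simp only [Set.mem_ofPred_eq] at hr hmin
  let ρ : E → E → Prop := fun a b => ∃ v, v ∈ S.vs a ∧ v ∈ S.vs b ∧ v ∉ bag r
  let B : Set E := {x | Relation.ReflTransGen ρ e₁ x}
  have he₁B : e₁ ∈ B := .refl
  have hBstar : ∀ v ∉ bag r, ∀ e ∈ B, v ∈ S.vs e → ∀ e', v ∈ S.vs e' → e' ∈ B :=
    fun v hv e he hve e' hve' => Relation.ReflTransGen.tail he ⟨v, hve, hve', hv⟩
  have hAstar : ∀ v ∉ bag r, ∀ e ∈ A, v ∈ S.vs e → ∀ e', v ∈ S.vs e' → e' ∈ A :=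
    fun v hv e he hve e' hve' => by
      by_contra h
      exact hv (hr ⟨e, he, e', h, hve, hve'⟩)
  have hBA : B ⊆ A := by
    intro x hx
    replace hx : Relation.ReflTransGen ρ e₁ x := hx
    induction hx with
    | refl => exact he₁
    | tail _ h ih =>
      obtain ⟨v, hva, hvb, hv⟩ := h
      exact hAstar v hv _ ih hva _ hvb
  have hBconn : S.MedConn B := by
    rintro C ⟨x, hx, hxC⟩ hcl y hy
    have hsymm : ∀ a b, ρ a b → ρ b a := by
      rintro a b ⟨v, h1, h2, h3⟩
      exact ⟨v, h2, h1, h3⟩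
    have : Std.Symm ρ := ⟨hsymm⟩
    have hxy : Relation.ReflTransGen ρ x y := (Std.Symm.symm _ _ hx).trans hy
    clear hy
    induction hxy with
    | refl => exact hxC
    | @tail a b h1 h2 ih =>
      have haB : a ∈ B := Relation.ReflTransGen.trans hx h1
      obtain ⟨v, hva, hvb, hv⟩ := h2
      exact hS.star_subset ⟨a, ih, hva⟩ (fun e he hve e' hve' f hf hf' =>
        hcl e (hBstar v hv a haB hva e hve) he e' (hBstar v hv a haB hva e' hve')
          ⟨v, f, hve, hve', hf, hf'⟩) b hvb
  by_cases hcase : ∃ e₂ ∈ A \ B, ∃ e₂' ∉ A, S.Med e₂ e₂'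
  · obtain ⟨e₂, he₂, e₂', he₂', hm₂⟩ := hcase
    let q : E → E → Prop := fun a b => a ∈ A \ B ∧ b ∈ A \ B ∧ S.Med a b
    let Y : Set E := {x | Relation.ReflTransGen q e₂ x}
    have hYAB : Y ⊆ A \ B := fun x hx => by
      cases hx with
      | refl => exact he₂
      | tail _ h => exact h.2.1
    have hYcl : ∀ e ∈ Y, ∀ e' ∈ A \ B, S.Med e e' → e' ∈ Y := fun e he e' he' hm =>
      Relation.ReflTransGen.tail he ⟨hYAB he, he', hm⟩
    have hYconn : S.MedConn Y := medConn_reflTransGen (fun a b h => ⟨h.2.1, h.1, h.2.2.symm⟩)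
      (fun a b h => h.2.2) e₂
    have hXconn : S.MedConn (A \ Y) := hA.diff hBconn hBA ⟨e₁, he₁B⟩ hYAB hYcl
    have he₁X : e₁ ∈ A \ Y := ⟨he₁, fun h => (hYAB h).2 he₁B⟩
    have hYcut : ∀ v ∉ bag r, ∀ e ∈ Y, v ∈ S.vs e → ∀ e', v ∈ S.vs e' → e' ∈ Y :=
        fun v hv e he hve => by
      refine hS.star_subset ⟨e, he, hve⟩ fun a ha hva b hvb f hfa hfb =>
        hYcl a ha b ⟨hAstar v hv a (hYAB ha).1 hva b hvb, fun hb => (hYAB ha).2 ?_⟩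
          ⟨v, f, hva, hvb, hfa, hfb⟩
      exact hBstar v hv b hb hvb a hva
    refine ⟨A \ Y, Y, Set.sdiff_union_of_subset fun x hx => (hYAB hx).1, Set.disjoint_sdiff_left,
      ⟨e₁, he₁X⟩, ⟨e₂, .refl⟩, hXconn, hYconn, ?_, ?_, r, ?_, ?_⟩
    · rw [Set.compl_sdiff, Set.union_comm]
      exact hA'.union hYconn he₂' (show e₂ ∈ Y from .refl) hm₂.symm
    · have : Yᶜ = A \ Y ∪ Aᶜ := by
        ext x
        have := @hYAB x
        simp only [Set.mem_compl_iff, Set.mem_union, Set.mem_sdiff] at this ⊢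
        tauto
      rw [this]
      exact hXconn.union hA' he₁X he₁' hm₁
    · rintro v ⟨e, he, e', he', hve, hve'⟩
      by_contra hv
      refine he' ⟨hAstar v hv e he.1 hve e' hve', fun h => he.2 ?_⟩
      exact hYcut v hv e' h hve' e hve
    · rintro v ⟨e, he, e', he', hve, hve'⟩
      by_contra hv
      exact he' (hYcut v hv e he hve e' hve')
  · exfalso
    push Not at hcase
    have hin : ∀ e ∈ A, ∀ e' ∉ A, S.Med e e' → e ∈ B := fun e he e' he' hm => by
      by_contra h
      exact hcase e ⟨he, h⟩ e' he' hm
    by_cases hsub : (S.vs e₁ : Set V) ⊆ bag r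
    · have hB1 : ∀ x ∈ B, x = e₁ := fun x hx => by
        induction hx with
        | refl => rfl
        | tail _ h ih =>
          obtain ⟨v, hva, -, hv⟩ := h
          exact (hv (hsub (ih ▸ hva))).elim
      obtain ⟨e₃, he₃, hne₃⟩ := hne.exists_ne e₁
      exact he₁' (hS.medConn_compl_singleton e₁ A ⟨e₃, hne₃, he₃⟩ (fun e hee he e' _ hm => by
        by_contra h
        exact hee (hB1 e (hin e he e' h hm))) (show e₁' ∈ ({e₁}ᶜ : Set E) from fun h =>
          he₁' (Set.mem_singleton_iff.1 h ▸ he₁)))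
    · have hrt : r ≠ t := fun h => hsub (h ▸ ht)
      obtain ⟨s, D, hlt, htD, hrD, hD⟩ := hT.exists_branch hrt
      have hBD : ∀ e ∈ B, ∃ i ∈ D, (S.vs e : Set V) ⊆ bag i := fun e he => by
        induction he with
        | refl => exact ⟨t, htD, ht⟩
        | @tail a b _ h ih =>
          obtain ⟨v, hva, hvb, hv⟩ := h
          obtain ⟨i, hi, hai⟩ := ih
          obtain ⟨j, hj⟩ := hedge b
          refine ⟨j, ?_, hj⟩
          by_contra hjD
          exact hv (SimpleGraph.Connected.mem_of_branch hD (hbag v) (hai hva) hi (hj hvb) hjD).2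
      refine hmin s (fun u hu => ?_) hlt
      obtain ⟨i, hi, hui⟩ : ∃ i ∈ D, u ∈ bag i := by
        obtain ⟨e, he, e', he', hue, hue'⟩ := hu
        by_contra hno
        refine he' (hS.star_subset ⟨e, he, hue⟩ (fun a ha hua b hub f hfa hfb => ?_) e' hue')
        by_contra hb
        obtain ⟨i, hi, hai⟩ := hBD a (hin a ha b hb ⟨u, f, hua, hub, hfa, hfb⟩)
        exact hno ⟨i, hi, hai hua⟩
      exact (SimpleGraph.Connected.mem_of_branch hD (hbag u) hui hi (hr hu) hrD).1

end DualSystem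

namespace SimpleGraph

theorem Reachable.mem_of_closed {α : Type} {G : SimpleGraph α} {C : Set α} {a b : α}
    (h : G.Reachable a b) (hC : ∀ x ∈ C, ∀ y, G.Adj x y → y ∈ C) (ha : a ∈ C) : b ∈ C := by
  obtain ⟨w⟩ := h
  induction w with
  | nil => exact ha
  | cons hadj _ ih => exact ih (hC _ ha _ hadj)

theorem IsAcyclic.sum {α β : Type} {G : SimpleGraph α} {H : SimpleGraph β} (hG : G.IsAcyclic)
    (hH : H.IsAcyclic) : (G ⊕g H).IsAcyclic := by
  rw [isAcyclic_iff_forall_adj_isBridge] at hG hH ⊢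
  rintro (a | a) (b | b) hab
  · rw [isBridge_iff]
    intro hr
    obtain ⟨c, hc, hac⟩ := hr.mem_of_closed
      (C := {x | ∃ c, x = Sum.inl c ∧ (G.deleteEdges {s(a, b)}).Reachable a c}) (by
        rintro _ ⟨c, rfl, hc⟩ (d | d) hcd
        · refine ⟨d, rfl, hc.trans (Adj.reachable ?_)⟩
          simpa [deleteEdges_adj] using hcd
        · simp [deleteEdges_adj] at hcd) ⟨a, rfl, .refl _⟩
    obtain rfl := Sum.inl_injective hc
    exact isBridge_iff.1 (hG (by simpa using hab)) hac
  · simp at hab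
  · simp at hab
  · rw [isBridge_iff]
    intro hr
    obtain ⟨c, hc, hac⟩ := hr.mem_of_closed
      (C := {x | ∃ c, x = Sum.inr c ∧ (H.deleteEdges {s(a, b)}).Reachable a c}) (by
        rintro _ ⟨c, rfl, hc⟩ (d | d) hcd
        · simp [deleteEdges_adj] at hcd
        · refine ⟨d, rfl, hc.trans (Adj.reachable ?_)⟩
          simpa [deleteEdges_adj] using hcd) ⟨a, rfl, .refl _⟩
    obtain rfl := Sum.inr_injective hc
    exact isBridge_iff.1 (hH (by simpa using hab)) hac

theorem IsTree.sum_sup_edge {α β : Type} {G : SimpleGraph α} {H : SimpleGraph β} (hG : G.IsTree)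
    (hH : H.IsTree) (a : α) (b : β) : ((G ⊕g H) ⊔ edge (Sum.inl a) (Sum.inr b)).IsTree :=
  ⟨hG.connected.sum_sup_edge hH.connected,
    (hG.isAcyclic.sum hH.isAcyclic).sup_edge_of_not_reachable (not_reachable_sum_inl_inr a b)⟩

theorem Connected.induce_image {α β : Type} {G : SimpleGraph α} {H : SimpleGraph β} (φ : G →g H)
    {C : Set α} (hC : (G.induce C).Connected) : (H.induce (φ '' C)).Connected := by
  refine hC.map (induceHom φ (Set.mapsTo_image φ C)) ?_
  rintro ⟨_, x, hx, rfl⟩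
  exact ⟨⟨x, hx⟩, rfl⟩

end SimpleGraph

/-- The set `U` has a tree decomposition with bags of size at most `w`, each of the sets in `K`
being contained in a bag. -/
def HasTreeDecomp {F : Type} (U : Set F) (K : Set (Set F)) (w : ℕ) : Prop :=
  ∃ (ι : Type) (T : SimpleGraph ι) (bag : ι → Set F), T.IsTree ∧ (∀ i, bag i ⊆ U) ∧
    (∀ i, (bag i).ncard ≤ w) ∧ (∀ x ∈ U, (T.induce {i | x ∈ bag i}).Connected) ∧
    ∀ k ∈ K, ∃ i, k ⊆ bag i

namespace HasTreeDecomp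

variable {F : Type} {U U₁ U₂ S₁ S₂ : Set F} {K K₁ K₂ : Set (Set F)} {w : ℕ}

theorem mono (h : HasTreeDecomp U K₁ w) (hK : ∀ k ∈ K₂, ∃ k' ∈ K₁, k ⊆ k') :
    HasTreeDecomp U K₂ w := by
  obtain ⟨ι, T, bag, hT, hU, hw, hconn, hcov⟩ := h
  refine ⟨ι, T, bag, hT, hU, hw, hconn, fun k hk => ?_⟩
  obtain ⟨k', hk', hkk'⟩ := hK k hk
  obtain ⟨i, hi⟩ := hcov k' hk'
  exact ⟨i, hkk'.trans hi⟩

theorem of_ncard_le (hU : U.ncard ≤ w) (hK : ∀ k ∈ K, k ⊆ U) : HasTreeDecomp U K w := by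
  refine ⟨Unit, ⊥, fun _ => U, .of_subsingleton, fun _ => subset_rfl, fun _ => hU, fun x hx => ?_,
    fun k hk => ⟨(), hK k hk⟩⟩
  have : Nonempty {_i : Unit | x ∈ U} := ⟨⟨(), hx⟩⟩
  exact SimpleGraph.Connected.of_subsingleton

theorem join (h₁ : HasTreeDecomp U₁ K₁ w) (h₂ : HasTreeDecomp U₂ K₂ w) (hS₁ : S₁ ∈ K₁)
    (hS₂ : S₂ ∈ K₂) (hU₁ : U₁ ∩ U₂ ⊆ S₁) (hU₂ : U₁ ∩ U₂ ⊆ S₂) :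
    HasTreeDecomp (U₁ ∪ U₂) (K₁ ∪ K₂) w := by
  obtain ⟨ι₁, T₁, bag₁, hT₁, hsub₁, hw₁, hconn₁, hcov₁⟩ := h₁
  obtain ⟨ι₂, T₂, bag₂, hT₂, hsub₂, hw₂, hconn₂, hcov₂⟩ := h₂
  obtain ⟨a, ha⟩ := hcov₁ S₁ hS₁
  obtain ⟨b, hb⟩ := hcov₂ S₂ hS₂
  let T := (T₁ ⊕g T₂) ⊔ SimpleGraph.edge (Sum.inl a) (Sum.inr b)
  let φ₁ : T₁ →g T := ⟨Sum.inl, fun h => by simp [T, h]⟩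
  let φ₂ : T₂ →g T := ⟨Sum.inr, fun h => by simp [T, h]⟩
  refine ⟨ι₁ ⊕ ι₂, T, Sum.elim bag₁ bag₂, hT₁.sum_sup_edge hT₂ a b, ?_, ?_, fun x hx => ?_, ?_⟩
  · rintro (i | i)
    exacts [(hsub₁ i).trans Set.subset_union_left, (hsub₂ i).trans Set.subset_union_right]
  · rintro (i | i)
    exacts [hw₁ i, hw₂ i]
  · have hset : {i | x ∈ Sum.elim bag₁ bag₂ i} =
        φ₁ '' {i | x ∈ bag₁ i} ∪ φ₂ '' {i | x ∈ bag₂ i} := by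
      ext i
      rcases i with i | i <;> simp [φ₁, φ₂]
    rw [hset]
    by_cases h1 : x ∈ U₁
    · by_cases h2 : x ∈ U₂
      · have hab : T.Adj (Sum.inl a) (Sum.inr b) := by simp [T, SimpleGraph.edge]
        have ha' : Sum.inl a ∈ φ₁ '' {i | x ∈ bag₁ i} := ⟨a, ha (hU₁ ⟨h1, h2⟩), rfl⟩
        have hb' : Sum.inr b ∈ φ₂ '' {i | x ∈ bag₂ i} := ⟨b, hb (hU₂ ⟨h1, h2⟩), rfl⟩
        have := SimpleGraph.induce_union_connected
          (SimpleGraph.induce_union_connected ((hconn₁ x h1).induce_image φ₁).preconnected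
            (SimpleGraph.induce_pair_connected_of_adj hab).preconnected
            ⟨_, ha', .inl rfl⟩).preconnected
          ((hconn₂ x h2).induce_image φ₂).preconnected ⟨_, .inr (.inr rfl), hb'⟩
        have hun : φ₁ '' {i | x ∈ bag₁ i} ∪ φ₂ '' {i | x ∈ bag₂ i} =
            φ₁ '' {i | x ∈ bag₁ i} ∪ {Sum.inl a, Sum.inr b} ∪ φ₂ '' {i | x ∈ bag₂ i} := by
          rw [Set.union_assoc, Set.insert_union, Set.singleton_union, Set.insert_eq_of_mem hb',
            Set.union_insert, Set.insert_eq_of_mem (.inl ha')]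
        rw [hun]
        exact this
      · have : {i | x ∈ bag₂ i} = ∅ := Set.eq_empty_of_forall_notMem fun i hi => h2 (hsub₂ i hi)
        rw [this, Set.image_empty, Set.union_empty]
        exact (hconn₁ x h1).induce_image φ₁
    · have : {i | x ∈ bag₁ i} = ∅ := Set.eq_empty_of_forall_notMem fun i hi => h1 (hsub₁ i hi)
      rw [this, Set.image_empty, Set.empty_union]
      exact (hconn₂ x (hx.resolve_left h1)).induce_image φ₂
  · rintro k (hk | hk)
    · obtain ⟨i, hi⟩ := hcov₁ k hk
      exact ⟨.inl i, hi⟩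
    · obtain ⟨i, hi⟩ := hcov₂ k hk
      exact ⟨.inr i, hi⟩

end HasTreeDecomp

namespace DualSystem

variable {V E F : Type} [Fintype E] (S : DualSystem V E F)

/-- The faces of the edges in `A`. -/
def faces (A : Set E) : Set F := {f | ∃ e ∈ A, f ∈ S.fs e}

/-- The faces shared by an edge in `A` and an edge outside `A`. -/
def cutFaces (A : Set E) : Set F := {f | ∃ e ∈ A, ∃ e' ∉ A, f ∈ S.fs e ∧ f ∈ S.fs e'}

/-- The pairs of faces of the edges in `A`. -/
def facePairs (A : Set E) : Set (Set F) := (fun e => (S.fs e : Set F)) '' A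

variable {S}

theorem Indecomposable.hasTreeDecomp_faces [Fintype V] [Fintype F] [Nontrivial F]
    (hS : S.Indecomposable) {ι : Type} {T : SimpleGraph ι} (hT : T.IsTree) {bag : ι → Set V}
    (hbag : ∀ v, (T.induce {i | v ∈ bag i}).Connected)
    (hedge : ∀ e, ∃ i, (S.vs e : Set V) ⊆ bag i) {k : ℕ} (hk : ∀ i, (bag i).ncard ≤ k + 1)
    {A : Set E} (hA : S.MedConn A) (hA' : S.MedConn Aᶜ) (hne : A.Nonempty) (hne' : Aᶜ.Nonempty)
    (hcut : ∃ i, S.cutVertices A ⊆ bag i) :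
    HasTreeDecomp (S.faces A) (S.facePairs A ∪ {S.cutFaces A}) (k + 2) := by
  classical
  induction hn : A.ncard using Nat.strong_induction_on generalizing A with
  | _ n ih =>
  rcases A.subsingleton_or_nontrivial with hsub | hnt
  · obtain ⟨e, he⟩ := hne
    obtain rfl := hsub.eq_singleton_of_mem he
    have hfaces : S.faces {e} = (S.fs e : Set F) := by
      ext f
      simp [faces]
    refine .of_ncard_le ?_ ?_
    · rw [hfaces, Set.ncard_coe_finset, S.card_fs]
      omega
    · rintro _ (⟨e', rfl, rfl⟩ | rfl)
      · exact hfaces.ge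
      · rintro f ⟨e', he', -, -, hf, -⟩
        exact ⟨e', he', hf⟩
  obtain ⟨X, Y, hXY, hdisj, hX, hY, hXc, hYc, hXc', hYc', i, hXi, hYi⟩ :=
    hS.exists_split hT hbag hedge hA hA' hnt hne' hcut
  subst hXY
  rw [Set.disjoint_left] at hdisj
  obtain ⟨x, hx⟩ := hX
  obtain ⟨y, hy⟩ := hY
  obtain ⟨z, hz⟩ := hne'
  have hzX : z ∉ X := fun h => hz (.inl h)
  have hzY : z ∉ Y := fun h => hz (.inr h)
  have decX := ih _ (hn ▸ Set.ncard_lt_ncard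
    ⟨Set.subset_union_left, fun h => hdisj (h (.inr hy)) hy⟩) hXc hXc' ⟨x, hx⟩ ⟨z, hzX⟩ ⟨i, hXi⟩ rfl
  have decY := ih _ (hn ▸ Set.ncard_lt_ncard
    ⟨Set.subset_union_right, fun h => hdisj hx (h (.inl hx))⟩) hYc hYc' ⟨y, hy⟩
    ⟨z, hzY⟩ ⟨i, hYi⟩ rfl
  let p : E → Fin 3 := fun e => if e ∈ X then 0 else if e ∈ Y then 1 else 2
  have hp0 : ∀ e, p e = 0 ↔ e ∈ X := fun e => by
    simp only [p]
    split_ifs <;> simp_all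
  have hp1 : ∀ e, p e = 1 ↔ e ∈ Y := fun e => by
    have := @hdisj e
    simp only [p]
    split_ifs <;> simp_all
  have hp2 : ∀ e, p e = 2 ↔ e ∉ X ∪ Y := fun e => by
    simp only [p, Set.mem_union]
    split_ifs <;> simp_all
  have hpconn : ∀ j, S.MedConn (p ⁻¹' {j}) := fun j => by
    fin_cases j
    · convert! hXc
      ext e
      exact hp0 e
    · convert! hYc
      ext e
      exact hp1 e
    · convert! hA'
      ext e
      exact hp2 e
  have hmix : ∀ e e', p e ≠ p e' → (e ∈ X ∧ e' ∉ X ∨ e' ∈ X ∧ e ∉ X) ∨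
      (e ∈ Y ∧ e' ∉ Y ∨ e' ∈ Y ∧ e ∉ Y) := fun e e' h => by
    by_contra hcon
    refine h ?_
    have h1 : e ∈ X ↔ e' ∈ X := by tauto
    have h2 : e ∈ Y ↔ e' ∈ Y := by tauto
    simp only [p, h1, h2]
  have hXp : ∀ e e', e ∈ X → e' ∉ X → p e ≠ p e' := fun e e' he he' h =>
    he' ((hp0 e').1 (h ▸ (hp0 e).2 he))
  have hYp : ∀ e e', e ∈ Y → e' ∉ Y → p e ≠ p e' := fun e e' he he' h =>
    he' ((hp1 e').1 (h ▸ (hp1 e).2 he))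
  have hfr : (S.frontierVertices p : Set V) ⊆ bag i := fun v hv => by
    obtain ⟨e, e', hve, hve', hne⟩ := mem_frontierVertices.1 hv
    rcases hmix e e' hne with (h | h) | (h | h)
    exacts [hXi ⟨e, h.1, e', h.2, hve, hve'⟩, hXi ⟨e', h.1, e, h.2, hve', hve⟩,
      hYi ⟨e, h.1, e', h.2, hve, hve'⟩, hYi ⟨e', h.1, e, h.2, hve', hve⟩]
  have hcard : (S.frontierFaces p : Set F).ncard ≤ k + 2 := by
    have h1 := hS.card_frontierFaces_le p hpconn
    have h2 := Set.ncard_le_ncard hfr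
    rw [Set.ncard_coe_finset] at h2 ⊢
    have := hk i
    omega
  have decN : HasTreeDecomp (S.frontierFaces p : Set F) {(S.frontierFaces p : Set F)} (k + 2) :=
    .of_ncard_le hcard (by simp)
  have hNX : ∀ f ∈ S.faces X, f ∈ S.frontierFaces p → f ∈ S.cutFaces X := by
    rintro f ⟨e, he, hfe⟩ hf
    obtain ⟨a, b, ha, hb, hab⟩ := mem_frontierFaces.1 hf
    by_contra hcon
    have : ∀ c, f ∈ S.fs c → c ∈ X := fun c hc => by
      by_contra h
      exact hcon ⟨e, he, c, h, hfe, hc⟩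
    exact hab (((hp0 a).2 (this a ha)).trans ((hp0 b).2 (this b hb)).symm)
  have hNY : ∀ f ∈ S.faces Y, f ∈ S.frontierFaces p → f ∈ S.cutFaces Y := by
    rintro f ⟨e, he, hfe⟩ hf
    obtain ⟨a, b, ha, hb, hab⟩ := mem_frontierFaces.1 hf
    by_contra hcon
    have : ∀ c, f ∈ S.fs c → c ∈ Y := fun c hc => by
      by_contra h
      exact hcon ⟨e, he, c, h, hfe, hc⟩
    exact hab (((hp1 a).2 (this a ha)).trans ((hp1 b).2 (this b hb)).symm)
  have hXYN : ∀ f ∈ S.faces X, f ∈ S.faces Y → f ∈ S.frontierFaces p := by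
    rintro f ⟨e, he, hfe⟩ ⟨e', he', hfe'⟩
    exact mem_frontierFaces.2 ⟨e, e', hfe, hfe', hXp e e' he fun h => hdisj h he'⟩
  have decXN := decX.join decN (.inr rfl) rfl (fun f hf => hNX f hf.1 hf.2) fun f hf => hf.2
  have hdec := decXN.join decY (S₁ := (S.frontierFaces p : Set F)) (.inr rfl) (.inr rfl)
    (by
      rintro f ⟨hf | hf, hf'⟩
      exacts [hXYN f hf hf', hf])
    (by
      rintro f ⟨hf | hf, hf'⟩
      exacts [hNY f hf' (hXYN f hf hf'), hNY f hf' hf])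
  have hU : S.faces X ∪ (S.frontierFaces p : Set F) ∪ S.faces Y = S.faces (X ∪ Y) := by
    ext f
    constructor
    · rintro ((⟨e, he, hf⟩ | hf) | ⟨e, he, hf⟩)
      · exact ⟨e, .inl he, hf⟩
      · obtain ⟨a, b, ha, hb, hab⟩ := mem_frontierFaces.1 hf
        rcases hmix a b hab with (h | h) | (h | h)
        exacts [⟨a, .inl h.1, ha⟩, ⟨b, .inl h.1, hb⟩, ⟨a, .inr h.1, ha⟩, ⟨b, .inr h.1, hb⟩]
      · exact ⟨e, .inr he, hf⟩
    · rintro ⟨e, he | he, hf⟩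
      exacts [.inl (.inl ⟨e, he, hf⟩), .inr ⟨e, he, hf⟩]
  rw [hU] at hdec
  refine hdec.mono ?_
  rintro _ (⟨e, he | he, rfl⟩ | rfl)
  · exact ⟨_, .inl (.inl (.inl ⟨e, he, rfl⟩)), subset_rfl⟩
  · exact ⟨_, .inr (.inl ⟨e, he, rfl⟩), subset_rfl⟩
  · refine ⟨_, .inl (.inr rfl), ?_⟩
    rintro f ⟨e, he, e', he', hfe, hfe'⟩
    refine mem_frontierFaces.2 ⟨e, e', hfe, hfe', fun h => ?_⟩
    exact (hp2 e).1 (h.trans ((hp2 e').2 he')) he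

/-- The dual graph of an indecomposable system has a tree decomposition whose width exceeds that of
a given decomposition of the graph by at most one. -/
theorem Indecomposable.hasTreeDecomp [Fintype V] [Fintype F] [Nontrivial F]
    (hS : S.Indecomposable) {ι : Type} {T : SimpleGraph ι} (hT : T.IsTree) {bag : ι → Set V}
    (hbag : ∀ v, (T.induce {i | v ∈ bag i}).Connected)
    (hedge : ∀ e, ∃ i, (S.vs e : Set V) ⊆ bag i) {k : ℕ} (hk : ∀ i, (bag i).ncard ≤ k + 1) :
    HasTreeDecomp Set.univ (S.facePairs Set.univ) (k + 2) := by
  classical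
  obtain ⟨f₀, -⟩ := exists_pair_ne F
  obtain ⟨e₀, -⟩ := hS.exists_mem_fs f₀
  have hother : ∀ f ∈ S.fs e₀, ∃ e ≠ e₀, f ∈ S.fs e := fun f hf => by
    obtain ⟨u, v, -, hvs⟩ := S.exists_vs e₀
    obtain ⟨e, he, hang⟩ := hS.exists_angle ((hvs u).2 (.inl rfl)) hf
    have : e ∈ S.angle u f := by simp [hang]
    exact ⟨e, he, (mem_angle.1 this).2⟩
  have hne : ({e₀}ᶜ : Set E).Nonempty := by
    obtain ⟨f, g, -, hfs⟩ := S.exists_fs e₀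
    obtain ⟨e, he, -⟩ := hother f ((hfs f).2 (.inl rfl))
    exact ⟨e, he⟩
  have hdec := hS.hasTreeDecomp_faces hT hbag hedge hk (hS.medConn_compl_singleton e₀)
    (by rw [compl_compl]; exact .singleton e₀) hne (by simp) (by
      obtain ⟨i, hi⟩ := hedge e₀
      refine ⟨i, ?_⟩
      rintro v ⟨-, -, e', he', -, hv⟩
      rw [Set.mem_compl_iff, not_not] at he'
      obtain rfl : e' = e₀ := he'
      exact hi hv)
  have hU : S.faces {e₀}ᶜ = Set.univ := by
    refine Set.eq_univ_of_forall fun f => ?_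
    obtain ⟨e, he⟩ := hS.exists_mem_fs f
    by_cases h : e = e₀
    · obtain ⟨e', he', hf⟩ := hother f (h ▸ he)
      exact ⟨e', he', hf⟩
    · exact ⟨e, h, he⟩
  rw [hU] at hdec
  refine hdec.mono ?_
  rintro _ ⟨e, -, rfl⟩
  by_cases h : e = e₀
  · subst h
    refine ⟨_, .inr rfl, fun f hf => ?_⟩
    obtain ⟨e', he', hf'⟩ := hother f hf
    exact ⟨e', he', e, by simp, hf', hf⟩
  · exact ⟨_, .inl ⟨e, h, rfl⟩, subset_rfl⟩

end DualSystem

namespace HasTreeDecomp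

variable {F F' : Type} {U : Set F} {K : Set (Set F)} {w : ℕ}

theorem image (h : HasTreeDecomp U K w) {φ : F → F'} (hφ : Function.Injective φ) :
    HasTreeDecomp (φ '' U) (Set.image φ '' K) w := by
  obtain ⟨ι, T, bag, hT, hU, hw, hconn, hcov⟩ := h
  refine ⟨ι, T, fun i => φ '' bag i, hT, fun i => Set.image_mono (hU i), fun i => ?_, ?_, ?_⟩
  · rw [Set.ncard_image_of_injective _ hφ]
    exact hw i
  · rintro _ ⟨x, hx, rfl⟩
    have : {i | φ x ∈ φ '' bag i} = {i | x ∈ bag i} := Set.ext fun i => hφ.mem_set_image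
    rw [this]
    exact hconn x hx
  · rintro _ ⟨k, hk, rfl⟩
    obtain ⟨i, hi⟩ := hcov k hk
    exact ⟨i, Set.image_mono hi⟩

theorem insert (h : HasTreeDecomp U K w) {s : Set F} (hs : s.Subsingleton) (hsU : s ⊆ U) :
    HasTreeDecomp U (insert s K) w := by
  obtain ⟨ι, T, bag, hT, hU, hw, hconn, hcov⟩ := h
  refine ⟨ι, T, bag, hT, hU, hw, hconn, ?_⟩
  rintro k (rfl | hk)
  · rcases hs.eq_empty_or_singleton with rfl | ⟨x, rfl⟩
    · obtain ⟨i⟩ := hT.connected.nonempty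
      exact ⟨i, Set.empty_subset _⟩
    · obtain ⟨i, hi⟩ := (hconn x (hsU rfl)).nonempty
      exact ⟨i, Set.singleton_subset_iff.2 hi⟩
  · exact hcov k hk

end HasTreeDecomp

namespace DualSystem

variable {V E F : Type} [Fintype E] (S : DualSystem V E F)

open scoped Classical in
theorem sum_subtype_vs (p : E → Prop) (z : E → ZMod 2) (hz : ∀ e, ¬ p e → z e = 0) (v : V) :
    ∑ e : Subtype p with v ∈ S.vs e.1, z e.1 = ∑ e with v ∈ S.vs e, z e := by
  refine Finset.sum_of_injOn Subtype.val Subtype.val_injective.injOn ?_ ?_ fun _ _ => rfl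
  · intro e he
    simpa using he
  · intro e he hne
    refine hz e fun h => hne ⟨⟨e, h⟩, ?_, rfl⟩
    simpa using he

open scoped Classical in
/-- The part of a system on one side of a separation of the faces along at most one face. -/
noncomputable def restrict {A B : Set F} (hAB : (A ∩ B).Subsingleton)
    (he : ∀ e, (S.fs e : Set F) ⊆ A ∨ (S.fs e : Set F) ⊆ B) :
    DualSystem V {e // (S.fs e : Set F) ⊆ A} A where
  vs e := S.vs e
  fs e := (S.fs e.1).subtype (· ∈ A)
  card_vs e := S.card_vs e
  card_fs e := by
    rw [Finset.card_subtype, Finset.filter_true_of_mem fun f hf => e.2 hf, S.card_fs]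
  even_iff z := by
    let z' : E → ZMod 2 := fun e => if h : (S.fs e : Set F) ⊆ A then z ⟨e, h⟩ else 0
    have hz' : ∀ e : {e // (S.fs e : Set F) ⊆ A}, z' e = z e := fun e => dif_pos e.2
    have hsum : ∀ (t : F → ZMod 2) (e : {e // (S.fs e : Set F) ⊆ A}),
        ∑ f ∈ (S.fs e.1).subtype (· ∈ A), t f = ∑ f ∈ S.fs e, t f := fun t e =>
      Finset.sum_subtype_of_mem t fun f hf => e.2 hf
    simp_rw [← hz', S.sum_subtype_vs _ z' fun e h => dif_neg h, S.even_iff]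
    constructor
    · rintro ⟨t, ht⟩
      exact ⟨fun f => t f, fun e => by rw [hsum t, ht]⟩
    · rintro ⟨t, ht⟩
      obtain ⟨c, hc⟩ : ∃ c, ∀ f : A, f.1 ∈ B → t f = c := by
        by_cases h : ∃ f : A, f.1 ∈ B
        · obtain ⟨f, hf⟩ := h
          exact ⟨t f, fun g hg => congrArg t (Subtype.ext (hAB ⟨g.2, hg⟩ ⟨f.2, hf⟩))⟩
        · exact ⟨0, fun f hf => (h ⟨f, hf⟩).elim⟩
      let t' : F → ZMod 2 := fun f => if h : f ∈ A then t ⟨f, h⟩ else c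
      have ht' : ∀ f : A, t' f = t f := fun f => dif_pos f.2
      refine ⟨t', fun e => ?_⟩
      by_cases h : (S.fs e : Set F) ⊆ A
      · rw [← hsum t' ⟨e, h⟩, ht ⟨e, h⟩]
        simp_rw [ht']
      · have hB : ∀ f ∈ S.fs e, t' f = c := fun f hf => by
          by_cases hfA : f ∈ A
          · exact (dif_pos hfA).trans (hc ⟨f, hfA⟩ ((he e).resolve_left h hf))
          · exact dif_neg hfA
        rw [Finset.sum_congr rfl hB, Finset.sum_const, S.card_fs, two_nsmul, ZMod.two_add_self]
        exact dif_neg h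
  exists_circuit z hz hev := by
    let z' : E → ZMod 2 := fun e => if h : (S.fs e : Set F) ⊆ A then z ⟨e, h⟩ else 0
    have hz' : ∀ e : {e // (S.fs e : Set F) ⊆ A}, z' e = z e := fun e => dif_pos e.2
    simp_rw [← hz', S.sum_subtype_vs _ z' fun e h => dif_neg h] at hev
    obtain ⟨c, hc0, hc, hcz, hdeg⟩ := S.exists_circuit z'
      (fun h => hz (funext fun e => (hz' e).symm.trans (congrFun h e))) hev
    have hc' : ∀ e, ¬ (S.fs e : Set F) ⊆ A → c e = 0 := fun e h =>
      by_contra fun h' => hcz e h' (dif_neg h)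
    refine ⟨fun e => c e, fun h => hc0 (funext fun e => ?_), fun v => ?_, fun e h => ?_,
      fun v => ?_⟩
    · by_cases h' : (S.fs e : Set F) ⊆ A
      exacts [congrFun h ⟨e, h'⟩, hc' e h']
    · rw [S.sum_subtype_vs _ c hc', hc]
    · rw [← hz']
      exact hcz _ h
    · refine le_trans (Finset.card_le_card_of_injOn Subtype.val (fun e h => ?_)
        Subtype.val_injective.injOn) (hdeg v)
      simpa using h

open scoped Classical in
theorem image_facePairs_restrict {A B : Set F} (hAB : (A ∩ B).Subsingleton)
    (he : ∀ e, (S.fs e : Set F) ⊆ A ∨ (S.fs e : Set F) ⊆ B) {e : E} (h : (S.fs e : Set F) ⊆ A) :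
    (S.fs e : Set F) ∈ Set.image Subtype.val '' (S.restrict hAB he).facePairs Set.univ := by
  refine ⟨_, ⟨⟨e, h⟩, trivial, rfl⟩, ?_⟩
  ext f
  simpa [restrict] using fun hf => h hf

/-- The dual graph of a system has a tree decomposition whose width exceeds that of a given
decomposition of the graph by at most one. -/
theorem hasTreeDecomp [Fintype V] [Fintype F] {ι : Type} {T : SimpleGraph ι} (hT : T.IsTree)
    {bag : ι → Set V} (hbag : ∀ v, (T.induce {i | v ∈ bag i}).Connected)
    (hedge : ∀ e, ∃ i, (S.vs e : Set V) ⊆ bag i) {k : ℕ} (hk : ∀ i, (bag i).ncard ≤ k + 1) :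
    HasTreeDecomp Set.univ (S.facePairs Set.univ) (k + 2) := by
  classical
  obtain ⟨n, hn⟩ : ∃ n, Fintype.card F = n := ⟨_, rfl⟩
  induction n using Nat.strong_induction_on generalizing E F with
  | _ n ih =>
  rcases subsingleton_or_nontrivial F with hF | hF
  · refine .of_ncard_le ?_ fun _ _ => Set.subset_univ _
    rw [Set.ncard_univ, Nat.card_eq_fintype_card]
    have := Fintype.card_le_one_iff_subsingleton.2 hF
    omega
  by_cases hS : S.Indecomposable
  · exact hS.hasTreeDecomp hT hbag hedge hk
  have hpart : ∀ A B : Set F, (A ∩ B).Subsingleton → A ≠ Set.univ →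
      (∀ e, (S.fs e : Set F) ⊆ A ∨ (S.fs e : Set F) ⊆ B) →
      HasTreeDecomp A (insert (A ∩ B) {s | ∃ e, s = (S.fs e : Set F) ∧ s ⊆ A}) (k + 2) := by
    intro A B hAB hA he
    have hlt : Fintype.card A < n := by
      rw [← hn]
      exact Fintype.card_subtype_lt (p := (· ∈ A))
        ((Set.ne_univ_iff_exists_notMem A).1 hA).choose_spec
    have h := ((ih _ hlt (S.restrict hAB he) (fun e => hedge e.1) rfl).image
      Subtype.val_injective).insert (s := A ∩ B) hAB (by simp)
    rw [Set.image_univ, Subtype.range_coe] at h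
    refine h.mono ?_
    rintro _ (rfl | ⟨e, rfl, h⟩)
    exacts [⟨_, .inl rfl, subset_rfl⟩, ⟨_, .inr (S.image_facePairs_restrict hAB he h), subset_rfl⟩]
  unfold Indecomposable at hS
  push Not at hS
  obtain ⟨A, B, hun, hAB, he, hA, hB⟩ := hS
  have h := (hpart A B hAB hA he).join
    (hpart B A (Set.inter_comm A B ▸ hAB) hB fun e => (he e).symm) (.inl rfl) (.inl rfl)
    subset_rfl (Set.inter_comm A B).le
  rw [hun] at h
  refine h.mono ?_
  rintro _ ⟨e, -, rfl⟩
  rcases he e with h | h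
  exacts [⟨_, .inl (.inr ⟨e, rfl, h⟩), subset_rfl⟩, ⟨_, .inr (.inr ⟨e, rfl, h⟩), subset_rfl⟩]

end DualSystem

theorem exists_isTreeDecomp_ncard_le {V : Type} [Finite V] (G : SimpleGraph V) :
    ∃ D : Decomp V, IsTreeDecomp G D ∧ ∀ i, (D.bag i).ncard ≤ treewidth G + 1 := by
  refine Nat.sInf_mem (s := {k | ∃ D : Decomp V, IsTreeDecomp G D ∧ ∀ i, (D.bag i).ncard ≤ k + 1})
    ⟨Nat.card V, ⟨Unit, ⊥, .of_subsingleton, fun _ => univ⟩,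
      ⟨fun v => ⟨(), trivial⟩, fun u v _ => ⟨(), trivial, trivial⟩, fun v => ?_⟩, fun i => ?_⟩
  · have : Nonempty {_i : Unit | v ∈ (univ : Set V)} := ⟨⟨(), trivial⟩⟩
    exact SimpleGraph.Connected.of_subsingleton
  · rw [ncard_univ]
    exact Nat.le_succ _

namespace PlaneEmbedding

variable {V : Type} {G : SimpleGraph V} (P : PlaneEmbedding G)

theorem exists_mem_dualSystem_fs [Fintype V] {f g : P.Face} (hne : f ≠ g) {e : G.edgeSet}
    (hf : P.Borders e f) (hg : P.Borders e g) :
    ∃ e, f ∈ P.dualSystem.fs e ∧ g ∈ P.dualSystem.fs e := by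
  obtain ⟨f', g', h⟩ := P.exists_sides e
  have hne' : f' ≠ g' := by
    rintro rfl
    exact hne (((h f).1 hf).elim id id |>.trans (((h g).1 hg).elim id id).symm)
  exact ⟨⟨e, f', g', hne', h⟩, P.mem_dualSystem_fs.2 hf, P.mem_dualSystem_fs.2 hg⟩

end PlaneEmbedding

/-- The treewidth of the weak dual of a plane graph is at most the
treewidth of the graph plus one. -/
theorem treewidth_weakDual_le {V : Type} [Fintype V]
    {G : SimpleGraph V} (P : PlaneEmbedding G) :
    treewidth P.weakDual ≤ treewidth G + 1 := by
  obtain ⟨D, ⟨-, hadj, hconn⟩, hcard⟩ := exists_isTreeDecomp_ncard_le G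
  obtain ⟨ι, T, bag, hT, -, hw, hbag, hcov⟩ := P.dualSystem.hasTreeDecomp D.isTree hconn
    (fun e => by
      obtain ⟨⟨e, he⟩, h⟩ := e
      induction e with | _ u v => ?_
      obtain ⟨i, hu, hv⟩ := hadj u v he
      refine ⟨i, fun w hw => ?_⟩
      rcases Sym2.mem_iff.1 (P.mem_dualSystem_vs.1 hw) with rfl | rfl
      exacts [hu, hv]) hcard
  let φ : {f // P.IsBoundedFace f} → P.Face := fun f => ⟨f.1, f.2.1⟩
  have hφ : Function.Injective φ := fun f g h => Subtype.ext (Subtype.mk.inj h)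
  refine Nat.sInf_le ⟨⟨ι, T, hT, fun i => φ ⁻¹' bag i⟩, ⟨fun f => ?_, fun f g hfg => ?_, fun f =>
    hbag (φ f) trivial⟩, fun i => ?_⟩
  · obtain ⟨i, hi⟩ := (hbag (φ f) trivial).nonempty
    exact ⟨i, hi⟩
  · obtain ⟨hne, h⟩ := (SimpleGraph.fromRel_adj _ f g).1 hfg
    obtain ⟨e, hf, hg⟩ : ∃ e, P.Borders e (φ f) ∧ P.Borders e (φ g) := by
      rcases h with ⟨e, h1, h2⟩ | ⟨e, h1, h2⟩
      exacts [⟨e, h1, h2⟩, ⟨e, h2, h1⟩]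
    obtain ⟨d, hdf, hdg⟩ := P.exists_mem_dualSystem_fs (hφ.ne hne) hf hg
    obtain ⟨i, hi⟩ := hcov _ ⟨d, trivial, rfl⟩
    exact ⟨i, hi hdf, hi hdg⟩
  · calc (φ ⁻¹' bag i).ncard = (φ '' (φ ⁻¹' bag i)).ncard := (ncard_image_of_injective _ hφ).symm
      _ ≤ (bag i).ncard := ncard_le_ncard (image_preimage_subset _ _)
      _ ≤ _ := hw i
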